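/- arXiv:2102.00113 — 5 statements merged into one kernel-verified Lean document; each statement's English description precedes it below -/
import Mathlib

section
/- Strict conditional positive definiteness of generalized multiquadric functions: let d ≥ 1 be an integer, let β > 0 be a real number that is not an integer, let ε > 0, and let m = ⌈β⌉. Then for every finite collection of pairwise distinct points x₁, …, x_N ∈ ℝ^d (N ≥ 1) and every nonzero vector c ∈ ℝ^N satisfying Σ_{i=1}^{N} c_i q(x_i) = 0 for every real polynomial q in d variables of total degree less than m, one has (−1)^m · Σ_{i=1}^{N} Σ_{j=1}^{N} c_i c_j (1 + ε² |x_i − x_j|²)^{β} > 0. -/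
open MeasureTheory Real

/-- Alternating remainder of the exponential series. -/
noncomputable def gmqG : ℕ → ℝ → ℝ
  | 0, u => Real.exp (-u)
  | (m + 1), u => u ^ m / (m.factorial : ℝ) - gmqG m u

lemma gmqG_deriv (m : ℕ) : ∀ u : ℝ, HasDerivAt (gmqG (m + 1)) (gmqG m u) u := by
  induction m with
  | zero =>
    intro u
    have h : HasDerivAt (fun u : ℝ => u ^ 0 / ((Nat.factorial 0 : ℕ) : ℝ) - Real.exp (-u))
        (Real.exp (-u)) u := by
      have h1 := ((hasDerivAt_id u).neg.exp).const_sub (1 : ℝ)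
      simpa using h1
    exact h
  | succ m ih =>
    intro u
    have h : HasDerivAt (fun u : ℝ => u ^ (m + 1) / ((Nat.factorial (m + 1) : ℕ) : ℝ) -
        gmqG (m + 1) u) (u ^ m / (m.factorial : ℝ) - gmqG m u) u := by
      have h1 := ((hasDerivAt_pow (m + 1) u).div_const ((Nat.factorial (m + 1) : ℕ) : ℝ)).sub (ih u)
      refine h1.congr_deriv ?_
      congr 1
      rw [Nat.factorial_succ]
      have := Nat.factorial_ne_zero m
      push_cast
      have h2 : (m.factorial : ℝ) ≠ 0 := by exact_mod_cast this
      have h3 : (m : ℝ) + 1 ≠ 0 := by positivity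
      field_simp
    exact h

lemma gmqG_continuous (m : ℕ) : Continuous (gmqG m) := by
  cases m with
  | zero =>
    show Continuous (fun u : ℝ => Real.exp (-u))
    fun_prop
  | succ m => exact continuous_iff_continuousAt.2 fun u => (gmqG_deriv m u).continuousAt

lemma gmqG_zero (m : ℕ) : gmqG (m + 1) 0 = 0 := by
  induction m with
  | zero => simp [gmqG]
  | succ m ih => rw [gmqG, ih]; simp

lemma gmqG_pos (m : ℕ) : ∀ u : ℝ, 0 < u → 0 < gmqG m u := by
  induction m with
  | zero => intro u _; exact Real.exp_pos _
  | succ m ih =>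
    intro u hu
    have hmono : StrictMonoOn (gmqG (m + 1)) (Set.Ici 0) := by
      apply strictMonoOn_of_deriv_pos (convex_Ici 0) (gmqG_continuous _).continuousOn
      intro y hy
      rw [interior_Ici] at hy
      rw [(gmqG_deriv m y).deriv]
      exact ih y hy
    have := hmono (Set.mem_Ici.2 le_rfl) (Set.mem_Ici.2 hu.le) hu
    rwa [gmqG_zero] at this

lemma gmqG_le (m : ℕ) (u : ℝ) (hu : 0 < u) : gmqG m u ≤ u ^ m / (m.factorial : ℝ) := by
  have := gmqG_pos (m + 1) u hu
  rw [gmqG] at this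
  linarith

lemma gmqG_le' (m : ℕ) (u : ℝ) (hu : 0 < u) : gmqG (m + 1) u ≤ u ^ m / (m.factorial : ℝ) := by
  have := gmqG_pos m u hu
  rw [gmqG]
  linarith

lemma gmqG_integrable (m : ℕ) (β : ℝ) (h1 : (m : ℝ) < β) (h2 : β < m + 1) :
    IntegrableOn (fun u : ℝ => gmqG (m + 1) u * u ^ (-β - 1)) (Set.Ioi 0) := by
  have hmeas : AEStronglyMeasurable (fun u : ℝ => gmqG (m + 1) u * u ^ (-β - 1)) volume :=
    ((gmqG_continuous (m + 1)).measurable.mul (measurable_id.pow_const _)).aestronglyMeasurable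
  rw [← Set.Ioc_union_Ioi_eq_Ioi (zero_le_one' ℝ)]
  apply IntegrableOn.union
  · have hI : IntegrableOn (fun u : ℝ => u ^ ((m : ℝ) - β)) (Set.Ioc 0 1) := by
      rw [← intervalIntegrable_iff_integrableOn_Ioc_of_le zero_le_one]
      exact intervalIntegral.intervalIntegrable_rpow' (by linarith)
    refine Integrable.mono' (hI.const_mul (1 / ((m + 1).factorial : ℝ))) hmeas.restrict ?_
    refine (ae_restrict_iff' measurableSet_Ioc).2 (Filter.Eventually.of_forall ?_)
    intro u hu
    have hu0 : 0 < u := hu.1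
    rw [Real.norm_of_nonneg (mul_nonneg (gmqG_pos _ u hu0).le (Real.rpow_nonneg hu0.le _))]
    calc _ ≤ u ^ (m + 1) / ((m + 1).factorial : ℝ) * u ^ (-β - 1) :=
          mul_le_mul_of_nonneg_right (gmqG_le _ u hu0) (Real.rpow_nonneg hu0.le _)
      _ = _ := by
        have : u ^ ((m : ℝ) - β) = u ^ (m + 1) * u ^ (-β - 1) := by
          rw [← Real.rpow_natCast, ← Real.rpow_add hu0]; congr 1; push_cast; ring
        rw [this]; ring
  · have hI : IntegrableOn (fun u : ℝ => u ^ ((m : ℝ) - β - 1)) (Set.Ioi 1) :=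
      integrableOn_Ioi_rpow_of_lt (by linarith) one_pos
    refine Integrable.mono' (hI.const_mul (1 / (m.factorial : ℝ))) hmeas.restrict ?_
    refine (ae_restrict_iff' measurableSet_Ioi).2 (Filter.Eventually.of_forall ?_)
    intro u hu
    have hu0 : 0 < u := lt_trans one_pos hu
    rw [Real.norm_of_nonneg (mul_nonneg (gmqG_pos _ u hu0).le (Real.rpow_nonneg hu0.le _))]
    calc _ ≤ u ^ m / (m.factorial : ℝ) * u ^ (-β - 1) :=
          mul_le_mul_of_nonneg_right (gmqG_le' _ u hu0) (Real.rpow_nonneg hu0.le _)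
      _ = _ := by
        have : u ^ ((m : ℝ) - β - 1) = u ^ m * u ^ (-β - 1) := by
          rw [← Real.rpow_natCast, ← Real.rpow_add hu0]; congr 1; ring
        rw [this]; ring

lemma gmq_integral_pos (f : ℝ → ℝ) (hf : IntegrableOn f (Set.Ioi 0)) (hp : ∀ u, 0 < u → 0 < f u) :
    0 < ∫ u in Set.Ioi (0 : ℝ), f u := by
  rw [setIntegral_pos_iff_support_of_nonneg_ae _ hf]
  · have : Function.support f ∩ Set.Ioi 0 = Set.Ioi 0 :=
      Set.inter_eq_right.2 fun u hu => (hp u hu).ne'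
    rw [this]; simp
  · exact (ae_restrict_iff' measurableSet_Ioi).2
      (Filter.Eventually.of_forall fun u hu => (hp u hu).le)

lemma gmq_scale (m : ℕ) (β t : ℝ) (ht : 0 < t) {u : ℝ} (hu : 0 < u) :
    gmqG (m + 1) (u * t) * u ^ (-β - 1) =
      t ^ (β + 1) * (gmqG (m + 1) (u * t) * (u * t) ^ (-β - 1)) := by
  rw [Real.mul_rpow hu.le ht.le]
  have : t ^ (β + 1) * t ^ (-β - 1) = 1 := by
    rw [← Real.rpow_add ht]; simp
  linear_combination (-gmqG (m + 1) (u * t) * u ^ (-β - 1)) * this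

lemma gmq_scale_integrable (m : ℕ) (β : ℝ) (h1 : (m : ℝ) < β) (h2 : β < m + 1) (t : ℝ)
    (ht : 0 < t) :
    IntegrableOn (fun u : ℝ => gmqG (m + 1) (u * t) * u ^ (-β - 1)) (Set.Ioi 0) := by
  have h := (integrableOn_Ioi_comp_mul_right_iff
    (fun u : ℝ => gmqG (m + 1) u * u ^ (-β - 1)) 0 ht).2 (by
      simpa using gmqG_integrable m β h1 h2)
  have h' : IntegrableOn (fun u : ℝ => t ^ (β + 1) *
      (gmqG (m + 1) (u * t) * (u * t) ^ (-β - 1))) (Set.Ioi 0) := h.const_mul (t ^ (β + 1))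
  refine h'.congr_fun ?_ measurableSet_Ioi
  intro u hu
  exact (gmq_scale m β t ht hu).symm

lemma gmq_scale_integral (m : ℕ) (β : ℝ) (t : ℝ) (ht : 0 < t) :
    ∫ u in Set.Ioi (0 : ℝ), gmqG (m + 1) (u * t) * u ^ (-β - 1) =
      t ^ β * ∫ u in Set.Ioi (0 : ℝ), gmqG (m + 1) u * u ^ (-β - 1) := by
  rw [setIntegral_congr_fun measurableSet_Ioi (fun u hu => gmq_scale m β t ht hu),
    integral_const_mul,
    integral_comp_mul_right_Ioi (fun u : ℝ => gmqG (m + 1) u * u ^ (-β - 1)) 0 ht]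
  rw [zero_mul, smul_eq_mul, ← mul_assoc, Real.rpow_add_one ht.ne']
  field_simp

section
variable {d N : ℕ} (x : Fin N → EuclideanSpace ℝ (Fin d)) (c : Fin N → ℝ)

lemma gmq_inner_pow (n : ℕ) :
    ∑ i, ∑ j, c i * c j * (inner ℝ (x i) (x j)) ^ n =
      ∑ f : Fin n → Fin d, (∑ i, c i * ∏ k, x i (f k)) ^ 2 := by
  have h : ∀ i j, (inner ℝ (x i) (x j) : ℝ) ^ n =
      ∑ f : Fin n → Fin d, (∏ k, x i (f k)) * ∏ k, x j (f k) := by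
    intro i j
    have : (inner ℝ (x i) (x j) : ℝ) = ∑ k, x i k * x j k := by
      simp [PiLp.inner_apply, mul_comm]
    rw [this, ← Fin.prod_const, Finset.prod_univ_sum]
    simp [Finset.prod_mul_distrib]
  simp_rw [h, Finset.mul_sum, sq, Finset.sum_mul_sum]
  symm
  rw [Finset.sum_comm]
  refine Finset.sum_congr rfl fun i _ => ?_
  rw [Finset.sum_comm]
  exact Finset.sum_congr rfl fun j _ => Finset.sum_congr rfl fun f _ => by ring

lemma gmq_moments_zero (hx : Function.Injective x)
    (h : ∀ (n : ℕ) (f : Fin n → Fin d), ∑ i, c i * ∏ k, x i (f k) = 0) : c = 0 := by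
  have hpoly : ∀ q : MvPolynomial (Fin d) ℝ,
      ∑ i, c i * MvPolynomial.eval (fun j => x i j) q = 0 := by
    have key : ∀ (q : MvPolynomial (Fin d) ℝ) (n : ℕ) (f : Fin n → Fin d),
        ∑ i, c i * (MvPolynomial.eval (fun j => x i j) q * ∏ k, x i (f k)) = 0 := by
      intro q
      induction q using MvPolynomial.induction_on with
      | C a =>
        intro n f
        have := congrArg (fun z => a * z) (h n f)
        simp only [Finset.mul_sum, mul_zero] at this
        rw [← this]
        exact Finset.sum_congr rfl fun i _ => by simp; ring
      | add p q hp hq =>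
        intro n f
        have := congrArg₂ (· + ·) (hp n f) (hq n f)
        simp only [← Finset.sum_add_distrib, add_zero] at this
        rw [← this]
        exact Finset.sum_congr rfl fun i _ => by simp; ring
      | mul_X p k hp =>
        intro n f
        rw [← hp (n + 1) (Fin.cons k f)]
        exact Finset.sum_congr rfl fun i _ => by
          simp only [map_mul, MvPolynomial.eval_X, Fin.prod_univ_succ, Fin.cons_zero, Fin.cons_succ]
          ring
    intro q
    simpa using key q 0 Fin.elim0
  funext i
  have hq := hpoly (∏ j ∈ Finset.univ.erase i,
    ∑ k, (MvPolynomial.X k - MvPolynomial.C (x j k)) ^ 2)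
  have he : ∀ a, MvPolynomial.eval (fun j => x a j) (∏ j ∈ Finset.univ.erase i,
    ∑ k, (MvPolynomial.X k - MvPolynomial.C (x j k)) ^ 2) =
      ∏ j ∈ Finset.univ.erase i, ‖x a - x j‖ ^ 2 := by
    intro a
    simp [map_prod, EuclideanSpace.norm_sq_eq]
  simp_rw [he] at hq
  rw [Finset.sum_eq_single i] at hq
  · rcases mul_eq_zero.1 hq with h0 | h0
    · simpa using h0
    · exfalso
      obtain ⟨j, hj, hj0⟩ := Finset.prod_eq_zero_iff.1 h0
      have : x i = x j := by simpa [sub_eq_zero] using hj0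
      exact (Finset.ne_of_mem_erase hj) (hx this).symm
  · intro a _ ha
    rw [Finset.prod_eq_zero (i := a) (by simp [ha]) (by simp), mul_zero]
  · simp

lemma gmq_exp_inner_pos (hx : Function.Injective x) (hc : c ≠ 0) :
    0 < ∑ i, ∑ j, c i * c j * Real.exp (inner ℝ (x i) (x j)) := by
  have hs : HasSum (fun n : ℕ => (∑ i, ∑ j, c i * c j * (inner ℝ (x i) (x j)) ^ n) /
      (n.factorial : ℝ)) (∑ i, ∑ j, c i * c j * Real.exp (inner ℝ (x i) (x j))) := by
    simp_rw [Finset.sum_div, mul_div_assoc]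
    refine hasSum_sum fun i _ => hasSum_sum fun j _ => HasSum.mul_left _ ?_
    rw [Real.exp_eq_exp_ℝ]
    exact NormedSpace.expSeries_div_hasSum_exp _
  have hnn : ∀ n : ℕ, 0 ≤ (∑ i, ∑ j, c i * c j * (inner ℝ (x i) (x j)) ^ n) /
      (n.factorial : ℝ) := by
    intro n
    rw [gmq_inner_pow]
    positivity
  refine lt_of_le_of_ne (hs.nonneg hnn) fun h0 => hc ?_
  rw [← h0] at hs
  have hz := (hasSum_zero_iff_of_nonneg hnn).1 hs
  refine gmq_moments_zero x c hx fun n f => ?_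
  have hn := congrFun hz n
  simp only [Pi.zero_apply] at hn
  have hn' := (div_eq_zero_iff.1 hn).resolve_right (by exact_mod_cast Nat.factorial_ne_zero n)
  rw [gmq_inner_pow, Finset.sum_eq_zero_iff_of_nonneg (fun _ _ => sq_nonneg _)] at hn'
  exact pow_eq_zero_iff (two_ne_zero) |>.1 (hn' f (Finset.mem_univ _))

lemma gmq_gauss_pos (hx : Function.Injective x) (hc : c ≠ 0) (a : ℝ) (ha : 0 < a) :
    0 < ∑ i, ∑ j, c i * c j * Real.exp (-(a * ‖x i - x j‖ ^ 2)) := by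
  have hb : 0 < Real.sqrt (2 * a) := Real.sqrt_pos.2 (by positivity)
  have h := gmq_exp_inner_pos (fun i => Real.sqrt (2 * a) • x i)
    (fun i => c i * Real.exp (-(a * ‖x i‖ ^ 2)))
    (fun i j hij => hx (smul_right_injective _ hb.ne' hij))
    (fun h0 => hc (funext fun i => by
      have := congrFun h0 i
      simpa [Real.exp_ne_zero] using this))
  convert h using 1
  refine Finset.sum_congr rfl fun i _ => Finset.sum_congr rfl fun j _ => ?_
  have : Real.exp (-(a * ‖x i - x j‖ ^ 2)) = Real.exp (-(a * ‖x i‖ ^ 2)) *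
      Real.exp (-(a * ‖x j‖ ^ 2)) *
      Real.exp (inner ℝ (Real.sqrt (2 * a) • x i) (Real.sqrt (2 * a) • x j)) := by
    rw [← Real.exp_add, ← Real.exp_add, real_inner_smul_left, real_inner_smul_right,
      norm_sub_sq_real]
    congr 1
    have hs : Real.sqrt (2 * a) * Real.sqrt (2 * a) = 2 * a := Real.mul_self_sqrt (by positivity)
    linear_combination (-(inner ℝ (x i) (x j) : ℝ)) * hs
  rw [this]; ring

lemma gmq_moment (m : ℕ) (ε : ℝ)
    (hortho : ∀ q : MvPolynomial (Fin d) ℝ, q.totalDegree < m →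
      ∑ i : Fin N, c i * MvPolynomial.eval (fun j => x i j) q = 0) (l : ℕ) :
    ∀ p q : MvPolynomial (Fin d) ℝ, p.totalDegree + q.totalDegree + 2 * l < 2 * m →
      ∑ i, ∑ j, (c i * MvPolynomial.eval (fun k => x i k) p) *
        (c j * MvPolynomial.eval (fun k => x j k) q) * (1 + ε ^ 2 * ‖x i - x j‖ ^ 2) ^ l = 0 := by
  induction l with
  | zero =>
    intro p q h
    simp only [pow_zero, mul_one]
    rw [← Finset.sum_mul_sum]
    rcases (by omega : p.totalDegree < m ∨ q.totalDegree < m) with h | h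
    · rw [hortho p h, zero_mul]
    · rw [hortho q h, mul_zero]
  | succ l ih =>
    intro p q h
    let A : MvPolynomial (Fin d) ℝ := ∑ k, MvPolynomial.C (ε ^ 2) * MvPolynomial.X k ^ 2
    have hA : A.totalDegree ≤ 2 := by
      refine MvPolynomial.totalDegree_finsetSum_le fun k _ => ?_
      refine (MvPolynomial.totalDegree_mul _ _).trans ?_
      rw [MvPolynomial.totalDegree_C, MvPolynomial.totalDegree_X_pow, zero_add]
    have hAe : ∀ i, MvPolynomial.eval (fun k => x i k) A = ε ^ 2 * ‖x i‖ ^ 2 := by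
      intro i
      simp [A, EuclideanSpace.norm_sq_eq, Finset.mul_sum]
    have e0 := ih p q (by omega)
    have e1 := ih (p * A) q (by
      have := MvPolynomial.totalDegree_mul p A; omega)
    have e2 := ih p (q * A) (by
      have := MvPolynomial.totalDegree_mul q A; omega)
    have e3 : ∀ k, _ := fun k : Fin d => ih (p * MvPolynomial.X k) (q * MvPolynomial.X k) (by
      have h1 := MvPolynomial.totalDegree_mul p (MvPolynomial.X k)
      have h2 := MvPolynomial.totalDegree_mul q (MvPolynomial.X k)
      rw [MvPolynomial.totalDegree_X] at h1 h2
      omega)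
    have e4 : ∑ i, ∑ j, ∑ k, (c i * MvPolynomial.eval (fun k => x i k) (p * MvPolynomial.X k)) *
        (c j * MvPolynomial.eval (fun k => x j k) (q * MvPolynomial.X k)) *
        (1 + ε ^ 2 * ‖x i - x j‖ ^ 2) ^ l = 0 := by
      refine Eq.trans ?_ (Finset.sum_eq_zero (s := Finset.univ) (fun k _ => e3 k))
      symm
      rw [Finset.sum_comm]
      refine Finset.sum_congr rfl fun i _ => ?_
      rw [Finset.sum_comm]
    have e6 := congrArg₂ (· + ·) (congrArg₂ (· + ·) (congrArg₂ (· + ·) e0 e1) e2)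
      (congrArg (fun z => (-2 * ε ^ 2) * z) e4)
    simp only [Finset.mul_sum, ← Finset.sum_add_distrib, mul_zero, add_zero] at e6
    refine Eq.trans ?_ e6
    refine Finset.sum_congr rfl fun i _ => Finset.sum_congr rfl fun j _ => ?_
    simp only [map_mul, hAe, MvPolynomial.eval_X]
    have hin : (inner ℝ (x i) (x j) : ℝ) = ∑ k, x i k * x j k := by
      simp [PiLp.inner_apply, mul_comm]
    set T := (1 + ε ^ 2 * ‖x i - x j‖ ^ 2) with hT
    set P := MvPolynomial.eval (fun k => x i k) p
    set Q := MvPolynomial.eval (fun k => x j k) q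
    have : ∑ k, -2 * ε ^ 2 * (c i * (P * x i k) * (c j * (Q * x j k)) * T ^ l) =
        -2 * ε ^ 2 * c i * P * c j * Q * T ^ l * (inner ℝ (x i) (x j) : ℝ) := by
      rw [hin, Finset.mul_sum]
      exact Finset.sum_congr rfl fun k _ => by ring
    rw [this, pow_succ]
    have hT' : T = 1 + ε ^ 2 * (‖x i‖ ^ 2 - 2 * inner ℝ (x i) (x j) + ‖x j‖ ^ 2) := by
      rw [hT, norm_sub_sq_real]
    linear_combination (c i * P * (c j * Q) * T ^ l) * hT'

lemma gmq_G_sum (m : ℕ) (ε : ℝ)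
    (hortho : ∀ q : MvPolynomial (Fin d) ℝ, q.totalDegree < m →
      ∑ i : Fin N, c i * MvPolynomial.eval (fun j => x i j) q = 0) (u : ℝ) (l : ℕ) (hl : l ≤ m) :
    ∑ i, ∑ j, c i * c j * gmqG l (u * (1 + ε ^ 2 * ‖x i - x j‖ ^ 2)) =
      (-1) ^ l * ∑ i, ∑ j, c i * c j * Real.exp (-(u * (1 + ε ^ 2 * ‖x i - x j‖ ^ 2))) := by
  induction l with
  | zero => simp [gmqG]
  | succ l ih =>
    have h0 := gmq_moment x c m ε hortho l 1 1 (by simp; omega)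
    have h1 := ih (by omega)
    have : ∑ i, ∑ j, c i * c j * gmqG (l + 1) (u * (1 + ε ^ 2 * ‖x i - x j‖ ^ 2)) =
        u ^ l / (l.factorial : ℝ) * (∑ i, ∑ j, (c i * MvPolynomial.eval (fun k => x i k) 1) *
        (c j * MvPolynomial.eval (fun k => x j k) 1) * (1 + ε ^ 2 * ‖x i - x j‖ ^ 2) ^ l) -
        ∑ i, ∑ j, c i * c j * gmqG l (u * (1 + ε ^ 2 * ‖x i - x j‖ ^ 2)) := by
      simp only [Finset.mul_sum, ← Finset.sum_sub_distrib]
      refine Finset.sum_congr rfl fun i _ => Finset.sum_congr rfl fun j _ => ?_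
      rw [gmqG, map_one, map_one, mul_pow]
      ring
    rw [this, h0, h1, pow_succ]
    ring

end

/-- Strict conditional positive definiteness of generalized multiquadric
functions: for `d ≥ 1`, non-integer `β > 0`, `ε > 0` and `m = ⌈β⌉`, for all pairwise distinct
`x₁, …, x_N ∈ ℝ^d` (`N ≥ 1`) and every nonzero `c ∈ ℝ^N` with `Σᵢ cᵢ q(xᵢ) = 0` for every
real polynomial `q` in `d` variables of total degree `< m`, one has
`(-1)^m Σᵢ Σⱼ cᵢ cⱼ (1 + ε²|xᵢ - xⱼ|²)^β > 0`. -/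
theorem GMQ_conditionally_positive_definite (d : ℕ) (hd : 1 ≤ d) (β : ℝ) (hβ : 0 < β)
    (hβint : ¬∃ n : ℤ, β = (n : ℝ)) (ε : ℝ) (hε : 0 < ε) (m : ℕ) (hm : m = ⌈β⌉₊)
    (N : ℕ) (hN : 1 ≤ N) (x : Fin N → EuclideanSpace ℝ (Fin d))
    (hx : Function.Injective x) (c : Fin N → ℝ) (hc : c ≠ 0)
    (hortho : ∀ q : MvPolynomial (Fin d) ℝ, q.totalDegree < m →
      ∑ i : Fin N, c i * MvPolynomial.eval (fun j => x i j) q = 0) :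
    0 < (-1 : ℝ) ^ m * ∑ i : Fin N, ∑ j : Fin N,
      c i * c j * (1 + ε ^ 2 * ‖x i - x j‖ ^ 2) ^ β := by
  have hlt : β < m := lt_of_le_of_ne (hm ▸ Nat.le_ceil β) fun h => hβint ⟨m, by simpa using h⟩
  obtain ⟨n, rfl⟩ : ∃ n, m = n + 1 :=
    Nat.exists_eq_succ_of_ne_zero (by rw [hm]; exact (Nat.ceil_pos.2 hβ).ne')
  have h1 : (n : ℝ) < β := by
    rw [← Nat.lt_ceil, ← hm]; omega
  have h2 : β < n + 1 := by exact_mod_cast hlt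
  have ht : ∀ i j, 0 < 1 + ε ^ 2 * ‖x i - x j‖ ^ 2 := fun i j => by positivity
  set K := ∫ u in Set.Ioi (0 : ℝ), gmqG (n + 1) u * u ^ (-β - 1) with hK
  have hKpos : 0 < K := gmq_integral_pos _ (gmqG_integrable n β h1 h2) fun u hu =>
    mul_pos (gmqG_pos _ u hu) (Real.rpow_pos_of_pos hu _)
  let F : ℝ → ℝ := fun u => (-1 : ℝ) ^ (n + 1) * ∑ i, ∑ j, c i * c j *
    (gmqG (n + 1) (u * (1 + ε ^ 2 * ‖x i - x j‖ ^ 2)) * u ^ (-β - 1))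
  have hcint : ∀ i j, Integrable (fun u : ℝ => c i * c j *
      (gmqG (n + 1) (u * (1 + ε ^ 2 * ‖x i - x j‖ ^ 2)) * u ^ (-β - 1)))
      (volume.restrict (Set.Ioi 0)) := fun i j =>
    (gmq_scale_integrable n β h1 h2 _ (ht i j)).const_mul _
  have hFint : IntegrableOn F (Set.Ioi 0) :=
    (integrable_finsetSum _ fun i _ => integrable_finsetSum _ fun j _ => hcint i j).const_mul _
  have hFpos : ∀ u, 0 < u → 0 < F u := by
    intro u hu
    have hs := gmq_G_sum x c (n + 1) ε hortho u (n + 1) le_rfl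
    have hg := gmq_gauss_pos x c hx hc (u * ε ^ 2) (by positivity)
    have hE : ∑ i, ∑ j, c i * c j * Real.exp (-(u * (1 + ε ^ 2 * ‖x i - x j‖ ^ 2))) =
        Real.exp (-u) * ∑ i, ∑ j, c i * c j * Real.exp (-(u * ε ^ 2 * ‖x i - x j‖ ^ 2)) := by
      simp only [Finset.mul_sum]
      refine Finset.sum_congr rfl fun i _ => Finset.sum_congr rfl fun j _ => ?_
      rw [mul_left_comm, ← Real.exp_add]
      congr 2
      ring
    have hF : F u = u ^ (-β - 1) * (Real.exp (-u) *
        ∑ i, ∑ j, c i * c j * Real.exp (-(u * ε ^ 2 * ‖x i - x j‖ ^ 2))) := by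
      simp only [F, ← mul_assoc, ← Finset.sum_mul]
      rw [hs, hE, ← mul_assoc, ← pow_add, Even.neg_one_pow ⟨n + 1, rfl⟩]
      ring
    rw [hF]
    exact mul_pos (Real.rpow_pos_of_pos hu _) (mul_pos (Real.exp_pos _) hg)
  have hI := gmq_integral_pos F hFint hFpos
  have hval : ∫ u in Set.Ioi (0 : ℝ), F u = ((-1 : ℝ) ^ (n + 1) * ∑ i : Fin N, ∑ j : Fin N,
      c i * c j * (1 + ε ^ 2 * ‖x i - x j‖ ^ 2) ^ β) * K := by
    simp only [F]
    rw [integral_const_mul, integral_finsetSum _ fun i _ =>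
      integrable_finsetSum _ fun j _ => hcint i j]
    rw [mul_assoc, Finset.sum_mul]
    congr 1
    refine Finset.sum_congr rfl fun i _ => ?_
    rw [integral_finsetSum _ fun j _ => hcint i j, Finset.sum_mul]
    refine Finset.sum_congr rfl fun j _ => ?_
    rw [integral_const_mul, gmq_scale_integral n β _ (ht i j), ← hK]
    ring
  rw [hval] at hI
  exact pos_of_mul_pos_left hI hKpos.le
end

section
/- Let α ∈ (0, 2), let s be a nonnegative integer, and let u : ℝ → ℝ be given by u(y) = (max(1 − y², 0))^{s + α/2}. Then for every x ∈ (−1, 1) the principal value limit defining the fractional Laplacian of u at x exists, and C_{1,α} · lim_{ε→0⁺} ∫_{{y : |x−y| > ε}} (u(x) − u(y)) / |x − y|^{1+α} dy = (2^α Γ((α+1)/2) Γ(s + 1 + α/2) / (√π Γ(s+1))) · Σ_{k=0}^{s} [ ((α+1)/2)_k · (−s)_k / ( (1/2)_k · k! ) ] · x^{2k}, where the sum is the terminating hypergeometric series ₂F₁((α+1)/2, −s; 1/2; x²). -/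
open MeasureTheory Real Topology Filter Polynomial

/-- The normalization constant `C_{d,α} = 2^{α-1} α Γ((α+d)/2) / (π^{d/2} Γ(1-α/2))`
of the fractional Laplacian. -/
noncomputable def fracLapConst (d : ℕ) (α : ℝ) : ℝ :=
  2 ^ (α - 1) * α * Real.Gamma ((α + d) / 2) /
    (Real.pi ^ ((d : ℝ) / 2) * Real.Gamma (1 - α / 2))

noncomputable def flT (s : ℕ) (b : ℝ) (k j : ℕ) : ℝ :=
  (-1) ^ j * ((2 * s + 1).choose (2 * j) : ℝ) * ((s - j).choose (k - j) : ℝ) *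
    (ascPochhammer ℝ j).eval (-b) * (ascPochhammer ℝ (k - j)).eval (1 + s + b)

lemma flT_step (s : ℕ) (b : ℝ) (k j : ℕ) (hj : j ≤ k) (hk : k < s) :
    ((k : ℝ) + 1) * (2 * k + 1) * flT s b (k + 1) j
      - ((s : ℝ) + k + 1) * (s - k) * (2 * b + 2 * k + 1) * flT s b k j
    = (j : ℝ) * (2 * j - 1) * flT s b (k + 1) j
      - (((j + 1 : ℕ) : ℝ) * (2 * ((j + 1 : ℕ) : ℝ) - 1)) * flT s b (k + 1) (j + 1) := by
  obtain ⟨m, rfl⟩ := Nat.exists_eq_add_of_le hj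
  obtain ⟨r, rfl⟩ := Nat.exists_eq_add_of_lt hk
  have e1 : j + m + r + 1 - j = m + r + 1 := by omega
  have e2 : j + m + 1 - j = m + 1 := by omega
  have e3 : j + m - j = m := by omega
  have e4 : j + m + r + 1 - (j + 1) = m + r := by omega
  have e5 : j + m + 1 - (j + 1) = m := by omega
  unfold flT
  rw [e1, e2, e3, e4, e5]
  have h1 : (((m + r + 1).choose (m + 1) : ℕ) : ℝ) * (m + 1) = ((m + r + 1).choose m : ℕ) * (r + 1) := by
    have := Nat.choose_succ_right_eq (m + r + 1) m
    rw [show m + r + 1 - m = r + 1 by omega] at this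
    exact_mod_cast this
  have h2 : (((m + r).choose m : ℕ) : ℝ) * (m + r + 1) = ((m + r + 1).choose m : ℕ) * (r + 1) := by
    have := Nat.choose_mul_succ_eq (m + r) m
    rw [show m + r + 1 - m = r + 1 by omega] at this
    exact_mod_cast this
  have h3 : (((2 * (j + m + r + 1) + 1).choose (2 * (j + 1)) : ℕ) : ℝ) * (2 * j + 1) * (2 * j + 2)
      = ((2 * (j + m + r + 1) + 1).choose (2 * j) : ℕ) * (2 * (m + r + 1) + 1) * (2 * (m + r + 1)) := by
    have a := Nat.choose_succ_right_eq (2 * (j + m + r + 1) + 1) (2 * j)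
    have c := Nat.choose_succ_right_eq (2 * (j + m + r + 1) + 1) (2 * j + 1)
    rw [show 2 * (j + m + r + 1) + 1 - 2 * j = 2 * (m + r + 1) + 1 by omega] at a
    rw [show 2 * (j + m + r + 1) + 1 - (2 * j + 1) = 2 * (m + r + 1) by omega] at c
    rw [show 2 * (j + 1) = 2 * j + 1 + 1 by ring]
    have a' : (((2 * (j + m + r + 1) + 1).choose (2 * j + 1) : ℕ) : ℝ) * (2 * j + 1)
      = ((2 * (j + m + r + 1) + 1).choose (2 * j) : ℕ) * (2 * (m + r + 1) + 1) := by exact_mod_cast a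
    have c' : (((2 * (j + m + r + 1) + 1).choose (2 * j + 1 + 1) : ℕ) : ℝ) * (2 * j + 2)
      = ((2 * (j + m + r + 1) + 1).choose (2 * j + 1) : ℕ) * (2 * (m + r + 1)) := by exact_mod_cast c
    linear_combination (2 * (j:ℝ) + 1) * c' + (2 * ((m:ℝ) + r + 1)) * a'
  generalize hX : (((2 * (j + m + r + 1) + 1).choose (2 * (j + 1)) : ℕ) : ℝ) = X at *
  generalize (((2 * (j + m + r + 1) + 1).choose (2 * j) : ℕ) : ℝ) = Y at *
  generalize (((m + r + 1).choose (m + 1) : ℕ) : ℝ) = c1 at *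
  generalize (((m + r + 1).choose m : ℕ) : ℝ) = c0 at *
  generalize (((m + r).choose m : ℕ) : ℝ) = c2 at *
  simp only [ascPochhammer_succ_eval]
  generalize (ascPochhammer ℝ j).eval (-b) = P
  push_cast
  generalize (ascPochhammer ℝ m).eval (1 + ((j:ℝ) + m + r + 1) + b) = Q
  have hm : (m:ℝ) + 1 ≠ 0 := by positivity
  have hm2 : (m:ℝ) + r + 1 ≠ 0 := by positivity
  have hj2 : (2 * (j:ℝ) + 1) * (2 * j + 2) ≠ 0 := by positivity
  have h1' : c1 = c0 * (r + 1) / (m + 1) := by field_simp; linarith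
  have h2' : c2 = c0 * (r + 1) / (m + r + 1) := by field_simp; linarith
  have h3' : X = Y * (2 * (m + r + 1) + 1) * (2 * (m + r + 1)) / ((2 * j + 1) * (2 * j + 2)) := by
    field_simp; linarith
  rw [h1', h2', h3', pow_succ]
  have hj3 : (2 * (j:ℝ) + 1) ≠ 0 := by positivity
  have hj4 : ((j:ℝ) + 1) ≠ 0 := by positivity
  field_simp
  ring

lemma flT_sum (s : ℕ) (b : ℝ) (k : ℕ) (hk : k ≤ s) :
    ∑ j ∈ Finset.range (k + 1), flT s b k j =
      ((s + k).factorial : ℝ) / (s.factorial : ℝ) * (-1) ^ k * ((ascPochhammer ℝ k).eval (b + 1 / 2) *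
        (ascPochhammer ℝ k).eval (-(s : ℝ)) /
        ((ascPochhammer ℝ k).eval (1 / 2) * (k.factorial : ℝ))) := by
  induction k with
  | zero =>
    have : ((s.factorial : ℕ) : ℝ) ≠ 0 := by positivity
    simp [flT, this]
  | succ k ih =>
    have ih := ih (by omega)
    have tel : ∑ j ∈ Finset.range (k + 1), (((k : ℝ) + 1) * (2 * k + 1) * flT s b (k + 1) j
      - ((s : ℝ) + k + 1) * (s - k) * (2 * b + 2 * k + 1) * flT s b k j) =
       - (((k + 1 : ℕ) : ℝ) * (2 * ((k + 1 : ℕ) : ℝ) - 1)) * flT s b (k + 1) (k + 1) := by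
      rw [Finset.sum_congr rfl (fun j hj => flT_step s b k j
        (by have := Finset.mem_range.1 hj; omega) (by omega)),
        Finset.sum_range_sub' (fun j : ℕ => (j : ℝ) * (2 * j - 1) * flT s b (k + 1) j)]
      simp
    rw [Finset.sum_sub_distrib, ← Finset.mul_sum, ← Finset.mul_sum, ih] at tel
    rw [Finset.sum_range_succ]
    have hp : (0:ℝ) < (ascPochhammer ℝ k).eval (1 / 2) := ascPochhammer_pos k _ (by norm_num)
    simp only [ascPochhammer_succ_eval]
    rw [show s + (k + 1) = (s + k) + 1 by ring, Nat.factorial_succ, Nat.factorial_succ]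
    push_cast at tel ⊢
    have hk1 : ((k:ℝ) + 1) ≠ 0 := by positivity
    have hk2 : (2 * (k:ℝ) + 1) ≠ 0 := by positivity
    have key : ∑ j ∈ Finset.range (k + 1), flT s b (k + 1) j + flT s b (k + 1) (k + 1) =
      ((s : ℝ) + k + 1) * (s - k) * (2 * b + 2 * k + 1) * (((s + k).factorial : ℝ) / (s.factorial : ℝ) * (-1) ^ k * ((ascPochhammer ℝ k).eval (b + 1 / 2) *
        (ascPochhammer ℝ k).eval (-(s : ℝ)) /
        ((ascPochhammer ℝ k).eval (1 / 2) * (k.factorial : ℝ)))) / (((k:ℝ) + 1) * (2 * k + 1)) := by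
      rw [eq_div_iff (by positivity)]
      linarith
    rw [key, pow_succ]
    have hf : ((s.factorial : ℕ) : ℝ) ≠ 0 := by positivity
    have hf2 : ((k.factorial : ℕ) : ℝ) ≠ 0 := by positivity
    have h12 : (1 / 2 + (k:ℝ)) ≠ 0 := by positivity
    have hp' := hp.ne'
    generalize (ascPochhammer ℝ k).eval (1 / 2) = A at *
    generalize (ascPochhammer ℝ k).eval (b + 1 / 2) = B at *
    generalize (ascPochhammer ℝ k).eval (-(s:ℝ)) = C at *
    generalize ((s.factorial : ℕ) : ℝ) = F at *
    generalize ((k.factorial : ℕ) : ℝ) = F2 at *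
    generalize (((s + k).factorial : ℕ) : ℝ) = F3 at *
    rw [show (1 / 2 + (k:ℝ)) = (2 * k + 1) / 2 by ring]
    field_simp
    ring

lemma fl_beta {a c : ℝ} (ha : 0 < a) (hc : 0 < c) :
    IntervalIntegrable (fun r : ℝ => r ^ (a - 1) * (1 - r) ^ (c - 1)) volume 0 1 ∧
    ∫ r in (0:ℝ)..1, r ^ (a - 1) * (1 - r) ^ (c - 1) =
      Real.Gamma a * Real.Gamma c / Real.Gamma (a + c) := by
  have hI := Complex.betaIntegral_convergent (u := (a:ℂ)) (v := (c:ℂ)) (by simpa) (by simpa)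
  have e : ∀ r ∈ Set.uIcc (0:ℝ) 1, ((r:ℂ) ^ ((a:ℂ) - 1) * (1 - (r:ℂ)) ^ ((c:ℂ) - 1)) =
      ((r ^ (a - 1) * (1 - r) ^ (c - 1) : ℝ) : ℂ) := by
    intro r hr
    rw [Set.uIcc_of_le zero_le_one] at hr
    push_cast
    rw [Complex.ofReal_cpow hr.1, Complex.ofReal_cpow (by linarith [hr.2])]
    push_cast
    rfl
  have e' : Set.EqOn (fun r : ℝ => ((r:ℂ) ^ ((a:ℂ) - 1) * (1 - (r:ℂ)) ^ ((c:ℂ) - 1)))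
      (fun r : ℝ => ((r ^ (a - 1) * (1 - r) ^ (c - 1) : ℝ) : ℂ)) (Set.uIoc 0 1) :=
    fun r hr => e r (Set.uIoc_subset_uIcc hr)
  constructor
  · have h2 := (intervalIntegrable_congr e').1 hI
    rw [intervalIntegrable_iff] at h2 ⊢
    exact h2.re
  · have h1 := ProbabilityTheory.beta_eq_betaIntegralReal a c ha hc
    unfold ProbabilityTheory.beta at h1
    rw [h1, Complex.betaIntegral, intervalIntegral.integral_congr (g := fun r : ℝ => ((r ^ (a - 1) * (1 - r) ^ (c - 1) : ℝ) : ℂ)) e, intervalIntegral.integral_ofReal, Complex.ofReal_re]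

lemma fl_tendsto_left {f : ℝ → ℝ} (hf : IntervalIntegrable f volume 0 1) :
    Tendsto (fun η : ℝ => ∫ r in η..1, f r) (𝓝[>] 0) (𝓝 (∫ r in (0:ℝ)..1, f r)) := by
  have h := intervalIntegral.continuousOn_primitive_interval_left (a := 0) (b := 1) (f := f)
    (μ := volume) (by
      rw [intervalIntegrable_iff] at hf
      rw [Set.uIcc_of_le zero_le_one, integrableOn_Icc_iff_integrableOn_Ioc]
      rwa [Set.uIoc_of_le zero_le_one] at hf)
  have h0 := (h 0 (by simp)).tendsto
  refine h0.mono_left ?_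
  rw [Set.uIcc_of_le zero_le_one]
  exact nhdsWithin_le_of_mem (by
    filter_upwards [Ioo_mem_nhdsGT (zero_lt_one' ℝ)] with y hy
    exact ⟨hy.1.le, hy.2.le⟩)

/-- `η ^ (-e) * O(η ^ d) → 0` when `e < d`. -/
lemma fl_squeeze {f : ℝ → ℝ} {e d C : ℝ} (hed : e < d)
    (h : ∀ᶠ η in 𝓝[>] (0:ℝ), |f η| ≤ C * η ^ d) :
    Tendsto (fun η => η ^ (-e) * f η) (𝓝[>] 0) (𝓝 0) := by
  have h0 : Tendsto (fun η : ℝ => C * η ^ (d - e)) (𝓝[>] 0) (𝓝 0) := by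
    have : Tendsto (fun η : ℝ => η ^ (d - e)) (𝓝[>] 0) (𝓝 ((0:ℝ) ^ (d - e))) :=
      ((Real.continuousAt_rpow_const 0 (d - e) (Or.inr (by linarith))).tendsto).mono_left
        nhdsWithin_le_nhds
    rw [Real.zero_rpow (by linarith)] at this
    simpa using this.const_mul C
  refine squeeze_zero_norm' ?_ h0
  filter_upwards [h, self_mem_nhdsWithin] with η h1 h2
  have h2 : 0 < η := h2
  rw [Real.norm_eq_abs, abs_mul, abs_of_pos (Real.rpow_pos_of_pos h2 _)]
  calc η ^ (-e) * |f η| ≤ η ^ (-e) * (C * η ^ d) := by gcongr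
    _ = C * η ^ (d - e) := by
      rw [show d - e = -e + d by ring, Real.rpow_add h2]; ring

lemma fl_ibp {a c η : ℝ} (hc : 0 < c) (h0 : 0 < η) (h1 : η < 1) :
    a * ∫ r in η..1, r ^ (a - 1) * (1 - r) ^ c =
      (a + c + 1) * (∫ r in η..1, r ^ a * (1 - r) ^ c) - η ^ a * (1 - η) ^ (c + 1) := by
  have hpos : ∀ r ∈ Set.uIcc η 1, 0 < r := by
    intro r hr
    rw [Set.uIcc_of_le h1.le] at hr
    linarith [hr.1]
  have cont : ∀ e : ℝ, ContinuousOn (fun r : ℝ => r ^ e * (1 - r) ^ c) (Set.uIcc η 1) := by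
    intro e r hr
    refine ContinuousAt.continuousWithinAt (ContinuousAt.mul ?_ ?_)
    · exact Real.continuousAt_rpow_const _ _ (Or.inl (hpos r hr).ne')
    · exact ContinuousAt.rpow_const (by fun_prop) (Or.inr hc.le)
  have ii : ∀ e : ℝ, IntervalIntegrable (fun r : ℝ => r ^ e * (1 - r) ^ c) volume η 1 :=
    fun e => (cont e).intervalIntegrable
  have hd : ∀ r ∈ Set.uIcc η 1, HasDerivAt (fun r : ℝ => r ^ a * (1 - r) ^ (c + 1))
      (a * (r ^ (a - 1) * (1 - r) ^ c) - (a + c + 1) * (r ^ a * (1 - r) ^ c)) r := by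
    intro r hr
    have hr0 := hpos r hr
    have d1 : HasDerivAt (fun r : ℝ => r ^ a) (a * r ^ (a - 1)) r :=
      Real.hasDerivAt_rpow_const (Or.inl hr0.ne')
    have d2 : HasDerivAt (fun r : ℝ => (1 - r) ^ (c + 1)) ((-1) * (c + 1) * (1 - r) ^ (c + 1 - 1)) r :=
      HasDerivAt.rpow_const ((hasDerivAt_id r).const_sub 1) (Or.inr (by linarith))
    refine (d1.mul d2).congr_deriv ?_
    symm
    have e1 : (1 - r) ^ (c + 1) = (1 - r) ^ c * (1 - r) := by
      rw [Set.uIcc_of_le h1.le] at hr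
      rw [Real.rpow_add_one' (by linarith [hr.2]) (by linarith)]
    have e2 : r ^ a = r ^ (a - 1) * r := by
      rw [← Real.rpow_add_one hr0.ne']; congr 1; ring
    rw [e1, e2, show c + 1 - 1 = c by ring]
    ring
  have := intervalIntegral.integral_eq_sub_of_hasDerivAt hd
    (((ii _).const_mul _).sub ((ii _).const_mul _))
  rw [intervalIntegral.integral_sub ((ii _).const_mul _) ((ii _).const_mul _),
    intervalIntegral.integral_const_mul, intervalIntegral.integral_const_mul] at this
  simp only [sub_self, Real.zero_rpow (show c + 1 ≠ 0 by linarith)] at this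
  linarith

lemma fl_fp {b c : ℝ} (hb0 : 0 < b) (hb1 : b < 1) (hc : 0 < c) (j : ℕ) :
    Tendsto (fun η : ℝ => (∫ r in η..1, r ^ ((j:ℝ) - b - 1) * (1 - r) ^ c)
        - (if j = 0 then η ^ (-b) / b else 0)) (𝓝[>] 0)
      (𝓝 (Real.Gamma (j - b) * Real.Gamma (c + 1) / Real.Gamma (j - b + (c + 1)))) := by
  rcases Nat.eq_zero_or_pos j with rfl | hj
  · simp only [if_true, Nat.cast_zero, zero_sub]
    obtain ⟨i1, i2⟩ := fl_beta (a := 1 - b) (c := c + 1) (by linarith) (by linarith)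
    have t1 := fl_tendsto_left i1
    rw [i2] at t1
    simp only [show 1 - b - 1 = -b by ring, show c + 1 - 1 = c by ring] at t1
    have t2 : Tendsto (fun η : ℝ => η ^ (-b) * ((1 - η) ^ (c + 1) - 1)) (𝓝[>] 0) (𝓝 0) := by
      refine fl_squeeze (d := 1) (C := c + 1) hb1 ?_
      filter_upwards [Ioo_mem_nhdsGT (zero_lt_one' ℝ)] with η hη
      have l := one_add_mul_self_le_rpow_one_add (s := -η) (by linarith [hη.2]) (p := c + 1) (by linarith)
      have u : (1 - η) ^ (c + 1) ≤ 1 := Real.rpow_le_one (by linarith [hη.2]) (by linarith [hη.1]) (by linarith)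
      rw [← sub_eq_add_neg] at l
      rw [Real.rpow_one, abs_le]
      constructor
      · linarith
      · have : 0 < (c+1) * η := mul_pos (by linarith) hη.1
        linarith
    have t3 := (t1.const_mul (-(c + 1 - b) / b)).add (t2.const_mul (1 / b))
    have g1 : Real.Gamma (1 - b) = -b * Real.Gamma (-b) := by
      rw [← Real.Gamma_add_one (by linarith)]; congr 1; ring
    have g2 : Real.Gamma (1 - b + (c + 1)) = (c + 1 - b) * Real.Gamma (-b + (c + 1)) := by
      rw [show c + 1 - b = -b + (c + 1) by ring, ← Real.Gamma_add_one (by linarith)]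
      congr 1; ring
    have hne : c + 1 - b ≠ 0 := by linarith
    have hG : Real.Gamma (-b + (c + 1)) ≠ 0 := (Real.Gamma_pos_of_pos (by linarith)).ne'
    have hval : -(c + 1 - b) / b * (Real.Gamma (1 - b) * Real.Gamma (c + 1) / Real.Gamma (1 - b + (c + 1))) + 1 / b * 0 = Real.Gamma (-b) * Real.Gamma (c + 1) / Real.Gamma (-b + (c + 1)) := by
      rw [g1, g2]
      field_simp
      ring
    rw [hval] at t3
    refine t3.congr' ?_
    filter_upwards [Ioo_mem_nhdsGT (zero_lt_one' ℝ)] with η hη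
    have := fl_ibp (a := -b) hc hη.1 hη.2
    field_simp
    linarith
  · simp only [hj.ne', if_false, sub_zero]
    have hj' : (1:ℝ) ≤ j := by exact_mod_cast hj
    obtain ⟨i1, i2⟩ := fl_beta (a := j - b) (c := c + 1) (by linarith) (by linarith)
    have t1 := fl_tendsto_left i1
    rw [i2] at t1
    simpa only [show c + 1 - 1 = c by ring] using t1

lemma fl_sum_even_odd (f : ℕ → ℝ) (m : ℕ) :
    ∑ i ∈ Finset.range (2 * m), f i = ∑ j ∈ Finset.range m, (f (2 * j) + f (2 * j + 1)) := by
  induction m with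
  | zero => simp
  | succ m ih =>
    rw [show 2 * (m + 1) = 2 * m + 1 + 1 by ring, Finset.sum_range_succ, Finset.sum_range_succ,
      Finset.sum_range_succ, ih]
    ring

lemma fl_binom (s : ℕ) (y : ℝ) :
    (1 + y) ^ (2 * s + 1) + (1 - y) ^ (2 * s + 1) =
      2 * ∑ j ∈ Finset.range (s + 1), ((2 * s + 1).choose (2 * j) : ℝ) * (y ^ 2) ^ j := by
  have h1 : ∀ y : ℝ, (1 + y) ^ (2 * s + 1) = ∑ i ∈ Finset.range (2 * (s + 1)),
      y ^ i * ((2 * s + 1).choose i : ℝ) := by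
    intro y
    rw [add_comm, add_pow]
    simp [show 2 * s + 1 + 1 = 2 * (s + 1) by ring]
  rw [sub_eq_add_neg, h1, h1, fl_sum_even_odd, fl_sum_even_odd, ← Finset.sum_add_distrib,
    Finset.mul_sum]
  refine Finset.sum_congr rfl fun j _ => ?_
  rw [pow_succ, pow_succ, pow_mul, pow_mul, neg_sq]
  ring

/-- the transformed profile -/
noncomputable def flg (s : ℕ) (b x t : ℝ) : ℝ :=
  (1 - t ^ 2) ^ ((s:ℝ) + b) * ((1 + x * t) ^ (2 * s + 1))⁻¹

lemma fl_wpos {x t : ℝ} (hx1 : -1 < x) (hx2 : x < 1) (ht0 : 0 ≤ t) (ht1 : t ≤ 1) : 0 < 1 + x * t := by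
  nlinarith

lemma fl_mobius (s : ℕ) {b x a : ℝ} (hx1 : -1 < x) (hx2 : x < 1)
    (ha0 : 0 < a) (ha1 : a < 1) :
    ∫ y in ((x + a) / (1 + x * a))..1, (1 - y ^ 2) ^ ((s:ℝ) + b) * (y - x) ^ (-1 - 2 * b) =
      (1 - x ^ 2) ^ ((s:ℝ) - b) * ∫ t in a..1, t ^ (-1 - 2 * b) * flg s b x t := by
  have hz : 0 < 1 - x ^ 2 := by nlinarith
  have hI : Set.uIcc a 1 = Set.Icc a 1 := Set.uIcc_of_le ha1.le
  have hw : ∀ t ∈ Set.uIcc a 1, 0 < 1 + x * t := by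
    intro t ht
    rw [hI] at ht
    exact fl_wpos hx1 hx2 (by linarith [ht.1]) ht.2
  have hder : ∀ t ∈ Set.uIcc a 1, HasDerivAt (fun t : ℝ => (x + t) / (1 + x * t))
      ((1 - x ^ 2) / (1 + x * t) ^ 2) t := by
    intro t ht
    have d1 : HasDerivAt (fun t : ℝ => x + t) 1 t := (hasDerivAt_id t).const_add x
    have d2 : HasDerivAt (fun t : ℝ => 1 + x * t) x t := by
      simpa using ((hasDerivAt_id t).const_mul x).const_add 1
    refine (d1.div d2 (hw t ht).ne').congr_deriv ?_
    congr 1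
    ring
  have hsub : Set.Ioo (min a 1) (max a 1) ⊆ Set.uIcc a 1 := by
    rw [hI, min_eq_left ha1.le, max_eq_right ha1.le]
    exact Set.Ioo_subset_Icc_self
  have key := intervalIntegral.integral_comp_mul_deriv_of_deriv_nonneg
    (g := fun y : ℝ => (1 - y ^ 2) ^ ((s:ℝ) + b) * (y - x) ^ (-1 - 2 * b))
    (fun t ht => (hder t ht).continuousAt.continuousWithinAt)
    (fun t ht => hder t (hsub ht))
    (fun t ht => div_nonneg hz.le (sq_nonneg _))
  have h1 : (x + 1) / (1 + x * 1) = 1 := by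
    rw [mul_one, add_comm, div_self]; linarith
  rw [h1] at key
  rw [← key, ← intervalIntegral.integral_const_mul]
  refine intervalIntegral.integral_congr fun t ht => ?_
  have hw' := hw t ht
  rw [hI] at ht
  have ht0 : 0 < t := by linarith [ht.1]
  have ht1 : 0 ≤ 1 - t ^ 2 := by nlinarith [ht.2]
  simp only [Function.comp, flg]
  have e1 : 1 - ((x + t) / (1 + x * t)) ^ 2 = (1 - x ^ 2) * (1 - t ^ 2) * (1 + x * t) ^ (-2:ℝ) := by
    rw [Real.rpow_neg hw'.le, Real.rpow_ofNat]
    field_simp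
    ring
  have e2 : (x + t) / (1 + x * t) - x = t * (1 - x ^ 2) * (1 + x * t) ^ (-1:ℝ) := by
    rw [Real.rpow_neg_one]
    field_simp
    ring
  have e3 : (1 - x ^ 2) / (1 + x * t) ^ 2 = (1 - x ^ 2) ^ (1:ℝ) * (1 + x * t) ^ (-2:ℝ) := by
    rw [Real.rpow_neg hw'.le, Real.rpow_ofNat, Real.rpow_one]; rfl
  have e4 : ((1 + x * t) ^ (2 * s + 1))⁻¹ = (1 + x * t) ^ (-(2 * (s:ℝ) + 1)) := by
    rw [Real.rpow_neg hw'.le]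
    congr 1
    rw [← Real.rpow_natCast]
    push_cast
    rfl
  rw [e1, e2, e3, e4, Real.mul_rpow (by positivity) (by positivity), Real.mul_rpow hz.le ht1,
    Real.mul_rpow (by positivity) (by positivity), Real.mul_rpow ht0.le hz.le,
    ← Real.rpow_mul hw'.le, ← Real.rpow_mul hw'.le]
  have z1 : (1 - x ^ 2) ^ ((s:ℝ) - b) = (1 - x ^ 2) ^ ((s:ℝ) + b) * (1 - x ^ 2) ^ (-1 - 2 * b) * (1 - x ^ 2) ^ (1:ℝ) := by
    rw [← Real.rpow_add hz, ← Real.rpow_add hz]; congr 1; ring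
  have w1 : (1 + x * t) ^ (-(2 * (s:ℝ) + 1)) = (1 + x * t) ^ (-2 * ((s:ℝ) + b)) * (1 + x * t) ^ (-1 * (-1 - 2 * b)) * (1 + x * t) ^ (-2:ℝ) := by
    rw [← Real.rpow_add hw', ← Real.rpow_add hw']; congr 1; ring
  rw [z1, w1]
  ring

/-- the polynomial appearing after the second substitution -/
noncomputable def flQ (s : ℕ) (x r : ℝ) : ℝ :=
  ∑ j ∈ Finset.range (s + 1), ((2 * s + 1).choose (2 * j) : ℝ) * (x ^ 2 * r) ^ j *
    (1 - x ^ 2 * (1 - r)) ^ (s - j)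

lemma flQ_eval (s : ℕ) {x t : ℝ} (hD : 1 - x ^ 2 * t ^ 2 ≠ 0) :
    flQ s x ((1 - x ^ 2) * t ^ 2 / (1 - x ^ 2 * t ^ 2)) =
      (1 - x ^ 2) ^ s / (1 - x ^ 2 * t ^ 2) ^ s *
        (((1 + x * t) ^ (2 * s + 1) + (1 - x * t) ^ (2 * s + 1)) / 2) := by
  rw [fl_binom, mul_div_cancel_left₀ _ (two_ne_zero), Finset.mul_sum, flQ]
  refine Finset.sum_congr rfl fun j hj => ?_
  have hj : j ≤ s := by have := Finset.mem_range.1 hj; omega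
  have e : 1 - x ^ 2 * (1 - (1 - x ^ 2) * t ^ 2 / (1 - x ^ 2 * t ^ 2)) =
      (1 - x ^ 2) / (1 - x ^ 2 * t ^ 2) := by
    field_simp
    ring
  have e2 : x ^ 2 * ((1 - x ^ 2) * t ^ 2 / (1 - x ^ 2 * t ^ 2)) =
      (x * t) ^ 2 * ((1 - x ^ 2) / (1 - x ^ 2 * t ^ 2)) := by ring
  rw [e, e2, mul_pow, ← div_pow]
  have : ((1 - x ^ 2) / (1 - x ^ 2 * t ^ 2)) ^ s =
    ((1 - x ^ 2) / (1 - x ^ 2 * t ^ 2)) ^ j * ((1 - x ^ 2) / (1 - x ^ 2 * t ^ 2)) ^ (s - j) := by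
    rw [← pow_add]; congr 1; omega
  rw [this]
  ring

lemma fl_sub2 (s : ℕ) {b x d : ℝ} (hx1 : -1 < x) (hx2 : x < 1)
    (hd0 : 0 < d) (hd1 : d < 1) :
    ∫ r in ((1 - x ^ 2) * d ^ 2 / (1 - x ^ 2 * d ^ 2))..1,
        r ^ (-1 - b) * (1 - r) ^ ((s:ℝ) + b) * flQ s x r =
      (1 - x ^ 2) ^ ((s:ℝ) - b) * ∫ t in d..1, t ^ (-1 - 2 * b) * (flg s b x t + flg s b (-x) t) := by
  have hz : 0 < 1 - x ^ 2 := by nlinarith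
  have hI : Set.uIcc d 1 = Set.Icc d 1 := Set.uIcc_of_le hd1.le
  have hD : ∀ t ∈ Set.uIcc d 1, 0 < 1 - x ^ 2 * t ^ 2 := by
    intro t ht
    rw [hI] at ht
    have := ht.1
    have := ht.2
    have : t ^ 2 ≤ 1 := by nlinarith
    nlinarith [sq_nonneg x]
  have hder : ∀ t ∈ Set.uIcc d 1, HasDerivAt (fun t : ℝ => (1 - x ^ 2) * t ^ 2 / (1 - x ^ 2 * t ^ 2))
      (2 * (1 - x ^ 2) * t / (1 - x ^ 2 * t ^ 2) ^ 2) t := by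
    intro t ht
    have d0 : HasDerivAt (fun t : ℝ => t ^ 2) (2 * t) t := by
      simpa using hasDerivAt_pow 2 t
    have d1 : HasDerivAt (fun t : ℝ => (1 - x ^ 2) * t ^ 2) ((1 - x ^ 2) * (2 * t)) t := d0.const_mul _
    have d2 : HasDerivAt (fun t : ℝ => 1 - x ^ 2 * t ^ 2) (-(x ^ 2 * (2 * t))) t :=
      (d0.const_mul (x ^ 2)).const_sub 1
    refine (d1.div d2 (hD t ht).ne').congr_deriv ?_
    congr 1
    ring
  have hsub : Set.Ioo (min d 1) (max d 1) ⊆ Set.uIcc d 1 := by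
    rw [hI, min_eq_left hd1.le, max_eq_right hd1.le]
    exact Set.Ioo_subset_Icc_self
  have key := intervalIntegral.integral_comp_mul_deriv_of_deriv_nonneg
    (g := fun r : ℝ => r ^ (-1 - b) * (1 - r) ^ ((s:ℝ) + b) * flQ s x r)
    (fun t ht => (hder t ht).continuousAt.continuousWithinAt)
    (fun t ht => hder t (hsub ht))
    (fun t ht => by
      have := hsub ht
      rw [hI] at this
      have : 0 < t := by linarith [this.1]
      positivity)
  have h1 : (1 - x ^ 2) * 1 ^ 2 / (1 - x ^ 2 * 1 ^ 2) = 1 := by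
    rw [one_pow, mul_one, mul_one, div_self hz.ne']
  rw [h1] at key
  rw [← key, ← intervalIntegral.integral_const_mul]
  refine intervalIntegral.integral_congr fun t ht => ?_
  have hD' := hD t ht
  rw [hI] at ht
  have ht0 : 0 < t := by linarith [ht.1]
  have ht1 : 0 ≤ 1 - t ^ 2 := by nlinarith [ht.2]
  have hwp : 0 < 1 + x * t := fl_wpos hx1 hx2 ht0.le ht.2
  have hwm : 0 < 1 - x * t := by
    have := fl_wpos (x := -x) (by linarith) (by linarith) ht0.le ht.2
    linarith
  simp only [Function.comp, flg]
  rw [flQ_eval s hD'.ne']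
  have hDw : 1 - x ^ 2 * t ^ 2 = (1 + x * t) * (1 - x * t) := by ring
  have e1 : ((1 + x * t) ^ (2 * s + 1))⁻¹ + ((1 + -x * t) ^ (2 * s + 1))⁻¹ =
      ((1 + x * t) ^ (2 * s + 1) + (1 - x * t) ^ (2 * s + 1)) * (1 - x ^ 2 * t ^ 2) ^ (-(2 * (s:ℝ) + 1)) := by
    have : (1 - x ^ 2 * t ^ 2) ^ (-(2 * (s:ℝ) + 1)) = ((1 - x ^ 2 * t ^ 2) ^ (2 * s + 1))⁻¹ := by
      rw [Real.rpow_neg hD'.le]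
      congr 1
      rw [← Real.rpow_natCast _ (2 * s + 1)]
      push_cast
      rfl
    rw [this, hDw, mul_pow, show 1 + -x * t = 1 - x * t by ring]
    field_simp
    ring
  rw [← mul_add, e1]
  generalize (1 + x * t) ^ (2 * s + 1) + (1 - x * t) ^ (2 * s + 1) = W
  have e2 : 1 - (1 - x ^ 2) * t ^ 2 / (1 - x ^ 2 * t ^ 2) = (1 - t ^ 2) * (1 - x ^ 2 * t ^ 2) ^ (-1:ℝ) := by
    rw [Real.rpow_neg_one]
    field_simp
    ring
  have e3 : (1 - x ^ 2) * t ^ 2 / (1 - x ^ 2 * t ^ 2) = (1 - x ^ 2) * t ^ (2:ℝ) * (1 - x ^ 2 * t ^ 2) ^ (-1:ℝ) := by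
    rw [Real.rpow_neg_one, Real.rpow_ofNat]
    rfl
  have e4 : (1 - x ^ 2) ^ s / (1 - x ^ 2 * t ^ 2) ^ s * (W / 2) = (1 - x ^ 2) ^ (s:ℝ) * (1 - x ^ 2 * t ^ 2) ^ (-(s:ℝ)) * (W / 2) := by
    rw [Real.rpow_neg hD'.le, Real.rpow_natCast, Real.rpow_natCast]; rfl
  have e5 : 2 * (1 - x ^ 2) * t / (1 - x ^ 2 * t ^ 2) ^ 2 = 2 * (1 - x ^ 2) ^ (1:ℝ) * t ^ (1:ℝ) * (1 - x ^ 2 * t ^ 2) ^ (-2:ℝ) := by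
    rw [Real.rpow_neg hD'.le, Real.rpow_ofNat, Real.rpow_one, Real.rpow_one]; rfl
  rw [e2, e3, e4, e5]
  generalize hDD : 1 - x ^ 2 * t ^ 2 = D at *
  generalize hzz : 1 - x ^ 2 = z at *
  rw [Real.mul_rpow (by positivity) (by positivity), Real.mul_rpow hz.le (by positivity),
    Real.mul_rpow ht1 (by positivity), ← Real.rpow_mul hD'.le, ← Real.rpow_mul hD'.le, ← Real.rpow_mul ht0.le]
  have z1 : z ^ ((s:ℝ) - b) = z ^ (-1 - b) * z ^ (s:ℝ) * z ^ (1:ℝ) := by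
    rw [← Real.rpow_add hz, ← Real.rpow_add hz]; congr 1; ring
  have t1 : t ^ (-1 - 2 * b) = t ^ (2 * (-1 - b)) * t ^ (1:ℝ) := by
    rw [← Real.rpow_add ht0]; congr 1; ring
  have w1 : D ^ (-(2 * (s:ℝ) + 1)) = D ^ (-1 * (-1 - b)) * D ^ (-1 * ((s:ℝ) + b)) * D ^ (-(s:ℝ)) * D ^ (-2:ℝ) := by
    rw [← Real.rpow_add hD', ← Real.rpow_add hD', ← Real.rpow_add hD']; congr 1; ring
  rw [z1, w1, t1]
  ring

lemma fl_Gamma_add (a : ℝ) (n : ℕ) (h : ∀ m : ℕ, a + m ≠ 0) :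
    Real.Gamma (a + n) = (ascPochhammer ℝ n).eval a * Real.Gamma a := by
  induction n with
  | zero => simp
  | succ n ih =>
    rw [ascPochhammer_succ_eval]
    push_cast
    rw [← add_assoc, Real.Gamma_add_one (h n), ih]
    ring

noncomputable def flc (s : ℕ) (x : ℝ) (j i : ℕ) : ℝ :=
  ((2 * s + 1).choose (2 * j) : ℝ) * (x ^ 2) ^ j * (((s - j).choose i : ℝ) * (-x ^ 2) ^ i)

lemma flQ_expand (s : ℕ) (x r : ℝ) :
    flQ s x r = ∑ j ∈ Finset.range (s + 1), ∑ i ∈ Finset.range (s + 1 - j),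
      flc s x j i * (r ^ j * (1 - r) ^ i) := by
  unfold flQ flc
  refine Finset.sum_congr rfl fun j hj => ?_
  have hj : j ≤ s := by have := Finset.mem_range.1 hj; omega
  rw [show 1 - x ^ 2 * (1 - r) = (-x ^ 2) * (1 - r) + 1 by ring, add_pow, Finset.mul_sum,
    show s + 1 - j = s - j + 1 by omega]
  refine Finset.sum_congr rfl fun i _ => ?_
  rw [mul_pow, mul_pow, one_pow]
  ring

lemma fl_limF (s : ℕ) {b : ℝ} (x : ℝ) (hb0 : 0 < b) (hb1 : b < 1) :
    Tendsto (fun η : ℝ => (∫ r in η..1, r ^ (-1 - b) * (1 - r) ^ ((s:ℝ) + b) * flQ s x r)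
        - (1 - x ^ 2) ^ s * (η ^ (-b) / b)) (𝓝[>] 0)
      (𝓝 (∑ j ∈ Finset.range (s + 1), ∑ i ∈ Finset.range (s + 1 - j),
        flc s x j i * (Real.Gamma (j - b) * Real.Gamma ((s:ℝ) + b + i + 1) /
          Real.Gamma (j - b + ((s:ℝ) + b + i + 1))))) := by
  have T : Tendsto (fun η : ℝ => ∑ j ∈ Finset.range (s + 1), ∑ i ∈ Finset.range (s + 1 - j),
      flc s x j i * ((∫ r in η..1, r ^ ((j:ℝ) - b - 1) * (1 - r) ^ ((s:ℝ) + b + i))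
        - (if j = 0 then η ^ (-b) / b else 0))) (𝓝[>] 0) 
      (𝓝 (∑ j ∈ Finset.range (s + 1), ∑ i ∈ Finset.range (s + 1 - j),
        flc s x j i * (Real.Gamma (j - b) * Real.Gamma ((s:ℝ) + b + i + 1) /
          Real.Gamma (j - b + ((s:ℝ) + b + i + 1))))) := by
    refine tendsto_finsetSum _ fun j _ => tendsto_finsetSum _ fun i _ => ?_
    exact (fl_fp hb0 hb1 (c := (s:ℝ) + b + i) (by positivity) j).const_mul _
  refine T.congr' ?_
  filter_upwards [Ioo_mem_nhdsGT (zero_lt_one' ℝ)] with η hη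
  have hI : Set.uIcc η 1 = Set.Icc η 1 := Set.uIcc_of_le hη.2.le
  have ii : ∀ j i : ℕ, IntervalIntegrable (fun r : ℝ => r ^ ((j:ℝ) - b - 1) * (1 - r) ^ ((s:ℝ) + b + i)) volume η 1 := by
    intro j i
    refine ContinuousOn.intervalIntegrable fun r hr => ?_
    rw [hI] at hr
    refine ContinuousAt.continuousWithinAt (ContinuousAt.mul ?_ ?_)
    · exact Real.continuousAt_rpow_const _ _ (Or.inl (by linarith [hr.1, hη.1]))
    · exact ContinuousAt.rpow_const (by fun_prop) (Or.inr (by positivity))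
  have e1 : ∫ r in η..1, r ^ (-1 - b) * (1 - r) ^ ((s:ℝ) + b) * flQ s x r =
      ∑ j ∈ Finset.range (s + 1), ∑ i ∈ Finset.range (s + 1 - j),
      flc s x j i * ∫ r in η..1, r ^ ((j:ℝ) - b - 1) * (1 - r) ^ ((s:ℝ) + b + i) := by
    have : ∀ j i : ℕ, flc s x j i * ∫ r in η..1, r ^ ((j:ℝ) - b - 1) * (1 - r) ^ ((s:ℝ) + b + i) =
        ∫ r in η..1, flc s x j i * (r ^ ((j:ℝ) - b - 1) * (1 - r) ^ ((s:ℝ) + b + i)) := by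
      intro j i
      rw [intervalIntegral.integral_const_mul]
    simp only [this]
    rw [Finset.sum_congr rfl fun j _ => (intervalIntegral.integral_finsetSum (fun i _ => (ii j i).const_mul _)).symm]
    rw [← intervalIntegral.integral_finsetSum (fun j _ => ?_)]
    · refine intervalIntegral.integral_congr fun r hr => ?_
      rw [hI] at hr
      have hr0 : 0 < r := by linarith [hr.1, hη.1]
      rw [flQ_expand, Finset.mul_sum]
      refine Finset.sum_congr rfl fun j _ => ?_
      rw [Finset.mul_sum]
      refine Finset.sum_congr rfl fun i _ => ?_
      rw [show (j:ℝ) - b - 1 = (-1 - b) + j by ring, Real.rpow_add hr0, Real.rpow_natCast,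
        Real.rpow_add_natCast' (by linarith [hr.2]) (by positivity)]
      ring
    · have := IntervalIntegrable.sum (Finset.range (s + 1 - j)) (fun i _ => (ii j i).const_mul (flc s x j i))
      refine this.congr ?_
      intro r _
      simp
  have e2 : ∑ j ∈ Finset.range (s + 1), ∑ i ∈ Finset.range (s + 1 - j),
      flc s x j i * (if j = 0 then η ^ (-b) / b else 0) = (1 - x ^ 2) ^ s * (η ^ (-b) / b) := by
    rw [Finset.sum_range_succ']
    simp only [Nat.add_eq_zero_iff, one_ne_zero, and_false, if_false, mul_zero, Finset.sum_const_zero, zero_add, if_true]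
    rw [← Finset.sum_mul]
    congr 1
    rw [show 1 - x ^ 2 = -x ^ 2 + 1 by ring, add_pow]
    refine Finset.sum_congr rfl fun i _ => ?_
    simp [flc]
    ring
  simp only [mul_sub, Finset.sum_sub_distrib]
  rw [e1, e2]

lemma fl_final (s : ℕ) {α : ℝ} (x : ℝ) (hα0 : 0 < α) (hα1 : α < 2) :
    fracLapConst 1 α * (-(∑ j ∈ Finset.range (s + 1), ∑ i ∈ Finset.range (s + 1 - j),
        flc s x j i * (Real.Gamma (j - α / 2) * Real.Gamma ((s:ℝ) + α / 2 + i + 1) /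
          Real.Gamma (j - α / 2 + ((s:ℝ) + α / 2 + i + 1))))) =
    (2 ^ α * Real.Gamma ((α + 1) / 2) * Real.Gamma ((s : ℝ) + 1 + α / 2) /
            (Real.sqrt Real.pi * Real.Gamma ((s : ℝ) + 1))) *
        ∑ k ∈ Finset.range (s + 1),
          ((ascPochhammer ℝ k).eval ((α + 1) / 2) * (ascPochhammer ℝ k).eval (-(s : ℝ)) /
              ((ascPochhammer ℝ k).eval (1 / 2) * (Nat.factorial k : ℝ))) *
            x ^ (2 * k) := by
  rw [← Finset.sum_range_diag_flip (s + 1) (fun j i => flc s x j i * (Real.Gamma (j - α / 2) * Real.Gamma ((s:ℝ) + α / 2 + i + 1) /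
          Real.Gamma (j - α / 2 + ((s:ℝ) + α / 2 + i + 1))))]
  rw [← Finset.sum_neg_distrib, Finset.mul_sum, Finset.mul_sum]
  refine Finset.sum_congr rfl fun k hk => ?_
  have hk : k ≤ s := by have := Finset.mem_range.1 hk; omega
  have hsum := flT_sum s (α / 2) k hk
  have hG1 : Real.Gamma (1 - α / 2) = -(α / 2) * Real.Gamma (-(α / 2)) := by
    rw [← Real.Gamma_add_one (by linarith)]; congr 1; ring
  have hG0 : Real.Gamma (-(α / 2)) ≠ 0 := by
    intro h
    have : 0 < Real.Gamma (1 - α / 2) := Real.Gamma_pos_of_pos (by linarith)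
    rw [hG1, h] at this
    simp at this
  have hinner : ∑ j ∈ Finset.range (k + 1), flc s x j (k - j) * (Real.Gamma (j - α / 2) * Real.Gamma ((s:ℝ) + α / 2 + (k - j : ℕ) + 1) /
          Real.Gamma (j - α / 2 + ((s:ℝ) + α / 2 + (k - j : ℕ) + 1))) =
      (-1) ^ k * x ^ (2 * k) * Real.Gamma (-(α / 2)) * Real.Gamma ((s : ℝ) + 1 + α / 2) / ((s + k).factorial : ℝ) *
       ∑ j ∈ Finset.range (k + 1), flT s (α / 2) k j := by
    rw [Finset.mul_sum]
    refine Finset.sum_congr rfl fun j hj => ?_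
    have hj : j ≤ k := by have := Finset.mem_range.1 hj; omega
    obtain ⟨m, rfl⟩ := Nat.exists_eq_add_of_le hj
    rw [show j + m - j = m by omega]
    have g1 : Real.Gamma ((j:ℝ) - α / 2) = (ascPochhammer ℝ j).eval (-(α / 2)) * Real.Gamma (-(α / 2)) := by
      rw [← fl_Gamma_add]
      · congr 1; ring
      · intro m h
        have h2 : (m:ℝ) = α / 2 := by linarith
        have h3 : (0:ℝ) < m := by linarith
        have h4 : (m:ℝ) < 1 := by linarith
        have h3 : 0 < m := by exact_mod_cast h3
        have h4 : m < 1 := by exact_mod_cast h4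
        omega
    have g2 : Real.Gamma ((s:ℝ) + α / 2 + m + 1) = (ascPochhammer ℝ m).eval (1 + s + α / 2) * Real.Gamma ((s:ℝ) + 1 + α / 2) := by
      rw [show (s:ℝ) + 1 + α / 2 = 1 + s + α / 2 by ring, ← fl_Gamma_add]
      · congr 1; ring
      · intro m
        positivity
    have g3 : Real.Gamma (j - α / 2 + ((s:ℝ) + α / 2 + m + 1)) = ((s + (j + m)).factorial : ℝ) := by
      rw [← Real.Gamma_nat_eq_factorial]
      congr 1
      push_cast
      ring
    rw [g1, g2, g3]
    unfold flc flT
    rw [show j + m - j = m by omega]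
    have sg : (x ^ 2) ^ j * (-x ^ 2) ^ m = (-1) ^ (j + m) * (-1) ^ j * x ^ (2 * (j + m)) := by
      rw [neg_pow, pow_add (-1 : ℝ), pow_mul, pow_add (x ^ 2)]
      have : ((-1:ℝ) ^ j) * (-1) ^ j = 1 := by rw [← mul_pow]; simp
      linear_combination (-(-1:ℝ) ^ m * (x ^ 2) ^ j * (x ^ 2) ^ m) * this
    linear_combination (((2 * s + 1).choose (2 * j) : ℝ) * ((s - j).choose m : ℝ) * (((ascPochhammer ℝ j).eval (-(α / 2)) * Real.Gamma (-(α / 2))) * ((ascPochhammer ℝ m).eval (1 + s + α / 2) * Real.Gamma ((s:ℝ) + 1 + α / 2)) / ((s + (j + m)).factorial : ℝ))) * sg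
  rw [hinner, hsum]
  unfold fracLapConst
  rw [hG1, Nat.cast_one, ← Real.sqrt_eq_rpow, Real.Gamma_nat_eq_factorial s,
    Real.rpow_sub (by norm_num), Real.rpow_one, show α / 2 + 1 / 2 = (α + 1) / 2 by ring]
  have hf1 : ((s.factorial : ℕ) : ℝ) ≠ 0 := by positivity
  have hf2 : (((s + k).factorial : ℕ) : ℝ) ≠ 0 := by positivity
  have hf3 : ((k.factorial : ℕ) : ℝ) ≠ 0 := by positivity
  have hp : (ascPochhammer ℝ k).eval (1 / 2 : ℝ) ≠ 0 := (ascPochhammer_pos k _ (by norm_num)).ne'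
  have hpi : Real.sqrt Real.pi ≠ 0 := (Real.sqrt_pos.2 Real.pi_pos).ne'
  have sg : ((-1:ℝ) ^ k) * (-1) ^ k = 1 := by rw [← mul_pow]; simp
  have sg2 : ((-1:ℝ) ^ k) ^ 2 = 1 := by rw [sq]; exact sg
  generalize (ascPochhammer ℝ k).eval (1 / 2 : ℝ) = A at *
  generalize Real.Gamma (-(α / 2)) = G at *
  generalize ((-1:ℝ) ^ k) = S at *
  field_simp
  rw [sg2]
  ring

lemma flg_cont (s : ℕ) {b x : ℝ} (hb0 : 0 < b) (hx1 : -1 < x) (hx2 : x < 1) {t : ℝ} (ht0 : 0 < t)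
    (ht1 : t ≤ 1) : ContinuousAt (fun t : ℝ => t ^ (-1 - 2 * b) * flg s b x t) t := by
  have hw := fl_wpos hx1 hx2 ht0.le ht1
  unfold flg
  refine ContinuousAt.mul (Real.continuousAt_rpow_const _ _ (Or.inl ht0.ne')) (ContinuousAt.mul ?_ ?_)
  · exact ContinuousAt.rpow_const (by fun_prop) (Or.inr (by positivity))
  · exact ContinuousAt.inv₀ (by fun_prop) (by positivity)

lemma flg_ii (s : ℕ) {b x : ℝ} (hb0 : 0 < b) (hx1 : -1 < x) (hx2 : x < 1) {a c : ℝ} (ha0 : 0 < a)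
    (ha1 : a ≤ 1) (hc0 : 0 < c) (hc1 : c ≤ 1) :
    IntervalIntegrable (fun t : ℝ => t ^ (-1 - 2 * b) * flg s b x t) volume a c := by
  refine ContinuousOn.intervalIntegrable fun t ht => ?_
  rw [Set.mem_uIcc] at ht
  refine (flg_cont s hb0 hx1 hx2 ?_ ?_).continuousWithinAt
  · rcases ht with h | h <;> linarith [h.1]
  · rcases ht with h | h <;> linarith [h.2]

lemma flg_lip (s : ℕ) (b x : ℝ) : ∃ C > 0, ∃ t0 > 0, ∀ t, |t| < t0 → |flg s b x t - 1| ≤ C * |t| := by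
  have hd : DifferentiableAt ℝ (flg s b x) 0 := by
    unfold flg
    refine DifferentiableAt.mul ?_ ?_
    · exact DifferentiableAt.rpow_const (by fun_prop) (Or.inl (by norm_num))
    · exact DifferentiableAt.inv (by fun_prop) (by simp)
  have h0 : flg s b x 0 = 1 := by simp [flg]
  have hO := hd.isBigO_sub
  obtain ⟨C, hC, hb⟩ := hO.exists_pos
  rw [Asymptotics.isBigOWith_iff] at hb
  obtain ⟨t0, ht0, h⟩ := Metric.eventually_nhds_iff.1 hb
  refine ⟨C, hC, t0, ht0, fun t ht => ?_⟩
  have := h (y := t) (by simpa using ht)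
  simpa [h0] using this

lemma fl_cut1 (s : ℕ) {b x : ℝ} (hb0 : 0 < b) (hb1 : b < 1) (hx1 : -1 < x) (hx2 : x < 1) :
    Tendsto (fun d : ℝ => (∫ t in (d / (1 - x * d))..d, t ^ (-1 - 2 * b) * flg s b x t)
      - d ^ (-(2 * b)) * ((1 - x * d) ^ (2 * b) - 1) / (2 * b)) (𝓝[>] 0) (𝓝 0) := by
  obtain ⟨C, hC, t0, ht0, hl⟩ := flg_lip s b x
  have hlim : Tendsto (fun d : ℝ => C * (1/2) ^ (-1 - 2 * b) * 4 * d ^ (2 - 2 * b)) (𝓝[>] 0) (𝓝 0) := by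
    have : Tendsto (fun η : ℝ => η ^ (2 - 2 * b)) (𝓝[>] 0) (𝓝 ((0:ℝ) ^ (2 - 2 * b))) :=
      ((Real.continuousAt_rpow_const 0 (2 - 2 * b) (Or.inr (by linarith))).tendsto).mono_left
        nhdsWithin_le_nhds
    rw [Real.zero_rpow (by linarith)] at this
    simpa using this.const_mul (C * (1/2) ^ (-1 - 2 * b) * 4)
  refine squeeze_zero_norm' ?_ hlim
  have hm : 0 < min (t0 / 2) (1 / 4) := by positivity
  filter_upwards [Ioo_mem_nhdsGT hm] with d hd
  have hd0 := hd.1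
  have hdt : d < t0 / 2 := lt_of_lt_of_le hd.2 (min_le_left _ _)
  have hd4 : d < 1 / 4 := lt_of_lt_of_le hd.2 (min_le_right _ _)
  have hxd1 : 1 / 2 < 1 - x * d := by nlinarith
  have hxd2 : 1 - x * d < 2 := by nlinarith
  have hxd0 : 0 < 1 - x * d := by linarith
  set a := d / (1 - x * d) with ha
  have ha1 : d / 2 ≤ a := by rw [ha]; gcongr
  have ha2 : a ≤ 2 * d := by rw [ha, div_le_iff₀ hxd0]; nlinarith
  have ha0 : 0 < a := by linarith
  have hmem : ∀ t ∈ Set.uIcc a d, d / 2 ≤ t ∧ t ≤ 2 * d := by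
    intro t ht
    rw [Set.mem_uIcc] at ht
    rcases ht with h | h <;> constructor <;> linarith [h.1, h.2]
  have i1 := flg_ii s hb0 hx1 hx2 ha0 (by linarith) hd0 (by linarith)
  have n0 : (0:ℝ) ∉ Set.uIcc a d := fun h => by linarith [(hmem 0 h).1]
  have i2 : IntervalIntegrable (fun t : ℝ => t ^ (-1 - 2 * b)) volume a d :=
    intervalIntegral.intervalIntegrable_rpow (Or.inr n0)
  have v2 : ∫ t in a..d, t ^ (-1 - 2 * b) = d ^ (-(2 * b)) * ((1 - x * d) ^ (2 * b) - 1) / (2 * b) := by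
    rw [integral_rpow (Or.inr ⟨by linarith, n0⟩), show -1 - 2 * b + 1 = -(2 * b) by ring, ha,
      Real.div_rpow hd0.le hxd0.le, Real.rpow_neg hxd0.le (2 * b)]
    field_simp
    ring
  rw [← v2, ← intervalIntegral.integral_sub i1 i2]
  have bd := intervalIntegral.norm_integral_le_of_norm_le_const (a := a) (b := d)
    (f := fun t => t ^ (-1 - 2 * b) * flg s b x t - t ^ (-1 - 2 * b))
    (C := (d / 2) ^ (-1 - 2 * b) * (C * (2 * d))) (by
      intro t ht
      have ⟨h1, h2⟩ := hmem t (Set.uIoc_subset_uIcc ht)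
      have htp : 0 < t := by linarith
      rw [← mul_sub_one, norm_mul, Real.norm_eq_abs, Real.norm_eq_abs, abs_of_pos (Real.rpow_pos_of_pos htp _)]
      have hh := hl t (by rw [abs_of_pos htp]; linarith)
      rw [abs_of_pos htp] at hh
      have r1 : t ^ (-1 - 2 * b) ≤ (d / 2) ^ (-1 - 2 * b) :=
        Real.rpow_le_rpow_of_nonpos (by linarith) h1 (by linarith)
      have r2 : |flg s b x t - 1| ≤ C * (2 * d) := hh.trans (by gcongr)
      gcongr)
  refine bd.trans ?_
  have hda : |d - a| ≤ 2 * d ^ 2 := by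
    have : d - a = - (x * d ^ 2) / (1 - x * d) := by
      rw [ha, eq_div_iff hxd0.ne', sub_mul, div_mul_cancel₀ _ hxd0.ne']; ring
    rw [this, abs_div, abs_of_pos hxd0, div_le_iff₀ hxd0, abs_neg, abs_mul, abs_of_nonneg (sq_nonneg d)]
    have : |x| ≤ 1 := abs_le.2 ⟨hx1.le, hx2.le⟩
    nlinarith [sq_nonneg d]
  have e : (d / 2) ^ (-1 - 2 * b) * (C * (2 * d)) * (2 * d ^ 2) = C * (1/2) ^ (-1 - 2 * b) * 4 * d ^ (2 - 2 * b) := by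
    rw [div_eq_mul_one_div d 2, Real.mul_rpow hd0.le (by norm_num),
      show 2 - 2 * b = (-1 - 2 * b) + (3:ℕ) by push_cast; ring, Real.rpow_add hd0, Real.rpow_natCast]
    ring
  rw [← e]
  gcongr

lemma fl_even_bound {b y : ℝ} (hb0 : 0 < b) (hb1 : b < 1) (hy : |y| < 1) :
    |(1 - y) ^ (2 * b) + (1 + y) ^ (2 * b) - 2| ≤ 2 * y ^ 2 := by
  have ⟨h1, h2⟩ := abs_lt.1 hy
  have hp : 0 < 1 + y := by linarith
  have hm : 0 < 1 - y := by linarith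
  have u1 := rpow_one_add_le_one_add_mul_self (s := (1 + y) ^ 2 - 1) (by nlinarith [sq_nonneg (1 + y)]) hb0.le hb1.le
  have u2 := rpow_one_add_le_one_add_mul_self (s := (1 - y) ^ 2 - 1) (by nlinarith [sq_nonneg (1 - y)]) hb0.le hb1.le
  have c1 : (1 + ((1 + y) ^ 2 - 1)) ^ b = (1 + y) ^ (2 * b) := by
    rw [Real.rpow_mul hp.le, Real.rpow_ofNat]; congr 1; ring
  have c2 : (1 + ((1 - y) ^ 2 - 1)) ^ b = (1 - y) ^ (2 * b) := by
    rw [Real.rpow_mul hm.le, Real.rpow_ofNat]; congr 1; ring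
  rw [c1] at u1
  rw [c2] at u2
  have s1 : (1 + y) ^ (2 * b) = ((1 + y) ^ b) ^ 2 := by
    rw [← Real.rpow_ofNat, ← Real.rpow_mul hp.le]; congr 1; ring
  have s2 : (1 - y) ^ (2 * b) = ((1 - y) ^ b) ^ 2 := by
    rw [← Real.rpow_ofNat, ← Real.rpow_mul hm.le]; congr 1; ring
  have pr : (1 + y) ^ b * (1 - y) ^ b = (1 - y ^ 2) ^ b := by
    rw [← Real.mul_rpow hp.le hm.le]; congr 1; ring
  have hy2 : 0 < 1 - y ^ 2 := by nlinarith
  have lo : 1 - y ^ 2 ≤ (1 - y ^ 2) ^ b :=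
    Real.self_le_rpow_of_le_one hy2.le (by nlinarith) hb1.le
  rw [abs_le]
  constructor
  · nlinarith [sq_nonneg ((1 + y) ^ b - (1 - y) ^ b)]
  · nlinarith [sq_nonneg y]

lemma fl_cut (s : ℕ) {b x : ℝ} (hb0 : 0 < b) (hb1 : b < 1) (hx1 : -1 < x) (hx2 : x < 1) :
    Tendsto (fun d : ℝ => (∫ t in (d / (1 - x * d))..d, t ^ (-1 - 2 * b) * flg s b x t)
      + (∫ t in (d / (1 - (-x) * d))..d, t ^ (-1 - 2 * b) * flg s b (-x) t)) (𝓝[>] 0) (𝓝 0) := by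
  have t1 := fl_cut1 s hb0 hb1 hx1 hx2
  have t2 := fl_cut1 s (x := -x) hb0 hb1 (by linarith) (by linarith)
  have t3 : Tendsto (fun d : ℝ => d ^ (-(2 * b)) * ((1 - x * d) ^ (2 * b) + (1 + x * d) ^ (2 * b) - 2)) (𝓝[>] 0) (𝓝 0) := by
    refine fl_squeeze (d := 2) (C := 2 * x ^ 2) (by linarith) ?_
    filter_upwards [Ioo_mem_nhdsGT (zero_lt_one' ℝ)] with d hd
    have hh := fl_even_bound (y := x * d) hb0 hb1 (by
      rw [abs_mul, abs_of_pos hd.1]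
      have : |x| < 1 := abs_lt.2 ⟨hx1, hx2⟩
      nlinarith [hd.1, hd.2, abs_nonneg x])
    refine hh.trans (le_of_eq ?_)
    rw [Real.rpow_ofNat]
    ring
  have t4 := (t1.add t2).add (t3.const_mul (1 / (2 * b)))
  simp only [mul_zero, add_zero] at t4
  refine t4.congr fun d => ?_
  rw [show 1 - -x * d = 1 + x * d by ring]
  ring

lemma fl_ker {b x e : ℝ} (hb0 : 0 < b) (he : 0 < e) :
    IntegrableOn (fun y : ℝ => (y - x) ^ (-1 - 2 * b)) (Set.Ioi (x + e)) ∧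
    ∫ y in Set.Ioi (x + e), (y - x) ^ (-1 - 2 * b) = e ^ (-(2 * b)) / (2 * b) := by
  have hd : ∀ y ∈ Set.Ici (x + e), HasDerivAt (fun y : ℝ => -((y - x) ^ (-(2 * b))) / (2 * b))
      ((y - x) ^ (-1 - 2 * b)) y := by
    intro y hy
    have hy : x + e ≤ y := hy
    have h1 : HasDerivAt (fun y : ℝ => (y - x) ^ (-(2 * b))) (1 * (-(2 * b)) * (y - x) ^ (-(2 * b) - 1)) y :=
      HasDerivAt.rpow_const ((hasDerivAt_id y).sub_const x) (Or.inl (ne_of_gt (by linarith : 0 < y - x)))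
    refine (h1.neg.div_const (2 * b)).congr_deriv ?_
    rw [show -1 - 2 * b = -(2 * b) - 1 by ring]
    field_simp
  have hpos : ∀ y ∈ Set.Ioi (x + e), 0 ≤ (y - x) ^ (-1 - 2 * b) := by
    intro y hy
    have hy : x + e < y := hy
    exact Real.rpow_nonneg (by linarith) _
  have hl : Tendsto (fun y : ℝ => -((y - x) ^ (-(2 * b))) / (2 * b)) atTop (𝓝 0) := by
    have h1 : Tendsto (fun y : ℝ => y - x) atTop atTop := tendsto_atTop_add_const_right _ (-x) tendsto_id
    have h2 := (tendsto_rpow_neg_atTop (y := 2 * b) (by linarith)).comp h1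
    simpa using (h2.neg.div_const (2 * b))
  refine ⟨integrableOn_Ioi_deriv_of_nonneg' hd hpos hl, ?_⟩
  rw [integral_Ioi_of_hasDerivAt_of_nonneg' hd hpos hl]
  rw [show x + e - x = e by ring]
  ring

lemma fl_R (s : ℕ) {b x e : ℝ} (hb0 : 0 < b) (hx1 : -1 < x) (he : 0 < e) (hxe : x + e < 1) :
    IntegrableOn (fun y : ℝ => ((max (1 - x ^ 2) 0) ^ ((s:ℝ) + b) - (max (1 - y ^ 2) 0) ^ ((s:ℝ) + b))
      / |x - y| ^ (1 + 2 * b)) (Set.Ioi (x + e)) ∧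
    ∫ y in Set.Ioi (x + e), ((max (1 - x ^ 2) 0) ^ ((s:ℝ) + b) - (max (1 - y ^ 2) 0) ^ ((s:ℝ) + b))
      / |x - y| ^ (1 + 2 * b) = (1 - x ^ 2) ^ ((s:ℝ) + b) * (e ^ (-(2 * b)) / (2 * b)) -
        ∫ y in (x + e)..1, (1 - y ^ 2) ^ ((s:ℝ) + b) * (y - x) ^ (-1 - 2 * b) := by
  have hsb : 0 < (s:ℝ) + b := by positivity
  obtain ⟨k1, k2⟩ := fl_ker (x := x) hb0 he
  have hz : 0 < 1 - x ^ 2 := by nlinarith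
  rw [max_eq_left hz.le]
  have hsubs : Set.Ioc (x + e) 1 ⊆ Set.Ioi (x + e) := fun y hy => hy.1
  have hzero : ∀ y : ℝ, 1 < y → (max (1 - y ^ 2) 0) ^ ((s:ℝ) + b) * (y - x) ^ (-1 - 2 * b) = 0 := by
    intro y hy
    rw [max_eq_right (by nlinarith), Real.zero_rpow hsb.ne', zero_mul]
  have i1 : IntegrableOn (fun y : ℝ => (max (1 - y ^ 2) 0) ^ ((s:ℝ) + b) * (y - x) ^ (-1 - 2 * b)) (Set.Ioi (x + e)) := by
    rw [← Set.Ioc_union_Ioi_eq_Ioi hxe.le]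
    refine IntegrableOn.union ?_ ?_
    · refine IntegrableOn.mono_set (t := Set.Icc (x + e) 1) ?_ Set.Ioc_subset_Icc_self
      refine ContinuousOn.integrableOn_Icc fun y hy => ContinuousAt.continuousWithinAt ?_
      refine ContinuousAt.mul ?_ ?_
      · exact ContinuousAt.rpow_const (by fun_prop) (Or.inr hsb.le)
      · exact ContinuousAt.rpow_const (by fun_prop) (Or.inl (by linarith [hy.1]))
    · refine (integrableOn_zero (ε' := ℝ)).congr_fun (fun y hy => ?_) measurableSet_Ioi
      exact (hzero y hy).symm
  have v1 : ∫ y in Set.Ioi (x + e), (max (1 - y ^ 2) 0) ^ ((s:ℝ) + b) * (y - x) ^ (-1 - 2 * b) =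
      ∫ y in (x + e)..1, (1 - y ^ 2) ^ ((s:ℝ) + b) * (y - x) ^ (-1 - 2 * b) := by
    rw [intervalIntegral.integral_of_le hxe.le,
      setIntegral_eq_of_subset_of_forall_sdiff_eq_zero measurableSet_Ioi hsubs (fun y hy => hzero y (by
        by_contra h
        exact hy.2 ⟨hy.1, not_lt.1 h⟩))]
    refine setIntegral_congr_fun measurableSet_Ioc fun y hy => ?_
    have h1 := hy.1
    have h2 := hy.2
    rw [max_eq_left (by nlinarith)]
  have eqon : Set.EqOn (fun y : ℝ => (1 - x ^ 2) ^ ((s:ℝ) + b) * (y - x) ^ (-1 - 2 * b) -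
      (max (1 - y ^ 2) 0) ^ ((s:ℝ) + b) * (y - x) ^ (-1 - 2 * b))
      (fun y : ℝ => ((1 - x ^ 2) ^ ((s:ℝ) + b) - (max (1 - y ^ 2) 0) ^ ((s:ℝ) + b))
      / |x - y| ^ (1 + 2 * b)) (Set.Ioi (x + e)) := by
    intro y hy
    have hy : x + e < y := hy
    simp only
    rw [abs_sub_comm, abs_of_pos (by linarith), ← sub_mul, show -1 - 2 * b = -(1 + 2 * b) by ring,
      Real.rpow_neg (by linarith)]
    rfl
  have hI : IntegrableOn (fun y : ℝ => (1 - x ^ 2) ^ ((s:ℝ) + b) * (y - x) ^ (-1 - 2 * b) -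
      (max (1 - y ^ 2) 0) ^ ((s:ℝ) + b) * (y - x) ^ (-1 - 2 * b)) (Set.Ioi (x + e)) :=
    Integrable.sub (k1.const_mul _) i1
  refine ⟨hI.congr_fun eqon measurableSet_Ioi, ?_⟩
  rw [← setIntegral_congr_fun measurableSet_Ioi eqon, integral_sub (k1.const_mul _) i1, v1,
    integral_const_mul, k2]

lemma fl_split (s : ℕ) {b x e : ℝ} (hb0 : 0 < b) (hx1 : -1 < x) (hx2 : x < 1) (he : 0 < e)
    (hxe : x + e < 1) (hxe' : -x + e < 1) :
    ∫ y in {y : ℝ | e < |x - y|}, ((max (1 - x ^ 2) 0) ^ ((s:ℝ) + b) - (max (1 - y ^ 2) 0) ^ ((s:ℝ) + b))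
      / |x - y| ^ (1 + 2 * b) = 2 * ((1 - x ^ 2) ^ ((s:ℝ) + b) * (e ^ (-(2 * b)) / (2 * b))) -
        (∫ y in (x + e)..1, (1 - y ^ 2) ^ ((s:ℝ) + b) * (y - x) ^ (-1 - 2 * b)) -
        ∫ y in (-x + e)..1, (1 - y ^ 2) ^ ((s:ℝ) + b) * (y - (-x)) ^ (-1 - 2 * b) := by
  obtain ⟨p1, p2⟩ := fl_R s hb0 hx1 he hxe
  obtain ⟨q1, q2⟩ := fl_R s (x := -x) hb0 (by linarith) he hxe'
  have hset : {y : ℝ | e < |x - y|} = Set.Iio (x - e) ∪ Set.Ioi (x + e) := by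
    ext y
    simp only [Set.mem_ofPred_eq, Set.mem_union, Set.mem_Iio, Set.mem_Ioi, lt_abs]
    constructor
    · rintro (h | h)
      · left; linarith
      · right; linarith
    · rintro (h | h)
      · left; linarith
      · right; linarith
  set f : ℝ → ℝ := fun y : ℝ => ((max (1 - x ^ 2) 0) ^ ((s:ℝ) + b) - (max (1 - y ^ 2) 0) ^ ((s:ℝ) + b))
      / |x - y| ^ (1 + 2 * b) with hf
  have hneg : (fun y : ℝ => ((max (1 - (-x) ^ 2) 0) ^ ((s:ℝ) + b) - (max (1 - y ^ 2) 0) ^ ((s:ℝ) + b))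
      / |-x - y| ^ (1 + 2 * b)) = fun y => f (-y) := by
    funext y
    simp only [hf, neg_sq]
    rw [show -x - y = -(x - -y) by ring, abs_neg]
  rw [hneg] at q1
  have q2' : ∫ y in Set.Ioi (-x + e), f (-y) = (1 - x ^ 2) ^ ((s:ℝ) + b) * (e ^ (-(2 * b)) / (2 * b)) -
        ∫ y in (-x + e)..1, (1 - y ^ 2) ^ ((s:ℝ) + b) * (y - (-x)) ^ (-1 - 2 * b) := by
    rw [← hneg, q2, neg_sq]
  rw [integral_comp_neg_Ioi, show -(-x + e) = x - e by ring, integral_Iic_eq_integral_Iio] at q2'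
  have hi : IntegrableOn f (Set.Iio (x - e)) := by
    rw [← integrableOn_Iic_iff_integrableOn_Iio]
    have := (integrableOn_Iic_iff_integrableOn_Iio (μ := volume) (f := f) (b := x - e))
    have h3 := (MeasurePreserving.integrableOn_comp_preimage (Measure.measurePreserving_neg (volume : Measure ℝ))
      (Homeomorph.neg ℝ).measurableEmbedding (f := f) (s := Set.Iio (x - e)))
    have hpre : (Neg.neg ⁻¹' (Set.Iio (x - e)) : Set ℝ) = Set.Ioi (-x + e) := by
      ext y
      simp only [Set.mem_preimage, Set.mem_Iio, Set.mem_Ioi]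
      constructor <;> intro h <;> linarith
    rw [this]
    rw [hpre] at h3
    exact h3.1 q1
  have p2' : ∫ y in Set.Ioi (x + e), f y = _ := p2
  rw [hset, setIntegral_union ?_ measurableSet_Ioi hi p1, q2', p2']
  · ring
  · rw [Set.disjoint_left]
    intro y h1 h2
    have h1 : y < x - e := h1
    have h2 : x + e < y := h2
    linarith

lemma fl_eval (s : ℕ) {b x d : ℝ} (hb0 : 0 < b) (hx1 : -1 < x) (hx2 : x < 1) (hd0 : 0 < d)
    (hd : d < 1 / 4) :
    ∫ y in (x + (1 - x ^ 2) * d)..1, (1 - y ^ 2) ^ ((s:ℝ) + b) * (y - x) ^ (-1 - 2 * b) =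
      (1 - x ^ 2) ^ ((s:ℝ) - b) * ((∫ t in (d / (1 - x * d))..d, t ^ (-1 - 2 * b) * flg s b x t) +
        ∫ t in d..1, t ^ (-1 - 2 * b) * flg s b x t) := by
  have hw : 1 / 2 < 1 - x * d := by nlinarith
  have hw0 : 0 < 1 - x * d := by linarith
  have ha0 : 0 < d / (1 - x * d) := by positivity
  have ha1 : d / (1 - x * d) < 1 := by rw [div_lt_one hw0]; linarith
  have key := fl_mobius s (b := b) hx1 hx2 ha0 ha1
  rw [intervalIntegral.integral_add_adjacent_intervals (flg_ii s hb0 hx1 hx2 ha0 ha1.le hd0 (by linarith))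
    (flg_ii s hb0 hx1 hx2 hd0 (by linarith) one_pos le_rfl), ← key]
  congr 1
  field_simp
  ring

/-- For `α ∈ (0,2)`, `s ∈ ℕ` and `u(y) = (max(1-y²,0))^{s+α/2}` on `ℝ`, for
every `x ∈ (-1,1)` the principal value limit defining the fractional Laplacian of `u` at `x`
exists and equals
`(2^α Γ((α+1)/2) Γ(s+1+α/2)/(√π Γ(s+1))) · ₂F₁((α+1)/2, -s; 1/2; x²)`, the hypergeometric
series terminating after `s+1` terms. -/
theorem fracLap_compact_solution_1d (α : ℝ) (hα : α ∈ Set.Ioo (0 : ℝ) 2) (s : ℕ)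
    (u : ℝ → ℝ) (hu : ∀ y, u y = (max (1 - y ^ 2) 0) ^ ((s : ℝ) + α / 2))
    (x : ℝ) (hx : x ∈ Set.Ioo (-1 : ℝ) 1) :
    Tendsto
      (fun ε : ℝ => fracLapConst 1 α *
        ∫ y in {y : ℝ | ε < |x - y|}, (u x - u y) / |x - y| ^ (1 + α))
      (𝓝[>] 0)
      (𝓝 ((2 ^ α * Real.Gamma ((α + 1) / 2) * Real.Gamma ((s : ℝ) + 1 + α / 2) /
            (Real.sqrt Real.pi * Real.Gamma ((s : ℝ) + 1))) *
        ∑ k ∈ Finset.range (s + 1),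
          ((ascPochhammer ℝ k).eval ((α + 1) / 2) * (ascPochhammer ℝ k).eval (-(s : ℝ)) /
              ((ascPochhammer ℝ k).eval (1 / 2) * (Nat.factorial k : ℝ))) *
            x ^ (2 * k))) := by
  obtain ⟨hx1, hx2⟩ := hx
  rw [← fl_final s x hα.1 hα.2]
  refine Tendsto.const_mul _ ?_
  obtain ⟨b, rfl⟩ : ∃ b, α = 2 * b := ⟨α / 2, by ring⟩
  have hb0 : 0 < b := by linarith [hα.1]
  have hb1 : b < 1 := by linarith [hα.2]
  simp only [show 2 * b / 2 = b by ring] at hu ⊢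
  simp only [hu]
  have hz : 0 < 1 - x ^ 2 := by nlinarith
  have hz1 : 1 - x ^ 2 ≤ 1 := by nlinarith
  set L := ∑ j ∈ Finset.range (s + 1), ∑ i ∈ Finset.range (s + 1 - j),
        flc s x j i * (Real.Gamma (j - b) * Real.Gamma ((s:ℝ) + b + i + 1) /
          Real.Gamma (j - b + ((s:ℝ) + b + i + 1))) with hL
  -- the limit in the rescaled variable
  have hη : Tendsto (fun d : ℝ => (1 - x ^ 2) * d ^ 2 / (1 - x ^ 2 * d ^ 2)) (𝓝[>] 0) (𝓝[>] 0) := by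
    refine tendsto_nhdsWithin_iff.2 ⟨?_, ?_⟩
    · have : ContinuousAt (fun d : ℝ => (1 - x ^ 2) * d ^ 2 / (1 - x ^ 2 * d ^ 2)) 0 :=
        ContinuousAt.div (by fun_prop) (by fun_prop) (by simp)
      have h := this.tendsto
      simp only [ne_eq, OfNat.ofNat_ne_zero, not_false_eq_true, zero_pow, mul_zero, zero_div] at h
      exact h.mono_left nhdsWithin_le_nhds
    · filter_upwards [Ioo_mem_nhdsGT (zero_lt_one' ℝ)] with d hd
      have h1 := hd.1
      have h2 : d ^ 2 < 1 := by nlinarith [hd.2]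
      have : 0 < 1 - x ^ 2 * d ^ 2 := by nlinarith [sq_nonneg x]
      exact div_pos (by positivity) this
  have T1 := (fl_limF s x hb0 hb1).comp hη
  rw [← hL] at T1
  have T2 := fl_cut s hb0 hb1 hx1 hx2
  have T3 : Tendsto (fun d : ℝ => d ^ (-(2 * b)) * (1 - (1 - x ^ 2 * d ^ 2) ^ b)) (𝓝[>] 0) (𝓝 0) := by
    refine fl_squeeze (d := 2) (C := 1) (by linarith) ?_
    filter_upwards [Ioo_mem_nhdsGT (zero_lt_one' ℝ)] with d hd
    have h1 := hd.1
    have h2 : d ^ 2 < 1 := by nlinarith [hd.2]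
    have h3 : 0 < 1 - x ^ 2 * d ^ 2 := by nlinarith [sq_nonneg x]
    have h4 : 0 ≤ x ^ 2 * d ^ 2 := by positivity
    have lo := Real.self_le_rpow_of_le_one h3.le (by linarith) hb1.le
    have up := Real.rpow_le_one h3.le (by linarith) hb0.le
    rw [Real.rpow_ofNat, abs_of_nonneg (by linarith)]
    nlinarith [sq_nonneg d]
  have T : Tendsto (fun d : ℝ => ∫ y in {y : ℝ | (1 - x ^ 2) * d < |x - y|},
      ((max (1 - x ^ 2) 0) ^ ((s:ℝ) + b) - (max (1 - y ^ 2) 0) ^ ((s:ℝ) + b))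
      / |x - y| ^ (1 + 2 * b)) (𝓝[>] 0) (𝓝 (-L)) := by
    have T4 := ((T1.neg).sub (T2.const_mul ((1 - x ^ 2) ^ ((s:ℝ) - b)))).add
      (T3.const_mul ((1 - x ^ 2) ^ ((s:ℝ) - b) / b))
    simp only [mul_zero, sub_zero, add_zero] at T4
    refine T4.congr' ?_
    filter_upwards [Ioo_mem_nhdsGT (show (0:ℝ) < 1 / 4 by norm_num)] with d hd
    have hd0 := hd.1
    have hd4 := hd.2
    have he : 0 < (1 - x ^ 2) * d := by positivity
    have m1 := fl_eval s hb0 hx1 hx2 hd0 hd4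
    have m2 := fl_eval s (x := -x) hb0 (by linarith) (by linarith) hd0 hd4
    rw [neg_sq] at m2
    have s2 := fl_sub2 s (b := b) hx1 hx2 hd0 (by linarith)
    simp only [mul_add] at s2
    rw [intervalIntegral.integral_add (flg_ii s hb0 hx1 hx2 hd0 (by linarith) one_pos le_rfl)
      (flg_ii s (x := -x) hb0 (by linarith) (by linarith) hd0 (by linarith) one_pos le_rfl)] at s2
    rw [fl_split s hb0 hx1 hx2 he (by nlinarith) (by nlinarith), m1, m2]
    simp only [Function.comp]
    rw [s2]
    have h2 : d ^ 2 < 1 := by nlinarith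
    have h3 : 0 < 1 - x ^ 2 * d ^ 2 := by nlinarith [sq_nonneg x]
    have p1 : ((1 - x ^ 2) * d ^ 2 / (1 - x ^ 2 * d ^ 2)) ^ (-b) =
        (1 - x ^ 2) ^ (-b) * d ^ (-(2 * b)) * (1 - x ^ 2 * d ^ 2) ^ b := by
      rw [Real.div_rpow (by positivity) h3.le, Real.mul_rpow hz.le (by positivity), Real.rpow_neg h3.le,
        ← Real.rpow_ofNat d 2, ← Real.rpow_mul hd0.le, div_inv_eq_mul]
      congr 3
      ring
    have p2 : (1 - x ^ 2) ^ ((s:ℝ) - b) = (1 - x ^ 2) ^ s * (1 - x ^ 2) ^ (-b) := by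
      rw [show (s:ℝ) - b = (s:ℝ) + -b by ring, Real.rpow_add hz, Real.rpow_natCast]
    have p3 : ((1 - x ^ 2) * d) ^ (-(2 * b)) = (1 - x ^ 2) ^ (-(2 * b)) * d ^ (-(2 * b)) :=
      Real.mul_rpow hz.le hd0.le
    have p4 : (1 - x ^ 2) ^ ((s:ℝ) + b) * (1 - x ^ 2) ^ (-(2 * b)) = (1 - x ^ 2) ^ s * (1 - x ^ 2) ^ (-b) := by
      rw [← p2, ← Real.rpow_add hz]; congr 1; ring
    rw [p1, p3, p2]
    linear_combination (-(d ^ (-(2 * b))) / b) * p4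
  have hsc : Tendsto (fun ε : ℝ => ε / (1 - x ^ 2)) (𝓝[>] 0) (𝓝[>] 0) := by
    refine tendsto_nhdsWithin_iff.2 ⟨?_, ?_⟩
    · have : ContinuousAt (fun ε : ℝ => ε / (1 - x ^ 2)) 0 := by fun_prop
      have h := this.tendsto
      simp only [zero_div] at h
      exact h.mono_left nhdsWithin_le_nhds
    · filter_upwards [self_mem_nhdsWithin] with ε hε
      exact div_pos hε hz
  refine (T.comp hsc).congr fun ε => ?_
  simp only [Function.comp]
  rw [mul_div_cancel₀ _ hz.ne']
end

section
/- Let α ∈ (0, 2) and let u : ℝ² → ℝ be given by u(x) = e^{−|x|²}. Then for every x ∈ ℝ² the principal value limit defining the fractional Laplacian of u at x exists, and C_{2,α} · lim_{ε→0⁺} ∫_{{y : |x−y| > ε}} (e^{−|x|²} − e^{−|y|²}) / |x − y|^{2+α} dy = 2^α Γ(1 + α/2) · Σ_{k=0}^{∞} [ (1 + α/2)_k / (k!)² ] · (−|x|²)^k, where the series (the confluent hypergeometric series ₁F₁(1 + α/2; 1; −|x|²)) converges absolutely for all x. -/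
open MeasureTheory Real Topology Filter Polynomial

/-- coefficients of the confluent hypergeometric series with second parameter `1` -/
noncomputable def hypCoef (a : ℝ) (k : ℕ) : ℝ :=
  (ascPochhammer ℝ k).eval a / ((Nat.factorial k : ℝ)) ^ 2

lemma hypCoef_succ (a : ℝ) (k : ℕ) :
    hypCoef a (k + 1) = hypCoef a k * ((a + k) / ((k : ℝ) + 1) ^ 2) := by
  unfold hypCoef
  rw [ascPochhammer_succ_eval, Nat.factorial_succ]
  have : ((Nat.factorial k : ℝ)) ≠ 0 := by positivity
  have h2 : (k : ℝ) + 1 ≠ 0 := by positivity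
  push_cast
  field_simp

lemma summable_hyp (a s : ℝ) : Summable (fun k : ℕ => hypCoef a k * s ^ k) := by
  have hlim : Tendsto (fun k : ℕ => |(a + k) / ((k : ℝ) + 1) ^ 2 * s|) atTop (𝓝 0) := by
    have h1 : Tendsto (fun k : ℕ => (1 : ℝ) / ((k : ℝ) + 1)) atTop (𝓝 0) :=
      tendsto_one_div_add_atTop_nhds_zero_nat
    have h2 : Tendsto (fun k : ℕ => |(((a - 1) * (1 / ((k : ℝ) + 1)) + 1) * (1 / ((k : ℝ) + 1))) * s|)
        atTop (𝓝 (|(((a - 1) * 0 + 1) * 0) * s|)) :=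
      (((((h1.const_mul (a - 1)).add_const 1).mul h1)).mul_const s).abs
    simp only [mul_zero, zero_mul, abs_zero] at h2
    refine h2.congr fun k => ?_
    have h2 : (k : ℝ) + 1 ≠ 0 := by positivity
    congr 2
    field_simp
    ring
  apply summable_of_ratio_norm_eventually_le (r := 1 / 2) (by norm_num)
  filter_upwards [hlim.eventually_lt_const (show (0 : ℝ) < 1 / 2 by norm_num)] with k hk
  rw [hypCoef_succ, pow_succ s, Real.norm_eq_abs, Real.norm_eq_abs,
    show hypCoef a k * ((a + k) / ((k : ℝ) + 1) ^ 2) * (s ^ k * s) =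
      ((a + k) / ((k : ℝ) + 1) ^ 2 * s) * (hypCoef a k * s ^ k) by ring, abs_mul]
  exact mul_le_mul_of_nonneg_right hk.le (abs_nonneg _)

lemma multichoose_real (a : ℝ) (k : ℕ) :
    Ring.multichoose a k = (ascPochhammer ℝ k).eval a / (Nat.factorial k : ℝ) := by
  have h := Ring.factorial_nsmul_multichoose_eq_ascPochhammer a k
  rw [Polynomial.ascPochhammer_smeval_eq_eval, nsmul_eq_mul] at h
  have : ((Nat.factorial k : ℝ)) ≠ 0 := by positivity
  rw [← h]; field_simp

lemma vander (a : ℝ) (k : ℕ) :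
    ∑ ij ∈ Finset.HasAntidiagonal.antidiagonal k, hypCoef a ij.1 * ((-1) ^ ij.2 / (Nat.factorial ij.2 : ℝ)) =
      (-1) ^ k * hypCoef (1 - a) k := by
  have h := Ring.add_choose_eq (r := -a) (s := (k : ℝ)) k (Commute.all _ _)
  have h1 : Ring.choose (-a + k) k = (ascPochhammer ℝ k).eval (1 - a) / (Nat.factorial k : ℝ) := by
    rw [← multichoose_real, Ring.multichoose_eq]; congr 1; ring
  have h2 : ∀ j, Ring.choose (-a) j = (-1) ^ j * ((ascPochhammer ℝ j).eval a / (Nat.factorial j : ℝ)) := by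
    intro j
    rw [Ring.choose_neg', multichoose_real]
    simp [Units.smul_def, Int.negOnePow_def]
  rw [h1] at h
  have hk : ((Nat.factorial k : ℝ)) ≠ 0 := by positivity
  have e : (-1) ^ k * hypCoef (1 - a) k = (-1) ^ k / (Nat.factorial k : ℝ) *
    ((ascPochhammer ℝ k).eval (1 - a) / (Nat.factorial k : ℝ)) := by
    unfold hypCoef; field_simp
  rw [e, h, Finset.mul_sum]
  refine Finset.sum_congr rfl fun ij hij => ?_
  rw [h2, Ring.choose_natCast]
  obtain ⟨i, j⟩ := ij
  simp only [Finset.HasAntidiagonal.mem_antidiagonal] at hij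
  subst hij
  simp only
  rw [Nat.add_choose, Nat.cast_div (Nat.factorial_mul_factorial_dvd_factorial_add i j) (by positivity)]
  have hi : ((Nat.factorial i : ℝ)) ≠ 0 := by positivity
  have hj : ((Nat.factorial j : ℝ)) ≠ 0 := by positivity
  have hs : ((-1 : ℝ) ^ i) * (-1) ^ i = 1 := by rw [← mul_pow]; norm_num
  unfold hypCoef
  push_cast
  field_simp
  rw [pow_add]
  linear_combination (-(-1) ^ j * (ascPochhammer ℝ i).eval a) * hs

lemma kummer (a s : ℝ) :
    (∑' k : ℕ, hypCoef a k * s ^ k) * Real.exp (-s) =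
      ∑' k : ℕ, hypCoef (1 - a) k * (-s) ^ k := by
  have he : Real.exp (-s) = ∑' k : ℕ, (-s) ^ k / (Nat.factorial k : ℝ) := by
    rw [Real.exp_eq_exp_ℝ, NormedSpace.exp_eq_tsum_div]
  rw [he, tsum_mul_tsum_eq_tsum_sum_antidiagonal_of_summable_norm (summable_hyp a s).norm
    (Real.summable_pow_div_factorial (-s)).norm]
  refine tsum_congr fun k => ?_
  rw [neg_pow s k, mul_left_comm, ← mul_assoc, ← vander, Finset.sum_mul]
  refine Finset.sum_congr rfl fun ij hij => ?_
  simp only [Finset.HasAntidiagonal.mem_antidiagonal] at hij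
  rw [← hij, pow_add, neg_pow s]; ring

lemma prod_central (n : ℕ) :
    ∏ i ∈ Finset.range n, (2 * (i : ℝ) + 1) / (2 * i + 2) =
      (Nat.factorial (2 * n) : ℝ) / (4 ^ n * (Nat.factorial n : ℝ) ^ 2) := by
  induction n with
  | zero => simp
  | succ n ih =>
    rw [Finset.prod_range_succ, ih, show 2 * (n + 1) = 2 * n + 1 + 1 by ring,
      Nat.factorial_succ, Nat.factorial_succ, Nat.factorial_succ]
    have : ((Nat.factorial n : ℝ)) ≠ 0 := by positivity
    have h2 : (n : ℝ) + 1 ≠ 0 := by positivity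
    push_cast
    field_simp
    ring

lemma hasSum_cosh_sin (s : ℝ) :
    HasSum (fun k : ℕ => (s ^ 2) ^ k / ((Nat.factorial k : ℝ)) ^ 2 * π)
      (∫ θ in (0 : ℝ)..π, Real.cosh (2 * s * Real.sin θ)) := by
  have key := intervalIntegral.hasSum_integral_of_dominated_convergence (μ := volume)
    (a := 0) (b := π)
    (F := fun (n : ℕ) θ => (2 * s * Real.sin θ) ^ (2 * n) / (Nat.factorial (2 * n) : ℝ))
    (f := fun θ => Real.cosh (2 * s * Real.sin θ))
    (fun n _ => (2 * s) ^ (2 * n) / (Nat.factorial (2 * n) : ℝ))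
    (fun n => (by fun_prop : Continuous _).aestronglyMeasurable)
    (by
      intro n
      refine ae_of_all _ fun t _ => ?_
      rw [Real.norm_eq_abs, abs_div, pow_mul, pow_mul, abs_of_nonneg (a := ((2 * s * Real.sin t) ^ 2) ^ n) (by positivity), Nat.abs_cast]
      gcongr ?_ / _
      rw [mul_pow]
      gcongr
      have := Real.sin_sq_le_one t
      nlinarith [sq_nonneg (2 * s)])
    (ae_of_all _ fun t _ => (Real.hasSum_cosh (2 * s)).summable)
    (by simp)
    (ae_of_all _ fun t _ => Real.hasSum_cosh _)
  suffices hfun : (fun k : ℕ => (s ^ 2) ^ k / ((Nat.factorial k : ℝ)) ^ 2 * π) = fun n : ℕ =>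
      ∫ θ in (0 : ℝ)..π, (2 * s * Real.sin θ) ^ (2 * n) / (Nat.factorial (2 * n) : ℝ) by
    rw [hfun]; exact key
  funext k
  have e : ∀ θ, (2 * s * Real.sin θ) ^ (2 * k) / (Nat.factorial (2 * k) : ℝ) =
    (2 * s) ^ (2 * k) / (Nat.factorial (2 * k) : ℝ) * Real.sin θ ^ (2 * k) := by
    intro θ; rw [mul_pow]; ring
  simp_rw [e]
  rw [intervalIntegral.integral_const_mul, integral_sin_pow_even, prod_central]
  have : ((Nat.factorial k : ℝ)) ≠ 0 := by positivity
  have : ((Nat.factorial (2 * k) : ℝ)) ≠ 0 := by positivity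
  rw [mul_pow, pow_mul 2, ← pow_mul s]
  norm_num
  field_simp

lemma angular (s φ : ℝ) :
    ∫ θ in (-π)..π, Real.exp (2 * s * Real.cos (θ - φ)) =
      2 * π * ∑' k : ℕ, (s ^ 2) ^ k / ((Nat.factorial k : ℝ)) ^ 2 := by
  have hper : Function.Periodic (fun θ => Real.exp (2 * s * Real.sin θ)) (2 * π) := by
    intro θ; simp
  have h1 : ∫ θ in (-π)..π, Real.exp (2 * s * Real.cos (θ - φ)) =
      ∫ θ in (-π)..π, Real.exp (2 * s * Real.sin θ) := by
    have : ∀ θ, Real.exp (2 * s * Real.cos (θ - φ)) =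
      (fun θ => Real.exp (2 * s * Real.sin θ)) (θ + (π / 2 - φ)) := by
      intro θ
      simp only
      rw [← Real.sin_add_pi_div_two]; congr 3; ring
    simp_rw [this]
    rw [intervalIntegral.integral_comp_add_right (fun θ => Real.exp (2 * s * Real.sin θ))]
    have := hper.intervalIntegral_add_eq (-π + (π / 2 - φ)) (-π)
    rw [show -π + 2 * π = π by ring] at this
    rw [← this]; congr 1; ring
  have hc : Continuous (fun θ => Real.exp (2 * s * Real.sin θ)) := by fun_prop
  have h2 : ∫ θ in (-π)..0, Real.exp (2 * s * Real.sin θ) =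
      ∫ θ in (0 : ℝ)..π, Real.exp (-(2 * s * Real.sin θ)) := by
    have := intervalIntegral.integral_comp_neg (a := 0) (b := π) (fun θ => Real.exp (2 * s * Real.sin θ))
    simp only [neg_zero, Real.sin_neg, mul_neg] at this
    exact this.symm
  rw [h1, ← intervalIntegral.integral_add_adjacent_intervals (b := 0) (hc.intervalIntegrable _ _) (hc.intervalIntegrable _ _), h2,
    ← intervalIntegral.integral_add ((by fun_prop : Continuous _).intervalIntegrable _ _) (hc.intervalIntegrable _ _)]
  have h3 : ∀ θ, Real.exp (-(2 * s * Real.sin θ)) + Real.exp (2 * s * Real.sin θ) =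
    2 * Real.cosh (2 * s * Real.sin θ) := by
    intro θ; rw [Real.cosh_eq]; ring
  simp_rw [h3]
  rw [intervalIntegral.integral_const_mul, ← (hasSum_cosh_sin s).tsum_eq, tsum_mul_right]
  ring

lemma gauss_moment (q : ℝ) (hq : -1 < q) :
    IntegrableOn (fun ρ : ℝ => ρ ^ q * Real.exp (-ρ ^ 2)) (Set.Ioi 0) ∧
    ∫ ρ in Set.Ioi (0 : ℝ), ρ ^ q * Real.exp (-ρ ^ 2) = 1 / 2 * Real.Gamma ((q + 1) / 2) := by
  have h1 := integrableOn_rpow_mul_exp_neg_rpow (p := 2) hq (by norm_num)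
  have h2 := integral_rpow_mul_exp_neg_rpow (p := 2) (by norm_num) hq
  simp only [Real.rpow_two] at h1 h2
  exact ⟨h1, h2⟩

lemma radial_zero (α : ℝ) (h0 : 0 < α) (h2 : α < 2) :
    IntegrableOn (fun ρ : ℝ => ρ ^ (-1 - α) * (1 - Real.exp (-ρ ^ 2))) (Set.Ioi 0) ∧
    ∫ ρ in Set.Ioi (0 : ℝ), ρ ^ (-1 - α) * (1 - Real.exp (-ρ ^ 2)) =
      Real.Gamma (1 - α / 2) / α := by
  have hb : ∀ ρ : ℝ, 0 ≤ 1 - Real.exp (-ρ ^ 2) ∧ 1 - Real.exp (-ρ ^ 2) ≤ 1 ∧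
      1 - Real.exp (-ρ ^ 2) ≤ ρ ^ 2 := by
    intro ρ
    have := Real.add_one_le_exp (-ρ ^ 2)
    have h3 : Real.exp (-ρ ^ 2) ≤ 1 := Real.exp_le_one_iff.2 (by nlinarith [sq_nonneg ρ])
    have := Real.exp_pos (-ρ ^ 2)
    refine ⟨by linarith, by linarith, by linarith⟩
  have hmeas : Measurable (fun ρ : ℝ => ρ ^ (-1 - α) * (1 - Real.exp (-ρ ^ 2))) := by fun_prop
  have hint : IntegrableOn (fun ρ : ℝ => ρ ^ (-1 - α) * (1 - Real.exp (-ρ ^ 2))) (Set.Ioi 0) := by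
    rw [← Set.Ioc_union_Ioi_eq_Ioi (show (0 : ℝ) ≤ 1 by norm_num)]
    refine IntegrableOn.union ?_ ?_
    · have : IntegrableOn (fun ρ : ℝ => ρ ^ (1 - α)) (Set.Ioc 0 1) := by
        have := intervalIntegral.intervalIntegrable_rpow' (a := 0) (b := 1) (r := 1 - α) (by linarith)
        rwa [intervalIntegrable_iff_integrableOn_Ioc_of_le (by norm_num)] at this
      refine Integrable.mono' this hmeas.aestronglyMeasurable ?_
      refine (ae_restrict_mem measurableSet_Ioc).mono fun ρ hρ => ?_
      have hp : 0 < ρ := hρ.1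
      have hp' : 0 ≤ ρ ^ (-1 - α) := Real.rpow_nonneg hp.le _
      rw [Real.norm_eq_abs, abs_of_nonneg (mul_nonneg hp' (hb ρ).1)]
      calc _ ≤ ρ ^ (-1 - α) * ρ ^ 2 := mul_le_mul_of_nonneg_left (hb ρ).2.2 hp'
        _ = _ := by
          rw [← Real.rpow_natCast, ← Real.rpow_add hp]; congr 1; push_cast; ring
    · have : IntegrableOn (fun ρ : ℝ => ρ ^ (-1 - α)) (Set.Ioi 1) :=
        integrableOn_Ioi_rpow_of_lt (by linarith) (by norm_num)
      refine Integrable.mono' this hmeas.aestronglyMeasurable ?_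
      refine (ae_restrict_mem measurableSet_Ioi).mono fun ρ hρ => ?_
      have hp : 0 < ρ := lt_trans one_pos hρ
      have hp' : 0 ≤ ρ ^ (-1 - α) := Real.rpow_nonneg hp.le _
      rw [Real.norm_eq_abs, abs_of_nonneg (mul_nonneg hp' (hb ρ).1)]
      exact mul_le_of_le_one_right hp' (hb ρ).2.1
  refine ⟨hint, ?_⟩
  obtain ⟨gi, gv⟩ := gauss_moment (1 - α) (by linarith)
  have hpow : ∀ ρ : ℝ, 0 < ρ → 2 * ρ * ρ ^ (-α) = 2 * ρ ^ (1 - α) := by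
    intro ρ hp
    rw [show 1 - α = 1 + -α by ring, Real.rpow_add hp, Real.rpow_one]; ring
  have heq : Set.EqOn (fun ρ : ℝ => (-2 / α) * (ρ ^ (1 - α) * Real.exp (-ρ ^ 2)))
      (fun ρ : ℝ => (2 * ρ * Real.exp (-ρ ^ 2)) * (-ρ ^ (-α) / α)) (Set.Ioi 0) := by
    intro ρ hp
    have := hpow ρ hp
    simp only
    linear_combination (Real.exp (-ρ ^ 2) / α) * this
  have parts := integral_Ioi_mul_deriv_eq_deriv_mul (a := (0 : ℝ)) (a' := (0 : ℝ)) (b' := (0 : ℝ))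
    (u := fun ρ : ℝ => 1 - Real.exp (-ρ ^ 2)) (u' := fun ρ => 2 * ρ * Real.exp (-ρ ^ 2))
    (v := fun ρ : ℝ => -ρ ^ (-α) / α) (v' := fun ρ => ρ ^ (-1 - α))
    (by
      intro ρ _
      have := (((hasDerivAt_pow 2 ρ).neg).exp).const_sub 1
      refine HasDerivAt.congr_deriv this ?_
      simp; ring)
    (by
      intro ρ hp
      have := ((Real.hasDerivAt_rpow_const (p := -α) (Or.inl (ne_of_gt hp))).neg).div_const α
      refine HasDerivAt.congr_deriv this ?_
      rw [show -α - 1 = -1 - α by ring]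
      field_simp)
    (by
      refine hint.congr_fun ?_ measurableSet_Ioi
      intro ρ _; simp only [Pi.mul_apply]; ring)
    (IntegrableOn.congr_fun (gi.const_mul (-2 / α)) heq measurableSet_Ioi)
    (by
      have hz : Tendsto (fun ρ : ℝ => ρ ^ (2 - α) / α) (𝓝[>] 0) (𝓝 0) := by
        have := (Real.continuous_rpow_const (q := 2 - α) (by linarith)).tendsto 0
        rw [Real.zero_rpow (by linarith)] at this
        simpa using (this.mono_left nhdsWithin_le_nhds).div_const α
      refine squeeze_zero_norm' ?_ hz
      filter_upwards [self_mem_nhdsWithin] with ρ hp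
      have hp : 0 < ρ := hp
      have hp' : 0 ≤ ρ ^ (-α) := Real.rpow_nonneg hp.le _
      simp only [Pi.mul_apply, norm_mul, Real.norm_eq_abs]
      rw [abs_of_nonneg (hb ρ).1, neg_div, abs_neg, abs_of_nonneg (by positivity)]
      calc _ ≤ ρ ^ 2 * (ρ ^ (-α) / α) := mul_le_mul_of_nonneg_right (hb ρ).2.2 (by positivity)
        _ = _ := by
          rw [show 2 - α = 2 + -α by ring, Real.rpow_add hp, Real.rpow_two]; ring)
    (by
      have hz : Tendsto (fun ρ : ℝ => ρ ^ (-α) / α) atTop (𝓝 0) := by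
        simpa using (tendsto_rpow_neg_atTop h0).div_const α
      refine squeeze_zero_norm' ?_ hz
      filter_upwards [eventually_gt_atTop 0] with ρ hp
      have hp' : 0 ≤ ρ ^ (-α) := Real.rpow_nonneg hp.le _
      simp only [Pi.mul_apply, norm_mul, Real.norm_eq_abs]
      rw [abs_of_nonneg (hb ρ).1, neg_div, abs_neg, abs_of_nonneg (by positivity)]
      exact mul_le_of_le_one_left (by positivity) (hb ρ).2.1)
  have hc : ∫ ρ in Set.Ioi (0 : ℝ), ρ ^ (-1 - α) * (1 - Real.exp (-ρ ^ 2)) =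
    ∫ ρ in Set.Ioi (0 : ℝ), (1 - Real.exp (-ρ ^ 2)) * ρ ^ (-1 - α) := by
    congr 1; funext ρ; ring
  rw [hc, parts, ← setIntegral_congr_fun measurableSet_Ioi heq, integral_const_mul, gv,
    show (1 - α + 1) / 2 = 1 - α / 2 by ring]
  field_simp
  ring

lemma gamma_poch (α : ℝ) (h0 : 0 < α) (h2 : α < 2) (k : ℕ) :
    1 / 2 * Real.Gamma ((k : ℝ) + 1 - α / 2) =
      -(Real.Gamma (1 - α / 2) / α) * (ascPochhammer ℝ (k + 1)).eval (-α / 2) := by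
  induction k with
  | zero =>
    simp; field_simp
  | succ k ih =>
    rw [ascPochhammer_succ_eval, ← mul_assoc, ← ih,
      show ((k + 1 : ℕ) : ℝ) + 1 - α / 2 = ((k : ℝ) + 1 - α / 2) + 1 by push_cast; ring,
      Real.Gamma_add_one]
    · push_cast; ring
    · have : (0 : ℝ) ≤ k := Nat.cast_nonneg k
      linarith

/-- The general radial term. -/
noncomputable def radTerm (α r : ℝ) (k : ℕ) (ρ : ℝ) : ℝ :=
  ρ ^ (-1 - α) * (Real.exp (-ρ ^ 2) * (((r * ρ) ^ 2) ^ (k + 1) / ((Nat.factorial (k + 1) : ℝ)) ^ 2))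

lemma radTerm_integral (α r : ℝ) (h0 : 0 < α) (h2 : α < 2) (k : ℕ) :
    IntegrableOn (radTerm α r k) (Set.Ioi 0) ∧
    ∫ ρ in Set.Ioi (0 : ℝ), radTerm α r k ρ =
      -(Real.Gamma (1 - α / 2) / α) * (hypCoef (-α / 2) (k + 1) * (r ^ 2) ^ (k + 1)) := by
  have hk : (0 : ℝ) ≤ k := Nat.cast_nonneg k
  obtain ⟨gi, gv⟩ := gauss_moment (2 * k + 1 - α) (by linarith)
  have heq : Set.EqOn (fun ρ : ℝ => ((r ^ 2) ^ (k + 1) / ((Nat.factorial (k + 1) : ℝ)) ^ 2) *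
      (ρ ^ (2 * k + 1 - α) * Real.exp (-ρ ^ 2))) (radTerm α r k) (Set.Ioi 0) := by
    intro ρ hp
    have hp : 0 < ρ := hp
    have : ρ ^ (2 * k + 1 - α) = ρ ^ (-1 - α) * (ρ ^ 2) ^ (k + 1) := by
      rw [← pow_mul, ← Real.rpow_natCast, ← Real.rpow_add hp]; congr 1; push_cast; ring
    simp only [radTerm]
    rw [this, mul_pow r ρ, mul_pow (r ^ 2)]; ring
  refine ⟨IntegrableOn.congr_fun (gi.const_mul _) heq measurableSet_Ioi, ?_⟩
  rw [← setIntegral_congr_fun measurableSet_Ioi heq, integral_const_mul, gv,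
    show (2 * (k : ℝ) + 1 - α + 1) / 2 = k + 1 - α / 2 by ring, gamma_poch α h0 h2, hypCoef]
  ring

lemma summable_bessel (t : ℝ) : Summable (fun k : ℕ => t ^ k / ((Nat.factorial k : ℝ)) ^ 2) := by
  refine Summable.of_norm_bounded (Real.summable_pow_div_factorial |t|) fun k => ?_
  rw [Real.norm_eq_abs, abs_div, abs_pow, abs_of_nonneg (a := (Nat.factorial k : ℝ) ^ 2) (by positivity)]
  have : (1 : ℝ) ≤ Nat.factorial k := by exact_mod_cast Nat.succ_le_of_lt (Nat.factorial_pos k)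
  gcongr
  nlinarith

lemma radial (α r : ℝ) (h0 : 0 < α) (h2 : α < 2) :
    IntegrableOn (fun ρ : ℝ => ρ ^ (-1 - α) * (1 - Real.exp (-ρ ^ 2) *
      ∑' k : ℕ, ((r * ρ) ^ 2) ^ k / ((Nat.factorial k : ℝ)) ^ 2)) (Set.Ioi 0) ∧
    ∫ ρ in Set.Ioi (0 : ℝ), ρ ^ (-1 - α) * (1 - Real.exp (-ρ ^ 2) *
      ∑' k : ℕ, ((r * ρ) ^ 2) ^ k / ((Nat.factorial k : ℝ)) ^ 2) =
      Real.Gamma (1 - α / 2) / α * ∑' k : ℕ, hypCoef (-α / 2) k * (r ^ 2) ^ k := by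
  have hG : 0 < Real.Gamma (1 - α / 2) / α := div_pos (Real.Gamma_pos_of_pos (by linarith)) h0
  obtain ⟨i0, v0⟩ := radial_zero α h0 h2
  have hsum := summable_hyp (-α / 2) (r ^ 2)
  have hsum1 := (summable_nat_add_iff 1).2 hsum
  have hnn : ∀ k ρ, 0 < ρ → 0 ≤ radTerm α r k ρ := by
    intro k ρ hp
    unfold radTerm
    have := Real.rpow_nonneg hp.le (-1 - α)
    positivity
  have hnorm : ∀ k, ∫ ρ in Set.Ioi (0 : ℝ), ‖radTerm α r k ρ‖ =
      -(Real.Gamma (1 - α / 2) / α) * (hypCoef (-α / 2) (k + 1) * (r ^ 2) ^ (k + 1)) := by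
    intro k
    rw [← (radTerm_integral α r h0 h2 k).2]
    refine setIntegral_congr_fun measurableSet_Ioi fun ρ hp => ?_
    simp only [Real.norm_eq_abs]
    exact abs_of_nonneg (hnn k ρ hp)
  have hs := hasSum_integral_of_summable_integral_norm (μ := volume.restrict (Set.Ioi (0 : ℝ)))
    (F := radTerm α r) (fun k => (radTerm_integral α r h0 h2 k).1)
    (by simp_rw [hnorm]; exact hsum1.mul_left _)
  have hval : ∫ ρ in Set.Ioi (0 : ℝ), ∑' k, radTerm α r k ρ =
      -(Real.Gamma (1 - α / 2) / α) * ∑' k, (hypCoef (-α / 2) (k + 1) * (r ^ 2) ^ (k + 1)) := by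
    rw [← hs.tsum_eq, ← tsum_mul_left]
    exact tsum_congr fun k => (radTerm_integral α r h0 h2 k).2
  have hint : IntegrableOn (fun ρ => ∑' k, radTerm α r k ρ) (Set.Ioi 0) := by
    by_cases hr : r = 0
    · have : (fun ρ => ∑' k, radTerm α r k ρ) = fun _ => 0 := by
        funext ρ; simp [radTerm, hr]
      rw [this]; exact integrableOn_zero
    · by_contra hcon
      have hz := integral_undef hcon
      rw [← hs.tsum_eq] at hz
      have hpos : ∀ k, 0 < ∫ ρ in Set.Ioi (0 : ℝ), radTerm α r k ρ := by
        intro k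
        rw [(radTerm_integral α r h0 h2 k).2]
        have := gamma_poch α h0 h2 k
        have hg : 0 < Real.Gamma ((k : ℝ) + 1 - α / 2) :=
          Real.Gamma_pos_of_pos (by have : (0 : ℝ) ≤ k := Nat.cast_nonneg k
                                    linarith)
        unfold hypCoef
        rw [div_mul_eq_mul_div, ← mul_div_assoc, ← mul_assoc, ← this]
        have : 0 < r ^ 2 := by positivity
        positivity
      exact absurd hz (hs.summable.tsum_pos (fun k => (hpos k).le) 0 (hpos 0)).ne'
  have heq : ∀ ρ : ℝ, ρ ^ (-1 - α) * (1 - Real.exp (-ρ ^ 2) *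
      ∑' k : ℕ, ((r * ρ) ^ 2) ^ k / ((Nat.factorial k : ℝ)) ^ 2) =
      ρ ^ (-1 - α) * (1 - Real.exp (-ρ ^ 2)) - ∑' k, radTerm α r k ρ := by
    intro ρ
    rw [(summable_bessel ((r * ρ) ^ 2)).tsum_eq_zero_add]
    simp only [radTerm]
    rw [tsum_mul_left, tsum_mul_left]
    simp
    ring
  simp_rw [heq]
  refine ⟨i0.sub hint, ?_⟩
  rw [integral_sub i0 hint, v0, hval, hsum.tsum_eq_zero_add]
  simp [hypCoef]
  ring

lemma polar_red (α : ℝ) (h0 : 0 < α) (x : EuclideanSpace ℝ (Fin 2)) (ε : ℝ) (hε : 0 < ε) :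
    ∫ y in {y : EuclideanSpace ℝ (Fin 2) | ε < ‖x - y‖},
      (Real.exp (-‖x‖ ^ 2) - Real.exp (-‖y‖ ^ 2)) / ‖x - y‖ ^ (2 + α) =
    ∫ ρ in Set.Ioi ε, 2 * π * Real.exp (-‖x‖ ^ 2) * (ρ ^ (-1 - α) * (1 - Real.exp (-ρ ^ 2) *
      ∑' k : ℕ, ((‖x‖ * ρ) ^ 2) ^ k / ((Nat.factorial k : ℝ)) ^ 2)) := by
  set H : EuclideanSpace ℝ (Fin 2) → ℝ := Set.indicator {z | ε < ‖z‖}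
    (fun z => (Real.exp (-‖x‖ ^ 2) - Real.exp (-‖x - z‖ ^ 2)) / ‖z‖ ^ (2 + α)) with hH
  have hm : MeasurableSet {y : EuclideanSpace ℝ (Fin 2) | ε < ‖x - y‖} :=
    measurableSet_lt measurable_const (by fun_prop)
  rw [← integral_indicator hm]
  have e1 : (Set.indicator {y : EuclideanSpace ℝ (Fin 2) | ε < ‖x - y‖} fun y =>
      (Real.exp (-‖x‖ ^ 2) - Real.exp (-‖y‖ ^ 2)) / ‖x - y‖ ^ (2 + α)) = fun y => H (x - y) := by
    funext y
    simp only [hH, Set.indicator, Set.mem_setOf_eq, sub_sub_cancel]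
  rw [e1, integral_sub_left_eq_self H volume x]
  let L : ℂ ≃ₗᵢ[ℝ] EuclideanSpace ℝ (Fin 2) := Complex.orthonormalBasisOneI.repr
  rw [← L.measurePreserving.integral_comp' (f := L.toMeasurableEquiv) H,
    ← Complex.integral_comp_polarCoord_symm]
  set w : ℂ := L.symm x with hw
  set r : ℝ := ‖x‖ with hr
  have hwr : ‖w‖ = r := by rw [hw, L.symm.norm_map]
  set φ := Complex.arg w with hφ
  set K : ℝ × ℝ → ℝ := fun p => p.1 ^ (-1 - α) *
    (Real.exp (-r ^ 2) - Real.exp (-(r ^ 2 + p.1 ^ 2 - 2 * (r * p.1) * Real.cos (p.2 - φ)))) with hK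
  have hnsq : ∀ p : ℝ × ℝ, ‖x - L (Complex.polarCoord.symm p)‖ ^ 2 =
      r ^ 2 + p.1 ^ 2 - 2 * (r * p.1) * Real.cos (p.2 - φ) := by
    intro p
    have hx : x = L w := by simp [hw]
    rw [hx, ← map_sub, L.norm_map, Complex.sq_norm, Complex.normSq_apply]
    have h1 := Complex.norm_mul_cos_arg w
    have h2 := Complex.norm_mul_sin_arg w
    rw [hwr] at h1 h2
    rw [Complex.polarCoord_symm_apply]
    simp only [Complex.sub_re, Complex.sub_im, ← h1, ← h2, Complex.mul_re, Complex.mul_im,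
      Complex.ofReal_re, Complex.ofReal_im, Complex.add_re, Complex.add_im, Complex.I_re,
      Complex.I_im, Real.cos_sub]
    rw [← hφ]
    have s1 := Real.sin_sq_add_cos_sq φ
    have s2 := Real.sin_sq_add_cos_sq p.2
    linear_combination r ^ 2 * s1 + p.1 ^ 2 * s2
  have hT : MeasurableSet (Set.Ioi (0 : ℝ) ×ˢ Set.Ioo (-π) π) := measurableSet_Ioi.prod measurableSet_Ioo
  have hE : MeasurableSet (Set.Ioi ε ×ˢ (Set.univ : Set ℝ)) := measurableSet_Ioi.prod MeasurableSet.univ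
  have e2 : ∫ p in polarCoord.target, p.1 • H (L.toMeasurableEquiv (Complex.polarCoord.symm p)) =
      ∫ p in Set.Ioi (0 : ℝ) ×ˢ Set.Ioo (-π) π, Set.indicator (Set.Ioi ε ×ˢ (Set.univ : Set ℝ)) K p := by
    refine setIntegral_congr_fun hT ?_
    rintro p ⟨hp, -⟩
    have hp : 0 < p.1 := hp
    have hn : ‖L (Complex.polarCoord.symm p)‖ = p.1 := by
      rw [L.norm_map, Complex.norm_polarCoord_symm, abs_of_pos hp]
    change p.1 • H (L (Complex.polarCoord.symm p)) = _
    by_cases hpe : ε < p.1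
    · rw [Set.indicator_of_mem (by exact ⟨hpe, trivial⟩), hH,
        Set.indicator_of_mem (by rw [Set.mem_setOf_eq, hn]; exact hpe), hn, hnsq, hK]
      simp only [smul_eq_mul]
      rw [show -1 - α = 1 - (2 + α) by ring, Real.rpow_sub hp, Real.rpow_one]
      ring
    · rw [Set.indicator_of_notMem (by rintro ⟨h, -⟩; exact hpe h), hH,
        Set.indicator_of_notMem (by rw [Set.mem_setOf_eq, hn]; exact hpe), smul_zero]
  have hinter : (Set.Ioi (0 : ℝ) ×ˢ Set.Ioo (-π) π) ∩ (Set.Ioi ε ×ˢ (Set.univ : Set ℝ)) =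
      Set.Ioi ε ×ˢ Set.Ioo (-π) π := by
    ext ⟨a, b⟩
    simp only [Set.mem_inter_iff, Set.mem_prod, Set.mem_Ioi, Set.mem_univ, and_true]
    constructor
    · rintro ⟨⟨_, h⟩, h'⟩; exact ⟨h', h⟩
    · rintro ⟨h, h'⟩; exact ⟨⟨hε.trans h, h'⟩, h⟩
  have hint : IntegrableOn K (Set.Ioi ε ×ˢ Set.Ioo (-π) π) (volume.prod volume) := by
    have i1 : IntegrableOn (fun ρ : ℝ => ρ ^ (-1 - α)) (Set.Ioi ε) :=
      integrableOn_Ioi_rpow_of_lt (by linarith) hε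
    have i2 : IntegrableOn (fun _ : ℝ => (1 : ℝ)) (Set.Ioo (-π) π) := by simp
    have i3 := Integrable.mul_prod i1 i2
    rw [Measure.prod_restrict] at i3
    have hKm : Measurable K := by rw [hK]; fun_prop
    refine Integrable.mono' i3 hKm.aestronglyMeasurable ?_
    refine (ae_restrict_mem (measurableSet_Ioi.prod measurableSet_Ioo)).mono ?_
    rintro p ⟨hp, -⟩
    have hp : 0 < p.1 := hε.trans hp
    have hp' : 0 ≤ p.1 ^ (-1 - α) := Real.rpow_nonneg hp.le _
    simp only [hK]
    rw [norm_mul, Real.norm_eq_abs, abs_of_nonneg hp']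
    refine mul_le_mul_of_nonneg_left ?_ hp'
    rw [← hnsq, Real.norm_eq_abs, abs_le]
    have a1 := Real.exp_pos (-r ^ 2)
    have a2 : Real.exp (-r ^ 2) ≤ 1 := Real.exp_le_one_iff.2 (by nlinarith [sq_nonneg r])
    have a3 := Real.exp_pos (-‖x - L (Complex.polarCoord.symm p)‖ ^ 2)
    have a4 : Real.exp (-‖x - L (Complex.polarCoord.symm p)‖ ^ 2) ≤ 1 :=
      Real.exp_le_one_iff.2 (by nlinarith [sq_nonneg ‖x - L (Complex.polarCoord.symm p)‖])
    constructor <;> linarith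
  rw [e2, setIntegral_indicator hE, hinter, Measure.volume_eq_prod, setIntegral_prod K hint]
  refine setIntegral_congr_fun measurableSet_Ioi fun ρ hρ => ?_
  simp only [hK]
  have hK2 : ∀ θ, ρ ^ (-1 - α) *
      (Real.exp (-r ^ 2) - Real.exp (-(r ^ 2 + ρ ^ 2 - 2 * (r * ρ) * Real.cos (θ - φ)))) =
      ρ ^ (-1 - α) * Real.exp (-r ^ 2) -
      ρ ^ (-1 - α) * Real.exp (-r ^ 2) * Real.exp (-ρ ^ 2) * Real.exp (2 * (r * ρ) * Real.cos (θ - φ)) := by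
    intro θ
    rw [show -(r ^ 2 + ρ ^ 2 - 2 * (r * ρ) * Real.cos (θ - φ)) =
      -r ^ 2 + -ρ ^ 2 + 2 * (r * ρ) * Real.cos (θ - φ) by ring, Real.exp_add, Real.exp_add]
    ring
  simp_rw [hK2]
  rw [← integral_Ioc_eq_integral_Ioo, ← intervalIntegral.integral_of_le (by linarith [Real.pi_pos]),
    intervalIntegral.integral_sub (by simp) ((by fun_prop : Continuous _).intervalIntegrable _ _),
    intervalIntegral.integral_const, intervalIntegral.integral_const_mul, angular, smul_eq_mul]
  ring


/-- For `α ∈ (0,2)` and `u(x) = e^{-|x|²}` on `ℝ²`, for every `x` the principal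
value limit defining the fractional Laplacian of `u` at `x` exists and equals
`2^α Γ(1+α/2) ₁F₁(1+α/2; 1; -|x|²)`, the confluent hypergeometric series converging
absolutely for all `x`. -/
theorem fracLap_gaussian_2d (α : ℝ) (hα : α ∈ Set.Ioo (0 : ℝ) 2)
    (u : EuclideanSpace ℝ (Fin 2) → ℝ) (hu : ∀ x, u x = Real.exp (-‖x‖ ^ 2))
    (x : EuclideanSpace ℝ (Fin 2)) :
    Summable (fun k : ℕ =>
      |(ascPochhammer ℝ k).eval (1 + α / 2) / ((Nat.factorial k : ℝ)) ^ 2 *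
        (-‖x‖ ^ 2) ^ k|) ∧
    Tendsto
      (fun ε : ℝ => fracLapConst 2 α *
        ∫ y in {y : EuclideanSpace ℝ (Fin 2) | ε < ‖x - y‖},
          (u x - u y) / ‖x - y‖ ^ (2 + α))
      (𝓝[>] 0)
      (𝓝 (2 ^ α * Real.Gamma (1 + α / 2) *
        ∑' k : ℕ, (ascPochhammer ℝ k).eval (1 + α / 2) / ((Nat.factorial k : ℝ)) ^ 2 *
          (-‖x‖ ^ 2) ^ k)) := by
  obtain ⟨h0, h2⟩ := hα
  refine ⟨(summable_hyp (1 + α / 2) (-‖x‖ ^ 2)).abs, ?_⟩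
  simp_rw [hu]
  obtain ⟨ri, rv⟩ := radial α ‖x‖ h0 h2
  have ri' := ri.const_mul (2 * π * Real.exp (-‖x‖ ^ 2))
  have hlim := (aecover_Ioi_of_Ioi (μ := volume) (l := 𝓝[>] (0 : ℝ)) (a := fun ε : ℝ => ε) (A := 0)
    (tendsto_id.mono_left nhdsWithin_le_nhds)).integral_tendsto_of_countably_generated ri'
  have hlim2 := hlim.const_mul (fracLapConst 2 α)
  have hval : fracLapConst 2 α * ∫ ρ in Set.Ioi (0 : ℝ), 2 * π * Real.exp (-‖x‖ ^ 2) *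
      (ρ ^ (-1 - α) * (1 - Real.exp (-ρ ^ 2) *
      ∑' k : ℕ, ((‖x‖ * ρ) ^ 2) ^ k / ((Nat.factorial k : ℝ)) ^ 2)) =
      2 ^ α * Real.Gamma (1 + α / 2) *
        ∑' k : ℕ, (ascPochhammer ℝ k).eval (1 + α / 2) / ((Nat.factorial k : ℝ)) ^ 2 *
          (-‖x‖ ^ 2) ^ k := by
    have hk := kummer (-α / 2) (‖x‖ ^ 2)
    rw [show 1 - -α / 2 = 1 + α / 2 by ring] at hk
    simp only [hypCoef] at hk rv
    rw [integral_const_mul, rv, ← hk, fracLapConst]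
    have hG : Real.Gamma (1 - α / 2) ≠ 0 := (Real.Gamma_pos_of_pos (by linarith)).ne'
    rw [show (α + (2 : ℕ)) / 2 = 1 + α / 2 by push_cast; ring, Real.rpow_sub (by norm_num)]
    have hpi := Real.pi_ne_zero
    norm_num
    field_simp
  rw [hval] at hlim2
  refine hlim2.congr' ?_
  filter_upwards [self_mem_nhdsWithin] with ε hε
  have hε : 0 < ε := hε
  rw [polar_red α h0 x ε hε, Measure.restrict_restrict measurableSet_Ioi,
    Set.inter_eq_left.2 (Set.Ioi_subset_Ioi hε.le)]
end

section
/- Let α ∈ (0, 2) and let u : ℝ → ℝ be given by u(y) = √(2/π) · sin(y)/y for y ≠ 0 and u(0) = √(2/π). Then for every x ∈ ℝ the principal value limit defining the fractional Laplacian of u at x exists, and C_{1,α} · lim_{ε→0⁺} ∫_{{y : |x−y| > ε}} (u(x) − u(y)) / |x − y|^{1+α} dy = (√2 / ((1+α)√π)) · Σ_{k=0}^{∞} [ ((α+1)/2)_k / ( ((3+α)/2)_k · (1/2)_k · k! ) ] · (−x²/4)^k, where the series (the hypergeometric series ₁F₂((α+1)/2; (3+α)/2, 1/2; −x²/4)) converges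 absolutely for all x. -/
open MeasureTheory Real Topology Filter Polynomial

lemma tonelli_aux (f : ℝ → ℝ → ℝ) (g h : ℝ → ℝ) (hm : Measurable (Function.uncurry f))
    (hf : ∀ z > 0, ∀ s > 0, 0 ≤ f z s)
    (hg : ∀ z > 0, IntegrableOn (fun s => f z s) (Set.Ioi 0) ∧ ∫ s in Set.Ioi 0, f z s = g z)
    (hh : ∀ s > 0, IntegrableOn (fun z => f z s) (Set.Ioi 0) ∧ ∫ z in Set.Ioi 0, f z s = h s) :
    ∫⁻ z in Set.Ioi (0:ℝ), ENNReal.ofReal (g z) = ∫⁻ s in Set.Ioi (0:ℝ), ENNReal.ofReal (h s) := by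
  have e1 : ∫⁻ z in Set.Ioi (0:ℝ), ENNReal.ofReal (g z)
      = ∫⁻ z in Set.Ioi (0:ℝ), ∫⁻ s in Set.Ioi (0:ℝ), ENNReal.ofReal (f z s) := by
    refine setLIntegral_congr_fun measurableSet_Ioi (fun z hz => ?_)
    rw [← (hg z hz).2, ofReal_integral_eq_lintegral_ofReal (hg z hz).1]
    exact (ae_restrict_iff' measurableSet_Ioi).2 (.of_forall fun s hs => hf z hz s hs)
  have e2 : ∫⁻ s in Set.Ioi (0:ℝ), ENNReal.ofReal (h s)
      = ∫⁻ s in Set.Ioi (0:ℝ), ∫⁻ z in Set.Ioi (0:ℝ), ENNReal.ofReal (f z s) := by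
    refine setLIntegral_congr_fun measurableSet_Ioi (fun s hs => ?_)
    rw [← (hh s hs).2, ofReal_integral_eq_lintegral_ofReal (hh s hs).1]
    exact (ae_restrict_iff' measurableSet_Ioi).2 (.of_forall fun z hz => hf z hz s hs)
  rw [e1, e2, lintegral_lintegral_swap]
  exact (hm.ennreal_ofReal).aemeasurable

lemma laplace_cos_aux (s : ℝ) (hs : 0 < s) :
    IntegrableOn (fun z => (1 - cos z) * exp (-(s * z))) (Set.Ioi 0) ∧
    ∫ z in Set.Ioi 0, (1 - cos z) * exp (-(s * z)) = 1 / s - s / (s ^ 2 + 1) := by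
  set F : ℝ → ℝ := fun z => exp (-(s * z)) * (-1 / s + (s * cos z - sin z) / (s ^ 2 + 1)) with hF
  have hd : ∀ z, HasDerivAt F ((1 - cos z) * exp (-(s * z))) z := by
    intro z
    have h1 : HasDerivAt (fun z => exp (-(s * z))) (exp (-(s * z)) * (-(s * 1))) z :=
      (((hasDerivAt_id z).const_mul s).neg).exp
    have h2 : HasDerivAt (fun z => -1 / s + (s * cos z - sin z) / (s ^ 2 + 1))
        ((s * (-sin z) - cos z) / (s ^ 2 + 1)) z :=
      ((((hasDerivAt_cos z).const_mul s).sub (hasDerivAt_sin z)).div_const _).const_add _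
    refine (h1.mul h2).congr_deriv ?_
    have : s ^ 2 + 1 ≠ 0 := by positivity
    field_simp
    ring
  have hlim : Tendsto F atTop (𝓝 0) := by
    have hexp : Tendsto (fun z => exp (-(s * z))) atTop (𝓝 0) :=
      tendsto_exp_neg_atTop_nhds_zero.comp (tendsto_id.const_mul_atTop hs)
    refine hexp.zero_mul_isBoundedUnder_le ?_
    refine isBoundedUnder_of ⟨1 / s + (s + 1) / (s ^ 2 + 1), fun z => ?_⟩
    simp only [Function.comp, norm_eq_abs]
    refine (abs_add_le _ _).trans ?_
    refine add_le_add ?_ ?_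
    · rw [abs_div, abs_neg, abs_one, abs_of_pos hs]
    · rw [abs_div, abs_of_pos (show 0 < s ^ 2 + 1 by positivity)]
      gcongr
      refine (abs_sub _ _).trans ?_
      rw [abs_mul, abs_of_pos hs]
      have := abs_cos_le_one z
      have := abs_sin_le_one z
      nlinarith
  have hn : ∀ z ∈ Set.Ioi (0:ℝ), 0 ≤ (1 - cos z) * exp (-(s * z)) := fun z _ =>
    mul_nonneg (by linarith [cos_le_one z]) (exp_pos _).le
  refine ⟨integrableOn_Ioi_deriv_of_nonneg (hd 0).continuousAt.continuousWithinAt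
    (fun z _ => hd z) hn hlim, ?_⟩
  rw [integral_Ioi_of_hasDerivAt_of_nonneg (hd 0).continuousAt.continuousWithinAt
    (fun z _ => hd z) hn hlim]
  simp [hF]
  ring

lemma integrableOn_gamma_aux {a r : ℝ} (ha : 0 < a) (hr : 0 < r) :
    IntegrableOn (fun t => t ^ (a - 1) * exp (-(r * t))) (Set.Ioi 0) := by
  have := integrableOn_rpow_mul_exp_neg_mul_rpow (p := 1) (s := a - 1) (b := r) (by linarith)
    one_pos hr
  simpa using this

lemma K_lintegral (α : ℝ) (h0 : 0 < α) (h2 : α < 2) :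
    ∫⁻ z in Set.Ioi (0:ℝ), ENNReal.ofReal ((1 - cos z) * (1 / z) ^ (α + 1) * Gamma (α + 1))
      = ENNReal.ofReal (1 / 2 * Gamma (α / 2) * Gamma (1 - α / 2)) := by
  rw [tonelli_aux (fun z s => (1 - cos z) * (s ^ (α + 1 - 1) * exp (-(z * s)))) _
    (fun s => s ^ (α - 1) * (1 / (1 + s ^ 2))),
    tonelli_aux (fun s v => s ^ (α - 1) * exp (-(1 + s ^ 2) * v)) _
    (fun v => v ^ ((1 - α / 2) - 1) * exp (-(1 * v)) * (1 / 2 * Gamma (α / 2))),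
    ← ofReal_integral_eq_lintegral_ofReal, integral_mul_const,
    Real.integral_rpow_mul_exp_neg_mul_Ioi (by linarith) one_pos]
  · congr 1
    simp
    ring
  · exact (integrableOn_gamma_aux (by linarith) one_pos).mul_const _
  · refine (ae_restrict_iff' measurableSet_Ioi).2 (.of_forall fun s hs => ?_)
    have : 0 < Gamma (α / 2) := Gamma_pos_of_pos (by linarith)
    have hs : 0 < s := hs
    simp only [Pi.zero_apply]
    positivity
  · simp only [Function.uncurry_def]; fun_prop
  · intro s hs v hv; positivity
  · intro s hs
    have hp : 0 < 1 + s ^ 2 := by positivity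
    have := integrableOn_gamma_aux one_pos hp
    have h3 := Real.integral_rpow_mul_exp_neg_mul_Ioi one_pos hp
    simp only [sub_self, rpow_zero, one_mul, rpow_one, Gamma_one, mul_one, ← neg_mul] at this h3
    exact ⟨this.const_mul _, by rw [integral_const_mul, h3]⟩
  · intro v hv
    have e : ∀ s : ℝ, s ^ (α - 1) * exp (-(1 + s ^ 2) * v)
      = exp (-v) * (s ^ (α - 1) * exp (- v * s ^ (2:ℝ))) := by
      intro s
      rw [mul_left_comm, ← exp_add, rpow_two]; ring_nf
    simp only [e]
    refine ⟨(integrableOn_rpow_mul_exp_neg_mul_rpow (by linarith) two_pos hv).const_mul _, ?_⟩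
    rw [integral_const_mul, integral_rpow_mul_exp_neg_mul_rpow two_pos (by linarith) hv]
    rw [show -(α - 1 + 1) / 2 = 1 - α / 2 - 1 by ring, show (α - 1 + 1) / 2 = α / 2 by ring, one_mul]
    ring
  · simp only [Function.uncurry_def]; fun_prop
  · intro z hz s hs
    have := cos_le_one z
    exact mul_nonneg (by linarith) (by positivity)
  · intro z hz
    refine ⟨(integrableOn_gamma_aux (by linarith) hz).const_mul _, ?_⟩
    rw [integral_const_mul, Real.integral_rpow_mul_exp_neg_mul_Ioi (by linarith) hz]
    ring
  · intro s hs
    have e : ∀ z : ℝ, (1 - cos z) * (s ^ (α + 1 - 1) * exp (-(z * s)))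
      = s ^ α * ((1 - cos z) * exp (-(s * z))) := by
      intro z
      rw [add_sub_cancel_right]; ring_nf
    simp only [e]
    refine ⟨(laplace_cos_aux s hs).1.const_mul _, ?_⟩
    rw [integral_const_mul, (laplace_cos_aux s hs).2, rpow_sub_one hs.ne']
    have : s ^ 2 + 1 ≠ 0 := by positivity
    have : 1 + s ^ 2 ≠ 0 := by positivity
    have := hs.ne'
    field_simp
    ring

lemma K_integral (α : ℝ) (h0 : 0 < α) (h2 : α < 2) :
    IntegrableOn (fun z => (1 - cos z) / z ^ (1 + α)) (Set.Ioi 0) ∧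
    fracLapConst 1 α * (2 * ∫ z in Set.Ioi 0, (1 - cos z) / z ^ (1 + α)) = 1 := by
  have hG : 0 < Gamma (α + 1) := Gamma_pos_of_pos (by linarith)
  have hn : ∀ z ∈ Set.Ioi (0:ℝ), 0 ≤ (1 - cos z) / z ^ (1 + α) := fun z hz =>
    div_nonneg (by linarith [cos_le_one z]) (rpow_nonneg (le_of_lt hz) _)
  have hae : 0 ≤ᵐ[volume.restrict (Set.Ioi (0:ℝ))] (fun z => (1 - cos z) / z ^ (1 + α)) :=
    (ae_restrict_iff' measurableSet_Ioi).2 (.of_forall hn)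
  have hm : Measurable (fun z : ℝ => (1 - cos z) / z ^ (1 + α)) := by fun_prop
  have hK : ∫⁻ z in Set.Ioi (0:ℝ), ENNReal.ofReal ((1 - cos z) / z ^ (1 + α))
      = ENNReal.ofReal (1 / 2 * Gamma (α / 2) * Gamma (1 - α / 2) / Gamma (α + 1)) := by
    have := K_lintegral α h0 h2
    rw [ENNReal.ofReal_div_of_pos hG, ← this, div_eq_mul_inv, ← lintegral_mul_const _ (by fun_prop)]
    refine setLIntegral_congr_fun measurableSet_Ioi (fun z hz => ?_)
    have hz : 0 < z := hz
    rw [← div_eq_mul_inv, ← ENNReal.ofReal_div_of_pos hG, one_div, inv_rpow hz.le, add_comm 1 α]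
    congr 1
    field_simp
  refine ⟨⟨hm.aestronglyMeasurable, ?_⟩, ?_⟩
  · rw [hasFiniteIntegral_iff_ofReal hae, hK]
    exact ENNReal.ofReal_lt_top
  · rw [integral_eq_lintegral_of_nonneg_ae hae hm.aestronglyMeasurable, hK, ENNReal.toReal_ofReal]
    · have hd := Real.Gamma_mul_Gamma_add_half ((α + 1) / 2)
      rw [show (α + 1) / 2 + 1 / 2 = α / 2 + 1 by ring, Gamma_add_one (by positivity),
        show 2 * ((α + 1) / 2) = α + 1 by ring, show 1 - (α + 1) = - α by ring, rpow_neg two_pos.le] at hd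
      unfold fracLapConst
      have g1 : 0 < Gamma (1 - α / 2) := Gamma_pos_of_pos (by linarith)
      have g2 : 0 < Gamma (α / 2) := Gamma_pos_of_pos (by linarith)
      rw [rpow_sub_one two_ne_zero, Nat.cast_one, ← sqrt_eq_rpow]
      have : 0 < √π := sqrt_pos.2 pi_pos
      have : 0 < (2:ℝ) ^ α := by positivity
      generalize Gamma (1 - α / 2) = G at g1 ⊢
      field_simp
      field_simp at hd
      linarith
    · have g1 : 0 < Gamma (1 - α / 2) := Gamma_pos_of_pos (by linarith)
      have g2 : 0 < Gamma (α / 2) := Gamma_pos_of_pos (by linarith)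
      positivity

lemma fubini_aux (α x : ℝ) (h0 : 0 < α) (h2 : α < 2) :
    IntegrableOn (fun z => ∫ t in Set.Ioc (0:ℝ) 1, cos (t * x) * ((1 - cos (t * z)) / z ^ (1 + α)))
      (Set.Ioi 0) ∧
    ∫ z in Set.Ioi (0:ℝ), ∫ t in Set.Ioc (0:ℝ) 1, cos (t * x) * ((1 - cos (t * z)) / z ^ (1 + α))
      = (∫ z in Set.Ioi 0, (1 - cos z) / z ^ (1 + α)) * ∫ t in Set.Ioc (0:ℝ) 1, t ^ α * cos (t * x) := by
  obtain ⟨hK, -⟩ := K_integral α h0 h2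
  set K := ∫ z in Set.Ioi 0, (1 - cos z) / z ^ (1 + α) with hKdef
  have hsc : ∀ t ∈ Set.Ioc (0:ℝ) 1, Set.EqOn (fun z => t ^ (1 + α) * ((1 - cos (t * z)) / (t * z) ^ (1 + α)))
      (fun z => (1 - cos (t * z)) / z ^ (1 + α)) (Set.Ioi 0) := by
    intro t ht z hz
    have hz : 0 < z := hz
    have := rpow_pos_of_pos ht.1 (1 + α)
    simp only
    rw [mul_rpow ht.1.le hz.le]
    field_simp
  have hi : ∀ t ∈ Set.Ioc (0:ℝ) 1, IntegrableOn (fun z => (1 - cos (t * z)) / z ^ (1 + α)) (Set.Ioi 0) := by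
    intro t ht
    refine IntegrableOn.congr_fun ?_ (hsc t ht) measurableSet_Ioi
    refine Integrable.const_mul ?_ _
    refine (integrableOn_Ioi_comp_mul_left_iff (fun z => (1 - cos z) / z ^ (1 + α)) 0 ht.1).2 ?_
    simpa using hK
  have hv : ∀ t ∈ Set.Ioc (0:ℝ) 1, ∫ z in Set.Ioi 0, (1 - cos (t * z)) / z ^ (1 + α) = t ^ α * K := by
    intro t ht
    rw [← setIntegral_congr_fun measurableSet_Ioi (hsc t ht), integral_const_mul,
      integral_comp_mul_left_Ioi (fun z => (1 - cos z) / z ^ (1 + α)) 0 ht.1, mul_zero, ← hKdef,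
      rpow_one_add' ht.1.le (by linarith), smul_eq_mul]
    have := ht.1
    field_simp
  have hta : IntegrableOn (fun t : ℝ => t ^ α) (Set.Ioc 0 1) :=
    (intervalIntegrable_iff_integrableOn_Ioc_of_le zero_le_one).1
      (intervalIntegral.intervalIntegrable_rpow' (by linarith))
  have hint : Integrable (Function.uncurry fun t z => cos (t * x) * ((1 - cos (t * z)) / z ^ (1 + α)))
      ((volume.restrict (Set.Ioc (0:ℝ) 1)).prod (volume.restrict (Set.Ioi (0:ℝ)))) := by
    have hmeas : Measurable (Function.uncurry fun t z : ℝ => cos (t * x) * ((1 - cos (t * z)) / z ^ (1 + α))) := by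
      simp only [Function.uncurry_def]; fun_prop
    rw [integrable_prod_iff hmeas.aestronglyMeasurable]
    constructor
    · refine (ae_restrict_iff' measurableSet_Ioc).2 (.of_forall fun t ht => ?_)
      exact (hi t ht).const_mul (cos (t * x))
    · refine Integrable.mono' (g := fun t => t ^ α * K) (hta.mul_const _) ?_ ?_
      · exact hmeas.norm.stronglyMeasurable.integral_prod_right.aestronglyMeasurable
      · refine (ae_restrict_iff' measurableSet_Ioc).2 (.of_forall fun t ht => ?_)
        rw [norm_of_nonneg (integral_nonneg fun _ => norm_nonneg _), ← hv t ht]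
        refine setIntegral_mono_on ((hi t ht).const_mul (cos (t * x))).norm (hi t ht) measurableSet_Ioi ?_
        intro z hz
        have hz : 0 < z := hz
        have hn : 0 ≤ (1 - cos (t * z)) / z ^ (1 + α) :=
          div_nonneg (by linarith [cos_le_one (t * z)]) (rpow_nonneg hz.le _)
        simp only [Function.uncurry_apply_pair]
        rw [norm_mul, norm_of_nonneg hn]
        exact mul_le_of_le_one_left hn (abs_cos_le_one _)
  refine ⟨hint.integral_prod_right, ?_⟩
  rw [← integral_integral_swap hint, ← integral_const_mul]
  refine setIntegral_congr_fun measurableSet_Ioc fun t ht => ?_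
  rw [integral_const_mul, hv t ht]
  ring

lemma series_aux (α x : ℝ) (h0 : 0 < α) :
    Summable (fun k : ℕ => |(-1) ^ k * x ^ (2 * k) / ((2 * k).factorial : ℝ) * (1 / (α + 2 * k + 1))|) ∧
    ∑' k : ℕ, (-1) ^ k * x ^ (2 * k) / ((2 * k).factorial : ℝ) * (1 / (α + 2 * k + 1))
      = ∫ t in Set.Ioc (0:ℝ) 1, t ^ α * cos (t * x) := by
  have hs : Summable (fun k : ℕ => |(-1) ^ k * x ^ (2 * k) / ((2 * k).factorial : ℝ) * (1 / (α + 2 * k + 1))|) := by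
    refine Summable.of_nonneg_of_le (fun _ => abs_nonneg _) (fun k => ?_) (Real.hasSum_cosh x).summable
    have h1 : 0 ≤ x ^ (2 * k) := by rw [pow_mul]; positivity
    rw [abs_mul, abs_div, abs_mul, abs_pow, abs_neg, abs_one, one_pow, one_mul, abs_of_nonneg h1,
      abs_of_nonneg (by positivity : (0:ℝ) ≤ ((2 * k).factorial : ℝ)), abs_of_pos (by positivity)]
    refine mul_le_of_le_one_right (by positivity) ?_
    rw [div_le_one (by positivity)]
    have : (0:ℝ) ≤ k := by positivity
    linarith
  refine ⟨hs, ?_⟩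
  have e : ∀ k : ℕ, Set.EqOn (fun t : ℝ => (-1) ^ k * x ^ (2 * k) / ((2 * k).factorial : ℝ) * t ^ (α + 2 * k))
     (fun t : ℝ => t ^ α * ((-1) ^ k * (t * x) ^ (2 * k) / ((2 * k).factorial : ℝ))) (Set.Ioc 0 1) := by
    intro k t ht
    simp only
    rw [show (2 * (k:ℝ)) = ((2 * k : ℕ) : ℝ) by push_cast; ring, rpow_add_natCast ht.1.ne', mul_pow]
    ring
  have hta : ∀ k : ℕ, IntegrableOn (fun t : ℝ => t ^ (α + 2 * k)) (Set.Ioc 0 1) := fun k =>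
    (intervalIntegrable_iff_integrableOn_Ioc_of_le zero_le_one).1
      (intervalIntegral.intervalIntegrable_rpow' (by have : (0:ℝ) ≤ k := by positivity
                                                     linarith))
  have hti : ∀ k : ℕ, ∫ t in Set.Ioc (0:ℝ) 1, t ^ (α + 2 * k) = 1 / (α + 2 * k + 1) := fun k => by
    have : (0:ℝ) ≤ k := by positivity
    rw [← intervalIntegral.integral_of_le zero_le_one, integral_rpow (Or.inl (by linarith)), one_rpow,
      zero_rpow (by linarith), sub_zero]
  have := hasSum_integral_of_summable_integral_norm (μ := volume.restrict (Set.Ioc (0:ℝ) 1))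
    (F := fun (k : ℕ) (t : ℝ) => (-1) ^ k * x ^ (2 * k) / ((2 * k).factorial : ℝ) * t ^ (α + 2 * k))
    (fun k => (hta k).const_mul _) (by
      refine hs.congr fun k => ?_
      rw [abs_mul, abs_of_pos (by positivity : 0 < 1 / (α + 2 * (k:ℝ) + 1)), ← hti k, ← integral_const_mul]
      refine setIntegral_congr_fun measurableSet_Ioc fun t ht => ?_
      rw [norm_mul, norm_of_nonneg (rpow_nonneg ht.1.le _), norm_eq_abs])
  simp only [integral_const_mul, hti] at this
  rw [this.tsum_eq]
  refine setIntegral_congr_fun measurableSet_Ioc fun t ht => ?_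
  rw [tsum_congr fun k => e k ht, tsum_mul_left, ← Real.cos_eq_tsum]

lemma coeff_aux (α x : ℝ) (h0 : 0 < α) (k : ℕ) :
    (ascPochhammer ℝ k).eval ((α + 1) / 2) /
          ((ascPochhammer ℝ k).eval ((3 + α) / 2) * (ascPochhammer ℝ k).eval (1 / 2) *
            (Nat.factorial k : ℝ)) *
        (-x ^ 2 / 4) ^ k
    = (1 + α) * ((-1) ^ k * x ^ (2 * k) / ((2 * k).factorial : ℝ) * (1 / (α + 2 * k + 1))) := by
  have h1 : (ascPochhammer ℝ k).eval ((α + 1) / 2) * (α + 2 * k + 1) =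
      (1 + α) * (ascPochhammer ℝ k).eval ((3 + α) / 2) := by
    induction k with
    | zero => simp; ring
    | succ k ih =>
      rw [ascPochhammer_succ_eval, ascPochhammer_succ_eval, ← mul_assoc, ← ih]
      push_cast; ring
  have h2 : (ascPochhammer ℝ k).eval (1 / 2 : ℝ) * (Nat.factorial k : ℝ) * 4 ^ k = ((2 * k).factorial : ℝ) := by
    clear h1
    induction k with
    | zero => simp
    | succ k ih =>
      rw [ascPochhammer_succ_eval, show 2 * (k + 1) = 2 * k + 1 + 1 by ring, Nat.factorial_succ,
        Nat.factorial_succ, Nat.factorial_succ]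
      push_cast
      rw [← ih]
      ring
  have p1 : 0 < (ascPochhammer ℝ k).eval ((3 + α) / 2) := ascPochhammer_pos _ _ (by linarith)
  have p2 : 0 < (ascPochhammer ℝ k).eval (1 / 2 : ℝ) := ascPochhammer_pos _ _ (by norm_num)
  have p3 : 0 < α + 2 * k + 1 := by positivity
  rw [← h2, div_pow, neg_pow, ← pow_mul]
  have : (ascPochhammer ℝ k).eval ((α + 1) / 2) =
      (1 + α) * (ascPochhammer ℝ k).eval ((3 + α) / 2) / (α + 2 * k + 1) := by
    rw [← h1]; field_simp
  rw [this]
  generalize (ascPochhammer ℝ k).eval ((3 + α) / 2) = A at *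
  generalize (ascPochhammer ℝ k).eval (1 / 2 : ℝ) = B at *
  field_simp

lemma split_aux (α : ℝ) (h0 : 0 < α) (u : ℝ → ℝ) (hm : Measurable u) (M : ℝ) (hM : ∀ y, |u y| ≤ M)
    (x ε : ℝ) (hε : 0 < ε) :
    ∫ y in {y : ℝ | ε < |x - y|}, (u x - u y) / |x - y| ^ (1 + α)
      = ∫ z in Set.Ioi ε, (2 * u x - u (x + z) - u (x - z)) / z ^ (1 + α) := by
  have e1 := (volume.measurePreserving_sub_left x).setIntegral_preimage_emb
    (MeasurableEquiv.subLeft x).measurableEmbedding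
    (fun z => (u x - u (x - z)) / |z| ^ (1 + α)) {z : ℝ | ε < |z|}
  simp only [Set.preimage_ofPred_eq, sub_sub_cancel] at e1
  rw [e1]
  have hset : {z : ℝ | ε < |z|} = Set.Ioi ε ∪ Set.Iio (-ε) := by
    ext z
    simp only [Set.mem_ofPred_eq, lt_abs, Set.mem_union, Set.mem_Ioi, Set.mem_Iio]
    constructor <;> rintro (h | h) <;> first | (left; linarith) | (right; linarith)
  have key : ∀ v : ℝ → ℝ, Measurable v → (∀ y, |v y| ≤ M) →
      IntegrableOn (fun z => (u x - v z) / |z| ^ (1 + α)) (Set.Ioi ε) := by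
    intro v hv hvM
    refine Integrable.mono' (g := fun z => (2 * M) * z ^ (-(1 + α)))
      ((integrableOn_Ioi_rpow_of_lt (by linarith) hε).const_mul _) ?_ ?_
    · exact Measurable.aestronglyMeasurable (by fun_prop)
    · refine (ae_restrict_iff' measurableSet_Ioi).2 (.of_forall fun z hz => ?_)
      have hz : 0 < z := hε.trans hz
      rw [abs_of_pos hz, norm_div, norm_of_nonneg (rpow_nonneg hz.le _), rpow_neg hz.le, ← div_eq_mul_inv]
      gcongr
      refine (abs_sub _ _).trans ?_
      linarith [hM x, hvM z]
  have i1 := key (fun z => u (x - z)) (by fun_prop) (fun _ => hM _)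
  have i2 := key (fun z => u (x + z)) (by fun_prop) (fun _ => hM _)
  have i3 : IntegrableOn (fun z => (u x - u (x - z)) / |z| ^ (1 + α)) (Set.Iio (-ε)) := by
    rw [← (Measure.measurePreserving_neg (volume : Measure ℝ)).integrableOn_comp_preimage
      (Homeomorph.neg ℝ).measurableEmbedding]
    simpa [Function.comp_def] using i2
  have e3 : ∫ z in Set.Iio (-ε), (u x - u (x - z)) / |z| ^ (1 + α)
      = ∫ z in Set.Ioi ε, (u x - u (x + z)) / |z| ^ (1 + α) := by
    rw [← integral_Iic_eq_integral_Iio, ← integral_comp_neg_Ioi]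
    simp
  rw [hset, setIntegral_union _ measurableSet_Iio i1 i3, e3, ← integral_add i1 i2]
  · refine setIntegral_congr_fun measurableSet_Ioi fun z hz => ?_
    have hz : 0 < z := hε.trans hz
    simp only [abs_of_pos hz]
    ring
  · rw [Set.disjoint_left]
    intro z h1 h2
    simp only [Set.mem_Ioi, Set.mem_Iio] at h1 h2
    linarith

/-- For `α ∈ (0,2)` and the sinc-type function `u(y) = √(2/π) sin(y)/y`
(with `u(0) = √(2/π)`), for every `x ∈ ℝ` the principal value limit defining the fractional
Laplacian of `u` at `x` exists and equals
`(√2/((1+α)√π)) ₁F₂((α+1)/2; (3+α)/2, 1/2; -x²/4)`, the series converging absolutely. -/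
theorem fracLap_sinc_1d (α : ℝ) (hα : α ∈ Set.Ioo (0 : ℝ) 2)
    (u : ℝ → ℝ) (hu0 : u 0 = Real.sqrt (2 / Real.pi))
    (hu : ∀ y : ℝ, y ≠ 0 → u y = Real.sqrt (2 / Real.pi) * Real.sin y / y) (x : ℝ) :
    Summable (fun k : ℕ =>
      |(ascPochhammer ℝ k).eval ((α + 1) / 2) /
          ((ascPochhammer ℝ k).eval ((3 + α) / 2) * (ascPochhammer ℝ k).eval (1 / 2) *
            (Nat.factorial k : ℝ)) *
        (-x ^ 2 / 4) ^ k|) ∧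
    Tendsto
      (fun ε : ℝ => fracLapConst 1 α *
        ∫ y in {y : ℝ | ε < |x - y|}, (u x - u y) / |x - y| ^ (1 + α))
      (𝓝[>] 0)
      (𝓝 ((Real.sqrt 2 / ((1 + α) * Real.sqrt Real.pi)) *
        ∑' k : ℕ,
          (ascPochhammer ℝ k).eval ((α + 1) / 2) /
              ((ascPochhammer ℝ k).eval ((3 + α) / 2) * (ascPochhammer ℝ k).eval (1 / 2) *
                (Nat.factorial k : ℝ)) *
            (-x ^ 2 / 4) ^ k)) := by

  obtain ⟨h0, h2⟩ := hα
  obtain ⟨hs, hsum⟩ := series_aux α x h0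
  obtain ⟨hFi, hF⟩ := fubini_aux α x h0 h2
  obtain ⟨-, hK⟩ := K_integral α h0 h2
  simp only [coeff_aux α x h0]
  refine ⟨by simpa only [abs_mul] using (hs.mul_left |1 + α|), ?_⟩
  rw [tsum_mul_left, hsum]
  set c := Real.sqrt (2 / Real.pi) with hc
  have hcc : Real.sqrt 2 / ((1 + α) * Real.sqrt Real.pi) * ((1 + α) *
      ∫ t in Set.Ioc (0:ℝ) 1, t ^ α * cos (t * x)) = c * ∫ t in Set.Ioc (0:ℝ) 1, t ^ α * cos (t * x) := by
    rw [hc, sqrt_div zero_le_two]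
    have : 0 < √π := sqrt_pos.2 pi_pos
    generalize (∫ t in Set.Ioc (0:ℝ) 1, t ^ α * cos (t * x)) = J
    field_simp
  rw [hcc]
  have hu' : ∀ y, u y = c * ∫ t in Set.Ioc (0:ℝ) 1, cos (t * y) := by
    intro y
    rw [← intervalIntegral.integral_of_le zero_le_one]
    by_cases hy : y = 0
    · subst hy; simp [hu0]
    · rw [hu y hy, intervalIntegral.integral_comp_mul_right _ hy]
      simp
      ring
  have hci : ∀ y, IntegrableOn (fun t : ℝ => cos (t * y)) (Set.Ioc 0 1) := fun y =>
    (Continuous.integrableOn_Icc (by fun_prop)).mono_set Set.Ioc_subset_Icc_self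
  have hmeas : Measurable u := by
    have : u = fun y => c * sinc y := by
      funext y
      by_cases hy : y = 0
      · subst hy; simp [hu0]
      · rw [hu y hy, sinc_of_ne_zero hy]; ring
    rw [this]
    fun_prop
  have hbd : ∀ y, |u y| ≤ c := by
    intro y
    rw [hu' y, abs_mul, abs_of_nonneg (sqrt_nonneg _)]
    refine mul_le_of_le_one_right (sqrt_nonneg _) ?_
    have := norm_setIntegral_le_of_norm_le_const (μ := volume) (s := Set.Ioc (0:ℝ) 1) (C := 1)
      (f := fun t => cos (t * y)) (by simp) (fun t _ => abs_cos_le_one _)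
    simpa using this
  have hnum : ∀ z, (2 * u x - u (x + z) - u (x - z)) / z ^ (1 + α)
      = 2 * c * ∫ t in Set.Ioc (0:ℝ) 1, cos (t * x) * ((1 - cos (t * z)) / z ^ (1 + α)) := by
    intro z
    have : ∀ t, cos (t * x) * ((1 - cos (t * z)) / z ^ (1 + α)) =
        (2 * cos (t * x) - cos (t * (x + z)) - cos (t * (x - z))) / (2 * z ^ (1 + α)) := by
      intro t
      rw [mul_add, mul_sub, cos_add, cos_sub, ← div_div]
      ring
    have hs2 : IntegrableOn (fun t => 2 * cos (t * x) - cos (t * (x + z))) (Set.Ioc 0 1) :=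
      ((hci x).const_mul 2).sub (hci _)
    simp only [this]
    rw [integral_div, integral_sub hs2 (hci _),
      integral_sub ((hci x).const_mul 2) (hci _), integral_const_mul, hu' x, hu' (x + z), hu' (x - z),
      ← div_div]
    ring
  have hlim := ((aecover_Ioi_of_Ioi (μ := volume) (l := 𝓝[>] (0:ℝ)) (a := fun ε : ℝ => ε) (A := 0)
    (tendsto_id.mono_left nhdsWithin_le_nhds)).integral_tendsto_of_countably_generated hFi).const_mul
      (fracLapConst 1 α * (2 * c))
  rw [hF] at hlim
  have hval : fracLapConst 1 α * (2 * c) * ((∫ z in Set.Ioi 0, (1 - cos z) / z ^ (1 + α)) *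
      ∫ t in Set.Ioc (0:ℝ) 1, t ^ α * cos (t * x)) = c * ∫ t in Set.Ioc (0:ℝ) 1, t ^ α * cos (t * x) := by
    linear_combination (c * ∫ t in Set.Ioc (0:ℝ) 1, t ^ α * cos (t * x)) * hK
  rw [hval] at hlim
  refine hlim.congr' ?_
  filter_upwards [self_mem_nhdsWithin] with ε hε
  have hε : 0 < ε := hε
  rw [split_aux α h0 u hmeas c hbd x ε hε]
  simp only [hnum]
  rw [integral_const_mul, mul_assoc (fracLapConst 1 α), Measure.restrict_restrict measurableSet_Ioi,
    Set.inter_eq_left.2 (Set.Ioi_subset_Ioi hε.le)]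
end

section
/- For every real α ≥ 0 and every x ∈ ℝ³ with x ≠ 0, the Fourier-multiplier representation of (-Δ)^{α/2} applied to u(x) = (1 + |x|²)^{-2} evaluates in closed form: ∫_{ℝ³} (2π|ξ|)^α · π² e^{−2π|ξ|} · e^{2πi⟨x,ξ⟩} dξ = Γ(2+α) · (1 + |x|²)^{-(2+α)/2} · sin((2+α)·arctan|x|) / (2|x|); moreover at x = 0 the same integral equals Γ(3+α)/2. -/
open MeasureTheory Real RealInnerProductSpace

lemma aux_int (b c : ℝ) (hb : -1 < b) (hc : 0 < c) :
    IntegrableOn (fun t : ℝ => t ^ b * Real.exp (-(c * t))) (Set.Ioi 0) := by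
  simpa using integrableOn_rpow_mul_exp_neg_mul_rpow (p := 1) (s := b) (b := c) hb one_pos hc

lemma aux_norm (b : ℝ) (z : ℂ) {t : ℝ} (ht : 0 < t) :
    ‖((t ^ b : ℝ) : ℂ) * Complex.exp (-(z * t))‖ = t ^ b * Real.exp (-(z.re * t)) := by
  rw [norm_mul, Complex.norm_real, Complex.norm_exp, Real.norm_of_nonneg (by positivity)]
  simp

lemma aux_meas (b : ℝ) (z : ℂ) :
    Measurable (fun t : ℝ => ((t ^ b : ℝ) : ℂ) * Complex.exp (-(z * t))) := by
  fun_prop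

lemma aux_intC (b : ℝ) (hb : -1 < b) (z : ℂ) (hz : 0 < z.re) :
    IntegrableOn (fun t : ℝ => ((t ^ b : ℝ) : ℂ) * Complex.exp (-(z * t))) (Set.Ioi 0) := by
  refine Integrable.mono' (aux_int b z.re hb hz) (aux_meas b z).aestronglyMeasurable ?_
  refine (ae_restrict_iff' measurableSet_Ioi).2 (.of_forall fun t ht => ?_)
  exact (aux_norm b z ht).le

lemma aux_diff (b : ℝ) (hb : -1 < b) (z₀ : ℂ) (hz : 0 < z₀.re) :
    DifferentiableAt ℂ (fun z : ℂ => ∫ t in Set.Ioi (0:ℝ),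
      ((t ^ b : ℝ) : ℂ) * Complex.exp (-(z * t))) z₀ := by
  have := hasDerivAt_integral_of_dominated_loc_of_deriv_le (μ := volume.restrict (Set.Ioi (0:ℝ)))
    (F := fun (z : ℂ) (t : ℝ) => ((t ^ b : ℝ) : ℂ) * Complex.exp (-(z * t)))
    (F' := fun (z : ℂ) (t : ℝ) => ((t ^ b : ℝ) : ℂ) * (Complex.exp (-(z * t)) * (-t)))
    (x₀ := z₀) (s := Metric.ball z₀ (z₀.re / 2))
    (bound := fun t => t ^ (b + 1) * Real.exp (-(z₀.re / 2 * t)))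
    (Metric.ball_mem_nhds _ (by positivity))
    (.of_forall fun z => (aux_meas b z).aestronglyMeasurable)
    (aux_intC b hb z₀ hz)
    (by exact Measurable.aestronglyMeasurable (by fun_prop))
    ?_ (aux_int (b + 1) _ (by linarith) (by positivity)) ?_
  · exact this.2.differentiableAt
  · refine (ae_restrict_iff' measurableSet_Ioi).2 (.of_forall fun t ht z hz' => ?_)
    have ht : 0 < t := ht
    have h1 : z₀.re / 2 ≤ z.re := by
      have := (Complex.abs_re_le_norm (z - z₀)).trans_lt (by simpa [dist_eq_norm] using hz')
      rw [abs_lt, Complex.sub_re] at this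
      linarith [this.1]
    rw [← mul_assoc, norm_mul, aux_norm b z ht, norm_neg, Complex.norm_real,
      Real.norm_of_nonneg ht.le, Real.rpow_add_one ht.ne']
    have : Real.exp (-(z.re * t)) ≤ Real.exp (-(z₀.re / 2 * t)) := by gcongr
    calc _ = t ^ b * t * Real.exp (-(z.re * t)) := by ring
      _ ≤ _ := by gcongr
  · refine .of_forall fun t z _ => ?_
    have h : HasDerivAt (fun z : ℂ => -(z * t)) (-t) z := by
      have := (hasDerivAt_mul_const (t : ℂ) (x := z)).neg
      exact this
    exact (h.cexp).const_mul _

lemma laplace_gamma (a : ℝ) (ha : 0 < a) (z : ℂ) (hz : 0 < z.re) :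
    ∫ t in Set.Ioi (0:ℝ), ((t ^ (a - 1) : ℝ) : ℂ) * Complex.exp (-(z * t)) =
      z ^ (-(a : ℂ)) * (Real.Gamma a : ℂ) := by
  have hU : IsOpen {z : ℂ | 0 < z.re} := isOpen_lt continuous_const Complex.continuous_re
  have hA : AnalyticOnNhd ℂ (fun z : ℂ => ∫ t in Set.Ioi (0:ℝ),
      ((t ^ (a - 1) : ℝ) : ℂ) * Complex.exp (-(z * t))) {z : ℂ | 0 < z.re} :=
    DifferentiableOn.analyticOnNhd
      (fun w hw => (aux_diff (a - 1) (by linarith) w hw).differentiableWithinAt) hU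
  have hB : AnalyticOnNhd ℂ (fun z : ℂ => z ^ (-(a : ℂ)) * (Real.Gamma a : ℂ))
      {z : ℂ | 0 < z.re} := by
    refine DifferentiableOn.analyticOnNhd (fun w hw => ?_) hU
    refine DifferentiableAt.differentiableWithinAt ?_
    exact (differentiableAt_id.cpow_const (Or.inl hw)).mul_const _
  have hreal : ∀ r : ℝ, 0 < r → ∫ t in Set.Ioi (0:ℝ),
      ((t ^ (a - 1) : ℝ) : ℂ) * Complex.exp (-((r : ℂ) * t)) =
      (r : ℂ) ^ (-(a : ℂ)) * (Real.Gamma a : ℂ) := by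
    intro r hr
    have h := Real.integral_rpow_mul_exp_neg_mul_Ioi ha hr
    have h2 : ∀ t : ℝ, ((t ^ (a - 1) : ℝ) : ℂ) * Complex.exp (-((r : ℂ) * t)) =
      ((t ^ (a - 1) * Real.exp (-(r * t)) : ℝ) : ℂ) := by intro t; push_cast; rfl
    simp_rw [h2]
    rw [integral_complex_ofReal, h]
    rw [← Complex.ofReal_neg, ← Complex.ofReal_cpow hr.le, Real.rpow_neg hr.le, one_div,
      ← Real.inv_rpow hr.le, Complex.ofReal_mul]
  have hpre : IsPreconnected {z : ℂ | 0 < z.re} := (convex_halfSpace_re_gt 0).isPreconnected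
  refine hA.eqOn_of_preconnected_of_frequently_eq hB hpre (z₀ := 1) (by simp) ?_ hz
  have ht : Filter.Tendsto (fun r : ℝ => (r : ℂ)) (nhdsWithin 1 {1}ᶜ) (nhdsWithin 1 {1}ᶜ) := by
    refine tendsto_nhdsWithin_iff.2 ⟨?_, ?_⟩
    · exact (Complex.continuous_ofReal.tendsto' 1 1 (by simp)).mono_left nhdsWithin_le_nhds
    · filter_upwards [self_mem_nhdsWithin] with r hr
      simpa using hr
  refine ht.frequently (Filter.Eventually.frequently ?_)
  filter_upwards [nhdsWithin_le_nhds (Ioi_mem_nhds (zero_lt_one (α := ℝ)))] with r hr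
  exact hreal r hr

lemma radial_sin (a : ℝ) (ha : 0 < a) (s : ℝ) :
    ∫ t in Set.Ioi (0:ℝ), t ^ (a - 1) * Real.exp (-(2 * π * t)) * Real.sin (2 * π * s * t) =
      (2 * π) ^ (-a) * (1 + s ^ 2) ^ (-a / 2) * Real.sin (a * Real.arctan s) * Real.Gamma a := by
  set z : ℂ := 2 * π * (1 - Complex.I * s) with hzdef
  have hre : z.re = 2 * π := by simp [hzdef]
  have him : z.im = -(2 * π * s) := by simp [hzdef]
  have hz : 0 < z.re := by rw [hre]; positivity
  have h := congrArg Complex.im (laplace_gamma a ha z hz)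
  have hint := aux_intC (a - 1) (by linarith) z hz
  have hs : 0 < √(1 + s ^ 2) := by positivity
  have hzexp : z = Complex.exp ((Real.log (2 * π * √(1 + s ^ 2)) : ℝ) +
      (-Real.arctan s : ℝ) * Complex.I) := by
    rw [Complex.exp_add, Complex.exp_mul_I, ← Complex.ofReal_exp, Real.exp_log (by positivity),
      ← Complex.ofReal_cos, ← Complex.ofReal_sin, Real.cos_neg, Real.sin_neg, Real.cos_arctan,
      Real.sin_arctan]
    apply Complex.ext
    · rw [hre]; simp [-Complex.ofReal_mul]; field_simp
    · rw [him]; simp [-Complex.ofReal_mul]; field_simp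
  have hlog : Complex.log z = (Real.log (2 * π * √(1 + s ^ 2)) : ℝ) +
      (-Real.arctan s : ℝ) * Complex.I := by
    rw [hzexp, Complex.log_exp]
    · simp [-Complex.ofReal_arctan]; linarith [Real.arctan_lt_pi_div_two s, Real.pi_pos]
    · simp [-Complex.ofReal_arctan]; linarith [Real.neg_pi_div_two_lt_arctan s, Real.pi_pos]
  have hz0 : z ≠ 0 := by intro h0; rw [h0] at hz; simp at hz
  have hL : Complex.im (∫ t in Set.Ioi (0:ℝ), ((t ^ (a - 1) : ℝ) : ℂ) * Complex.exp (-(z * t))) =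
     ∫ t in Set.Ioi (0:ℝ), t ^ (a - 1) * Real.exp (-(2 * π * t)) * Real.sin (2 * π * s * t) := by
    have := integral_im (𝕜 := ℂ) hint
    refine Eq.trans this.symm ?_
    refine setIntegral_congr_fun measurableSet_Ioi fun t _ => ?_
    simp only [RCLike.im_to_complex, Complex.im_ofReal_mul, Complex.exp_im, Complex.neg_re,
      Complex.neg_im, Complex.re_mul_ofReal, Complex.im_mul_ofReal, hre, him]
    rw [← mul_assoc]; congr 2; ring
  rw [← hL, h, Complex.cpow_def_of_ne_zero hz0, hlog, Complex.im_mul_ofReal]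
  congr 1
  rw [Complex.exp_im]
  have e1 : (((Real.log (2 * π * √(1 + s ^ 2)) : ℝ) +
      (-Real.arctan s : ℝ) * Complex.I) * (-(a:ℂ))).re = Real.log (2 * π * √(1 + s ^ 2)) * (-a) := by
    simp [-Complex.ofReal_mul, -Complex.ofReal_arctan]
  have e2 : (((Real.log (2 * π * √(1 + s ^ 2)) : ℝ) +
      (-Real.arctan s : ℝ) * Complex.I) * (-(a:ℂ))).im = a * Real.arctan s := by
    simp [-Complex.ofReal_mul, -Complex.ofReal_arctan, mul_comm]
  rw [e1, e2]
  congr 1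
  rw [← Real.rpow_def_of_pos (by positivity), Real.mul_rpow (by positivity) (by positivity),
    Real.sqrt_eq_rpow, ← Real.rpow_mul (by positivity)]
  congr 2; ring

abbrev E3 := EuclideanSpace ℝ (Fin 3)
abbrev E2 := EuclideanSpace ℝ (Fin 2)

lemma exists_split (x : E3) (hx : x ≠ 0) : ∃ e : E3 ≃ᵐ ℝ × E2,
    MeasurePreserving e volume (volume.prod volume) ∧
    ∀ ξ, ⟪x, ξ⟫ = ‖x‖ * (e ξ).1 ∧ ‖ξ‖ = √((e ξ).1 ^ 2 + ‖(e ξ).2‖ ^ 2) := by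
  have hn : ‖x‖ ≠ 0 := norm_ne_zero_iff.2 hx
  obtain ⟨b, hb⟩ := Orthonormal.exists_orthonormalBasis_extension_of_card_eq (𝕜 := ℝ) (E := E3)
    (ι := Fin 3) (by simp) (v := fun _ => (‖x‖⁻¹ • x)) (s := {0}) (by
      rw [orthonormal_iff_ite]
      rintro ⟨i, rfl⟩ ⟨j, rfl⟩
      simp [norm_smul, hn])
  have hb0 : b 0 = ‖x‖⁻¹ • x := hb 0 rfl
  refine ⟨b.measurableEquiv.trans ((MeasurableEquiv.toLp 2 (Fin 3 → ℝ)).symm.trans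
    ((MeasurableEquiv.piFinSuccAbove (fun _ : Fin 3 => ℝ) 0).trans
      (MeasurableEquiv.prodCongr (MeasurableEquiv.refl ℝ) (MeasurableEquiv.toLp 2 (Fin 2 → ℝ))))),
      ?_, ?_⟩
  · refine b.measurePreserving_measurableEquiv.trans
      ((EuclideanSpace.volume_preserving_symm_measurableEquiv_toLp (Fin 3)).trans
      ((volume_preserving_piFinSuccAbove (fun _ : Fin 3 => ℝ) 0).trans ?_))
    exact (MeasurePreserving.id volume).prod (PiLp.volume_preserving_toLp (Fin 2))
  · intro ξ
    constructor
    · change ⟪x, ξ⟫ = ‖x‖ * b.repr ξ 0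
      rw [b.repr_apply_apply, hb0, inner_smul_left]
      simp; field_simp
    · rw [← b.repr.norm_map ξ, EuclideanSpace.norm_eq, EuclideanSpace.norm_sq_eq,
        Fin.sum_univ_succ, Real.norm_eq_abs, sq_abs]
      rfl

lemma integral_plane (g : ℝ → ℝ) (t : ℝ) :
    ∫ y : E2, g (√(t ^ 2 + ‖y‖ ^ 2)) = 2 * π * ∫ r in Set.Ioi |t|, r * g r := by
  rw [integral_fun_norm_addHaar volume (fun ρ => g (√(t ^ 2 + ρ ^ 2)))]
  have hball : (volume : Measure E2).real (Metric.ball 0 1) = π := by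
    simp [Measure.real, EuclideanSpace.volume_ball_fin_two, Real.pi_pos.le]
  have himg : (fun ρ : ℝ => √(t ^ 2 + ρ ^ 2)) '' Set.Ioi 0 = Set.Ioi |t| := by
    ext r
    constructor
    · rintro ⟨ρ, hρ, rfl⟩
      have hρ : 0 < ρ := hρ
      show |t| < _
      apply Real.lt_sqrt_of_sq_lt
      rw [sq_abs]; nlinarith
    · intro hr
      have hr : |t| < r := hr
      have h0 : 0 < r := (abs_nonneg t).trans_lt hr
      have h1 : 0 < r ^ 2 - t ^ 2 := by
        rw [← sq_abs t]; nlinarith [abs_nonneg t]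
      refine ⟨√(r ^ 2 - t ^ 2), Real.sqrt_pos.2 h1, ?_⟩
      simp only [Real.sq_sqrt h1.le]
      rw [add_sub_cancel, Real.sqrt_sq h0.le]
  have key := integral_image_eq_integral_abs_deriv_smul (s := Set.Ioi (0:ℝ))
    (f := fun ρ : ℝ => √(t ^ 2 + ρ ^ 2)) (f' := fun ρ => ρ / √(t ^ 2 + ρ ^ 2)) measurableSet_Ioi
    (by
      intro ρ hρ
      have hρ : 0 < ρ := hρ
      have h := (((hasDerivAt_pow 2 ρ).const_add (t ^ 2)).sqrt (by positivity)).hasDerivWithinAt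
        (s := Set.Ioi 0)
      have : 0 < √(t ^ 2 + ρ ^ 2) := by positivity
      have e : ρ / √(t ^ 2 + ρ ^ 2) =
          ((2 : ℕ) : ℝ) * ρ ^ (2 - 1) / (2 * √(t ^ 2 + ρ ^ 2)) := by
        norm_num
        field_simp
      rw [← e] at h
      exact h)
    (by
      intro a ha b hb hab
      have ha : 0 < a := ha
      have hb : 0 < b := hb
      have h : t ^ 2 + a ^ 2 = t ^ 2 + b ^ 2 :=
        (Real.sqrt_inj (by positivity) (by positivity)).1 hab
      exact (pow_left_inj₀ ha.le hb.le two_ne_zero).1 (by linarith))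
    (fun r => r * g r)
  rw [himg] at key
  rw [key, hball]
  simp only [finrank_euclideanSpace, Fintype.card_fin, smul_eq_mul, nsmul_eq_mul]
  rw [← mul_assoc]
  congr 1
  refine setIntegral_congr_fun measurableSet_Ioi fun ρ hρ => ?_
  have hρ : 0 < ρ := hρ
  have : 0 < √(t ^ 2 + ρ ^ 2) := by positivity
  rw [abs_of_pos (by positivity)]
  field_simp
  norm_num

lemma integral_exp_sym (s : ℝ) (hs : 0 < s) (r : ℝ) (hr : 0 < r) :
    ∫ t in Set.Ioo (-r) r, Complex.exp (2 * π * Complex.I * ((s * t : ℝ) : ℂ)) =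
      ((Real.sin (2 * π * s * r) / (π * s) : ℝ) : ℂ) := by
  have h1 : ∀ t : ℝ, Complex.exp (2 * π * Complex.I * ((s * t : ℝ) : ℂ)) =
    Complex.exp ((2 * π * s * Complex.I) * t) := by
    intro t; congr 1; push_cast; ring
  have hs' : (s : ℂ) ≠ 0 := by exact_mod_cast hs.ne'
  have hpi : (π : ℂ) ≠ 0 := by exact_mod_cast Real.pi_ne_zero
  simp_rw [h1]
  rw [← integral_Ioc_eq_integral_Ioo, ← intervalIntegral.integral_of_le (by linarith),
    integral_exp_mul_complex (by simp [hs.ne', Real.pi_ne_zero])]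
  push_cast
  rw [Complex.sin]
  have e1 : (2 * π * s * Complex.I) * ((r : ℝ) : ℂ) = (2 * π * s * r) * Complex.I := by ring
  have e2 : (2 * π * s * Complex.I) * (-(r : ℝ) : ℂ) = -(2 * π * s * r) * Complex.I := by ring
  rw [e1, e2]
  field_simp
  rw [Complex.I_sq]; ring

lemma radial_fourier (g : ℝ → ℝ) (hg : Measurable g)
    (hgi : IntegrableOn (fun r => r ^ 2 * g r) (Set.Ioi 0)) (x : E3) (hx : x ≠ 0)
    (hint : Integrable (fun ξ : E3 => (g ‖ξ‖ : ℂ) *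
      Complex.exp (2 * π * Complex.I * ((⟪x, ξ⟫ : ℝ) : ℂ)))) :
    ∫ ξ : E3, (g ‖ξ‖ : ℂ) * Complex.exp (2 * π * Complex.I * ((⟪x, ξ⟫ : ℝ) : ℂ)) =
    ((2 / ‖x‖ * ∫ r in Set.Ioi (0:ℝ), r * g r * Real.sin (2 * π * ‖x‖ * r) : ℝ) : ℂ) := by
  obtain ⟨e, he, hsp⟩ := exists_split x hx
  have hs : 0 < ‖x‖ := norm_pos_iff.2 hx
  set s := ‖x‖ with hsdef
  set H : ℝ × E2 → ℂ := fun p => (g (√(p.1 ^ 2 + ‖p.2‖ ^ 2)) : ℂ) *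
    Complex.exp (2 * π * Complex.I * ((s * p.1 : ℝ) : ℂ)) with hH
  have hHe : (fun ξ : E3 => (g ‖ξ‖ : ℂ) *
      Complex.exp (2 * π * Complex.I * ((⟪x, ξ⟫ : ℝ) : ℂ))) = H ∘ e := by
    funext ξ
    simp only [hH, Function.comp]
    rw [(hsp ξ).1, (hsp ξ).2]
  rw [hHe] at hint ⊢
  have hHint : Integrable H (volume.prod volume) :=
    (he.integrable_comp_emb e.measurableEmbedding).1 hint
  have h1 : ∫ ξ, (H ∘ e) ξ = ∫ p, H p ∂(volume.prod volume) := he.integral_comp' H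
  rw [h1, integral_prod _ hHint]
  set ph : ℝ → ℂ := fun t => Complex.exp (2 * π * Complex.I * ((s * t : ℝ) : ℂ)) with hph
  have hphn : ∀ t, ‖ph t‖ = 1 := by
    intro t
    rw [hph]; simp only [Complex.norm_exp]; simp
  have hphc : Continuous ph := by fun_prop
  set K : ℝ → ℝ → ℂ := fun t r => (Set.Ioi |t|).indicator
    (fun r => ((2 * π * (r * g r) : ℝ) : ℂ) * ph t) r with hK
  have hinner : ∀ t, ∫ y : E2, H (t, y) = ∫ r, K t r := by
    intro t
    simp only [hH, hK]
    rw [integral_mul_const, integral_complex_ofReal, integral_plane, integral_indicator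
      measurableSet_Ioi, integral_mul_const, integral_complex_ofReal, integral_const_mul]
  have hKeq : ∀ t r, K t r = (Set.Ioo (-r) r).indicator
      (fun t => ((2 * π * (r * g r) : ℝ) : ℂ) * ph t) t := by
    intro t r
    simp only [hK, Set.indicator, Set.mem_Ioi, Set.mem_Ioo, abs_lt]
  have hKm : Measurable (Function.uncurry K) := by
    have hset : MeasurableSet {p : ℝ × ℝ | |p.1| < p.2} :=
      measurableSet_lt (by fun_prop) (by fun_prop)
    have : Function.uncurry K = {p : ℝ × ℝ | |p.1| < p.2}.indicator
      (fun p => ((2 * π * (p.2 * g p.2) : ℝ) : ℂ) * ph p.1) := by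
      funext p; simp [hK, Function.uncurry, Set.indicator]
    rw [this]
    refine Measurable.indicator ?_ hset
    fun_prop
  have hKn : ∀ r, ∫ t, ‖K t r‖ = (Set.Ioi (0:ℝ)).indicator
      (fun r => 4 * π * ‖r ^ 2 * g r‖) r := by
    intro r
    simp_rw [hKeq, norm_indicator_eq_indicator_norm, norm_mul, hphn]
    rw [integral_indicator measurableSet_Ioo]
    simp only [mul_one, integral_const, MeasurableSet.univ, measureReal_restrict_apply, Set.univ_inter, Real.volume_real_Ioo]
    by_cases hr : 0 < r
    · rw [Set.indicator_of_mem (by exact hr), max_eq_left (by linarith), Complex.norm_real]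
      simp only [norm_mul, norm_pow, Real.norm_eq_abs, abs_of_pos hr, abs_of_pos Real.pi_pos, smul_eq_mul]
      norm_num; ring
    · rw [Set.indicator_of_notMem (by exact hr), max_eq_right (by linarith)]; simp
  have hKint : Integrable (Function.uncurry K) (volume.prod volume) := by
    rw [integrable_prod_iff' hKm.aestronglyMeasurable]
    constructor
    · refine .of_forall fun r => ?_
      simp only [Function.uncurry, hKeq]
      rw [integrable_indicator_iff measurableSet_Ioo]
      exact (Continuous.integrableOn_Icc (by fun_prop)).mono_set Set.Ioo_subset_Icc_self
    · simp only [Function.uncurry, hKn]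
      rw [integrable_indicator_iff measurableSet_Ioi]
      exact hgi.norm.const_mul _
  simp_rw [hinner]
  rw [integral_integral_swap hKint]
  have hout : ∀ r, ∫ t, K t r = (Set.Ioi (0:ℝ)).indicator
      (fun r => ((2 / s * (r * g r * Real.sin (2 * π * s * r)) : ℝ) : ℂ)) r := by
    intro r
    simp_rw [hKeq]
    rw [integral_indicator measurableSet_Ioo]
    by_cases hr : 0 < r
    · rw [Set.indicator_of_mem (by exact hr), integral_const_mul, hph,
        integral_exp_sym s hs r hr, ← Complex.ofReal_mul]
      congr 1
      field_simp
    · rw [Set.indicator_of_notMem (by exact hr), Set.Ioo_eq_empty (by linarith)]; simp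
  simp_rw [hout]
  rw [integral_indicator measurableSet_Ioi, integral_complex_ofReal, integral_const_mul]

/-- For every `α ≥ 0`, the Fourier-multiplier representation of `(-Δ)^{α/2}`
applied to `u(x) = (1+|x|²)^{-2}` on `ℝ³` (whose Fourier transform is `π² e^{-2π|ξ|}`)
converges absolutely and evaluates in closed form: for `x ≠ 0`,
`∫ (2π|ξ|)^α π² e^{-2π|ξ|} e^{2πi⟨x,ξ⟩} dξ = Γ(2+α)(1+|x|²)^{-(2+α)/2} sin((2+α) arctan|x|)/(2|x|)`,
and at `x = 0` the same integral equals `Γ(3+α)/2`. -/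
theorem fourier_multiplier_GIMQ_3d (α : ℝ) (hα : 0 ≤ α)
    (F : EuclideanSpace ℝ (Fin 3) → EuclideanSpace ℝ (Fin 3) → ℂ)
    (hF : ∀ x ξ, F x ξ =
      (((2 * Real.pi * ‖ξ‖) ^ α * (Real.pi ^ 2 * Real.exp (-(2 * Real.pi * ‖ξ‖))) : ℝ) : ℂ) *
        Complex.exp (2 * (Real.pi : ℂ) * Complex.I * ((⟪x, ξ⟫ : ℝ) : ℂ))) :
    (∀ x, Integrable (F x)) ∧
    (∀ x : EuclideanSpace ℝ (Fin 3), x ≠ 0 →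
      ∫ ξ, F x ξ =
        ((Real.Gamma (2 + α) * (1 + ‖x‖ ^ 2) ^ (-(2 + α) / 2) *
          Real.sin ((2 + α) * Real.arctan ‖x‖) / (2 * ‖x‖) : ℝ) : ℂ)) ∧
    (∫ ξ, F 0 ξ) = ((Real.Gamma (3 + α) / 2 : ℝ) : ℂ) := by
  set g : ℝ → ℝ := fun r => (2 * π * r) ^ α * (π ^ 2 * Real.exp (-(2 * π * r))) with hg
  have hgm : Measurable g := by fun_prop
  have hpow : ∀ (n : ℕ) (r : ℝ), 0 < r → r ^ n * g r =
      (2 * π) ^ α * π ^ 2 * (r ^ ((n + 1 + α) - 1) * Real.exp (-(2 * π * r))) := by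
    intro n r hr
    have : (n + 1 + α) - 1 = n + α := by ring
    simp only [hg]
    rw [this, Real.rpow_add hr, Real.rpow_natCast, Real.mul_rpow (by positivity) hr.le]
    ring
  have hgi : IntegrableOn (fun r => r ^ 2 * g r) (Set.Ioi 0) := by
    refine IntegrableOn.congr_fun ?_ (fun r hr => (hpow 2 r hr).symm) measurableSet_Ioi
    exact (aux_int _ _ (by push_cast; linarith) (by positivity)).const_mul _
  have hgE : Integrable (fun ξ : E3 => g ‖ξ‖) := by
    rw [integrable_fun_norm_addHaar]
    simpa using hgi
  have hFi : ∀ x, Integrable (F x) := by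
    intro x
    have hFx : F x = fun ξ => (g ‖ξ‖ : ℂ) *
      Complex.exp (2 * π * Complex.I * ((⟪x, ξ⟫ : ℝ) : ℂ)) := funext fun ξ => hF x ξ
    rw [hFx]
    refine Integrable.mono' hgE.norm ?_ ?_
    · exact Measurable.aestronglyMeasurable (by fun_prop)
    · refine .of_forall fun ξ => ?_
      rw [norm_mul, Complex.norm_real, Complex.norm_exp]
      simp
  refine ⟨hFi, ?_, ?_⟩
  · intro x hx
    have hFx : F x = fun ξ => (g ‖ξ‖ : ℂ) *
      Complex.exp (2 * π * Complex.I * ((⟪x, ξ⟫ : ℝ) : ℂ)) := funext fun ξ => hF x ξ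
    have hi := hFi x
    rw [hFx] at hi ⊢
    rw [radial_fourier g hgm hgi x hx hi]
    have hs : 0 < ‖x‖ := norm_pos_iff.2 hx
    congr 1
    have h1 : ∫ r in Set.Ioi (0:ℝ), r * g r * Real.sin (2 * π * ‖x‖ * r) =
        ∫ r in Set.Ioi (0:ℝ), (2 * π) ^ α * π ^ 2 * (r ^ ((2 + α) - 1) *
          Real.exp (-(2 * π * r)) * Real.sin (2 * π * ‖x‖ * r)) := by
      refine setIntegral_congr_fun measurableSet_Ioi fun r hr => ?_
      have := hpow 1 r hr
      have e : ((1:ℕ) + 1 + α : ℝ) = 2 + α := by push_cast; ring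
      rw [e, pow_one] at this
      simp only [this]; ring
    rw [h1, integral_const_mul, radial_sin (2 + α) (by linarith), Real.rpow_neg (by positivity),
      Real.rpow_add (by positivity), Real.rpow_two]
    have : (2 * π) ^ α ≠ 0 := by positivity
    field_simp
    try ring
  · have h0 : F 0 = fun ξ => ((g ‖ξ‖ : ℝ) : ℂ) := by
      funext ξ; rw [hF]; simp [hg]
    rw [h0, integral_complex_ofReal]
    congr 1
    rw [integral_fun_norm_addHaar volume g]
    have hball : (volume : Measure E3).real (Metric.ball 0 1) = π * 4 / 3 := by
      rw [Measure.real, EuclideanSpace.volume_ball_fin_three]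
      simp only [ENNReal.ofReal_one, one_pow, one_mul]
      exact ENNReal.toReal_ofReal (by positivity)
    have h1 : ∫ r in Set.Ioi (0:ℝ), r ^ 2 * g r =
        ∫ r in Set.Ioi (0:ℝ), (2 * π) ^ α * π ^ 2 * (r ^ ((3 + α) - 1) *
          Real.exp (-(2 * π * r))) := by
      refine setIntegral_congr_fun measurableSet_Ioi fun r hr => ?_
      have := hpow 2 r hr
      have e : ((2:ℕ) + 1 + α : ℝ) = 3 + α := by push_cast; ring
      rw [e] at this
      exact this
    rw [hball]
    simp only [finrank_euclideanSpace, Fintype.card_fin, smul_eq_mul, nsmul_eq_mul,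
      Nat.add_one_sub_one]
    rw [h1, integral_const_mul, Real.integral_rpow_mul_exp_neg_mul_Ioi (by linarith)
      (by positivity), one_div, Real.inv_rpow (by positivity),
      Real.rpow_add (by positivity)]
    have : (2 * π) ^ α ≠ 0 := by positivity
    have e3 : (2 * π) ^ (3:ℝ) = (2 * π) ^ 3 := by exact_mod_cast Real.rpow_natCast (2 * π) 3
    rw [e3]
    push_cast
    field_simp
    try ring
end
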